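/- Let d ≥ 3 and δ ∈ (2/3, 1). Let {A_T}_{T ∈ ℝ_{>0}} be a family of Borel subsets of ℝ^d with Lebesgue measure vol(A_T) = T and A_{T₁} ⊆ A_{T₂} whenever T₁ ≤ T₂. Let p₁, …, p_s be distinct primes, k₁, …, k_s ∈ ℕ, and N = p₁^{k₁}⋯p_s^{k_s}. Let v₀ ∈ ℤ^d have gcd of coordinates equal to 1, and set P_{v₀,N}(ℤ^d) = {v ∈ ℤ^d : gcd of the coordinates of v is 1, and v ≡ v₀ (mod N)}. Then for every left Haar measure ν on SL_d(ℝ), for ν-almost every g ∈ SL_d(ℝ) there exist C > 0 and T₀ > 0 such that for all T ≥ T₀: | #( g·P_{v₀,N}(ℤ^d) ∩ A_T ) − T/(N^d·ζ_S(d)) | ≤ C·T^δ. -/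

import Mathlib

open MeasureTheory Matrix ENNReal

noncomputable section

noncomputable instance Padic.instMeasurableSpace' {p : ℕ} [Fact p.Prime] :
    MeasurableSpace ℚ_[p] := borel _

instance Padic.instBorelSpace' {p : ℕ} [Fact p.Prime] : BorelSpace ℚ_[p] := ⟨rfl⟩

instance Matrix.SpecialLinearGroup.instTopologicalSpace'
    {n : Type*} [DecidableEq n] [Fintype n] {R : Type*} [CommRing R] [TopologicalSpace R] :
    TopologicalSpace (SpecialLinearGroup n R) :=
  show TopologicalSpace {A : Matrix n n R // A.det = 1} from inferInstance

noncomputable instance Matrix.SpecialLinearGroup.instMeasurableSpace'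
    {n : Type*} [DecidableEq n] [Fintype n] {R : Type*} [CommRing R] [TopologicalSpace R] :
    MeasurableSpace (SpecialLinearGroup n R) := borel _

/-- A finite set of distinct primes `p 0, …, p (s-1)`. -/
structure PrimeTup where
  s : ℕ
  p : Fin s → ℕ
  hp : ∀ i, (p i).Prime
  inj : Function.Injective p

namespace PrimeTup

instance (S : PrimeTup) (i : Fin S.s) : Fact (S.p i).Prime := ⟨S.hp i⟩

/-- The `p i`-adic field. -/
abbrev Qp (S : PrimeTup) (i : Fin S.s) : Type := ℚ_[S.p i]

/-- The space `ℚ_S^d = ℝ^d × ∏ᵢ ℚ_{pᵢ}^d`. -/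
abbrev QS (S : PrimeTup) (d : ℕ) : Type :=
  (Fin d → ℝ) × ((i : Fin S.s) → Fin d → S.Qp i)

/-- The ring `ℤ_S = ℤ[1/p₁, …, 1/p_s] ⊆ ℚ`. -/
def Zs (S : PrimeTup) : Subring ℚ :=
  Subring.closure (Set.range fun i : Fin S.s => ((S.p i : ℚ))⁻¹)

/-- The group `G_d = SL_d(ℝ) × ∏ᵢ SL_d(ℚ_{pᵢ})`. -/
abbrev G (S : PrimeTup) (d : ℕ) : Type :=
  SpecialLinearGroup (Fin d) ℝ × ((i : Fin S.s) → SpecialLinearGroup (Fin d) (S.Qp i))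

/-- Diagonal embedding of `SL_d(ℤ_S)` into `G_d`. -/
def toG (S : PrimeTup) (d : ℕ) : SpecialLinearGroup (Fin d) S.Zs →* S.G d :=
  MonoidHom.prod
    (SpecialLinearGroup.map ((Rat.castHom ℝ).comp S.Zs.subtype))
    (Pi.monoidHom fun i => SpecialLinearGroup.map ((Rat.castHom (S.Qp i)).comp S.Zs.subtype))

/-- The lattice `Γ_d`, the diagonally embedded copy of `SL_d(ℤ_S)` in `G_d`. -/
def Gamma (S : PrimeTup) (d : ℕ) : Subgroup (S.G d) := (S.toG d).range

/-- The componentwise linear action of `G_d` on `ℚ_S^d`. -/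
def act (S : PrimeTup) {d : ℕ} (g : S.G d) (x : S.QS d) : S.QS d :=
  ((g.1 : Matrix (Fin d) (Fin d) ℝ).mulVec x.1,
   fun i => ((g.2 i : Matrix (Fin d) (Fin d) (S.Qp i))).mulVec (x.2 i))

/-- Diagonal embedding of rational vectors into `ℚ_S^d`. -/
def diag (S : PrimeTup) {d : ℕ} (v : Fin d → ℚ) : S.QS d :=
  (fun j => (v j : ℝ), fun i j => (v j : S.Qp i))

/-- The first standard basis vector of `ℤ_S^d`. -/
def e1 (S : PrimeTup) (d : ℕ) : Fin d → S.Zs := fun j => if j.1 = 0 then 1 else 0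

/-- The set of `S`-primitive vectors `P(ℤ_S^d) = SL_d(ℤ_S)·e₁` inside `(ℤ_S)^d`. -/
def primZs (S : PrimeTup) (d : ℕ) : Set (Fin d → S.Zs) :=
  {w | ∃ γ : SpecialLinearGroup (Fin d) S.Zs,
    w = (γ : Matrix (Fin d) (Fin d) S.Zs).mulVec (S.e1 d)}

/-- The set of `S`-primitive vectors regarded inside `ℚ_S^d` via the diagonal embedding. -/
def prim (S : PrimeTup) (d : ℕ) : Set (S.QS d) :=
  (fun w : Fin d → S.Zs => S.diag fun j => ((w j : ℚ))) '' S.primZs d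

/-- Multiplication of a vector of `ℚ_S^d` by a (diagonally embedded) rational scalar. -/
def ratSMul (S : PrimeTup) {d : ℕ} (q : ℚ) (x : S.QS d) : S.QS d :=
  (fun j => (q : ℝ) * x.1 j, fun i j => (q : S.Qp i) * x.2 i j)

/-- `ℕ_S`: positive integers coprime to all the primes of `S`. -/
def NS (S : PrimeTup) : Set ℕ := {m | 0 < m ∧ ∀ i, ¬ (S.p i ∣ m)}

/-- The `S`-arithmetic zeta value `ζ_S(d)`. -/
def zetaS (S : PrimeTup) (d : ℕ) : ℝ := ∑' m : S.NS, (1 : ℝ) / ((m : ℕ) : ℝ) ^ d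

/-- The "unit box" `[0,1]^d × ∏ᵢ ℤ_{pᵢ}^d` used to normalize the volume on `ℚ_S^d`. -/
def unitBox (S : PrimeTup) (d : ℕ) : Set (S.QS d) :=
  {x | (∀ j, x.1 j ∈ Set.Icc (0:ℝ) 1) ∧ ∀ i j, ‖x.2 i j‖ ≤ 1}

/-- `v` is the measure `vol_S` on `ℚ_S^d`: the (unique) translation-invariant regular Borel
measure giving the unit box `[0,1]^d × ∏ᵢ ℤ_{pᵢ}^d` measure one; equivalently, the product of
Lebesgue measure on `ℝ^d` and the normalized Haar measures on the `ℚ_{pᵢ}^d`. -/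
def IsVolS (S : PrimeTup) (d : ℕ) (v : Measure (S.QS d)) : Prop :=
  v.IsAddHaarMeasure ∧ v.Regular ∧ v (S.unitBox d) = 1

/-- `μ` is an admissible measure on `G_d/Γ_d`: a regular Borel probability measure invariant
under the left `G_d`-action. -/
def Admissible (S : PrimeTup) (d : ℕ) (μ : Measure (S.G d ⧸ S.Gamma d)) : Prop :=
  IsProbabilityMeasure μ ∧ μ.Regular ∧ SMulInvariantMeasure (S.G d) (S.G d ⧸ S.Gamma d) μ

end PrimeTup

end

/-! ### Topological and measurable structure of `SL_d(ℝ)` -/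

/-- The real special linear group of size `d`. -/
abbrev SLR (d : ℕ) : Type := SpecialLinearGroup (Fin d) ℝ

namespace SLR

variable {d : ℕ}

theorem isClosedEmbedding_coe :
    Topology.IsClosedEmbedding (fun g : SLR d => (g : Matrix (Fin d) (Fin d) ℝ)) :=
  Matrix.SpecialLinearGroup.isClosedEmbedding_val

instance : IsTopologicalGroup (SLR d) :=
  Matrix.SpecialLinearGroup.topologicalGroup (n := Fin d) (R := ℝ)

instance : SecondCountableTopology (SLR d) :=
  have : SecondCountableTopology (Matrix (Fin d) (Fin d) ℝ) :=
    inferInstanceAs (SecondCountableTopology (Fin d → Fin d → ℝ))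
  isClosedEmbedding_coe.isEmbedding.secondCountableTopology

instance : LocallyCompactSpace (SLR d) :=
  have : LocallyCompactSpace (Matrix (Fin d) (Fin d) ℝ) :=
    inferInstanceAs (LocallyCompactSpace (Fin d → Fin d → ℝ))
  isClosedEmbedding_coe.locallyCompactSpace

instance : BorelSpace (SLR d) := ⟨rfl⟩

theorem smul_def (g : SLR d) (x : Fin d → ℝ) :
    g • x = (g : Matrix (Fin d) (Fin d) ℝ).mulVec x := rfl

theorem continuous_smul_fun : Continuous fun p : SLR d × (Fin d → ℝ) => p.1 • p.2 := by
  have h : Continuous fun p : SLR d × (Fin d → ℝ) => (p.1 : Matrix (Fin d) (Fin d) ℝ) :=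
    isClosedEmbedding_coe.continuous.comp continuous_fst
  exact h.matrix_mulVec continuous_snd

instance : ContinuousSMul (SLR d) (Fin d → ℝ) := ⟨continuous_smul_fun⟩

instance : MeasurableSMul₂ (SLR d) (Fin d → ℝ) := ⟨continuous_smul_fun.measurable⟩

theorem measurePreserving_smul (g : SLR d) :
    MeasurePreserving (fun x : Fin d → ℝ => g • x) := by
  refine ⟨(continuous_const_smul g).measurable, ?_⟩
  have h : (g : Matrix (Fin d) (Fin d) ℝ).det = 1 := g.2
  have := Real.map_matrix_volume_pi_eq_smul_volume_pi (M := (g : Matrix (Fin d) (Fin d) ℝ))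
    (by rw [h]; exact one_ne_zero)
  rw [h, inv_one, abs_one, ofReal_one, one_smul] at this
  exact this

instance : SMulInvariantMeasure (SLR d) (Fin d → ℝ) volume :=
  ⟨fun g _ hs => (measurePreserving_smul g).measure_preimage hs.nullMeasurableSet⟩

end SLR

/-! ### Uniqueness of invariant measures on homogeneous spaces -/

section Homogeneous

variable {G Y : Type*} [Group G] [MeasurableSpace G] [MeasurableSpace Y] [MulAction G Y]
  [MeasurableSMul₂ G Y] (θ : Measure G) [SigmaFinite θ] (m : Measure Y) [SigmaFinite m]

theorem lintegral_measure_smul_mem [SMulInvariantMeasure G Y m] {E : Set Y}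
    (hE : MeasurableSet E) :
    ∫⁻ y, θ {g | g • y ∈ E} ∂m = θ Set.univ * m E := by
  have hmeas : MeasurableSet {p : G × Y | p.1 • p.2 ∈ E} := measurable_smul hE
  have h1 : (θ.prod m) {p : G × Y | p.1 • p.2 ∈ E} = ∫⁻ y, θ {g | g • y ∈ E} ∂m :=
    Measure.prod_apply_symm hmeas
  have h2 : (θ.prod m) {p : G × Y | p.1 • p.2 ∈ E} = ∫⁻ g, m {y | g • y ∈ E} ∂θ :=
    Measure.prod_apply hmeas
  have h3 : ∀ g : G, m {y | g • y ∈ E} = m E := fun g =>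
      SMulInvariantMeasure.measure_preimage_smul g hE
  rw [← h1, h2]
  simp [h3, mul_comm]

omit [MeasurableSpace Y] [MeasurableSMul₂ G Y] [SigmaFinite θ] in
theorem measure_smul_smul_mem [MeasurableMul G] [θ.IsMulRightInvariant] (h : G) (o : Y)
    (E : Set Y) : θ {g | g • h • o ∈ E} = θ {g | g • o ∈ E} := by
  have := measure_preimage_mul_right θ h {g | g • o ∈ E}
  rw [← this]
  simp [Set.preimage, mul_smul]

variable {θ m}

theorem absolutelyContinuous_of_transitive [MeasurableMul G] [θ.IsMulRightInvariant]
    (hθ : θ ≠ 0) {ℓ : Measure Y} [SigmaFinite ℓ] [SMulInvariantMeasure G Y m]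
    [SMulInvariantMeasure G Y ℓ] (hℓ : ℓ ≠ 0) (o : Y)
    (hom : ∀ᵐ y ∂m, ∃ h : G, y = h • o) (hoℓ : ∀ᵐ y ∂ℓ, ∃ h : G, y = h • o) : m ≪ ℓ := by
  refine Measure.AbsolutelyContinuous.mk fun E hE hE0 => ?_
  have h1 := lintegral_measure_smul_mem θ ℓ hE
  have hmE : Measurable fun y : Y => θ {g : G | g • y ∈ E} :=
    measurable_measure_prodMk_right (measurable_smul hE)
  rw [hE0, mul_zero, lintegral_eq_zero_iff hmE] at h1
  have : (ae ℓ).NeBot := ae_neBot.2 hℓ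
  obtain ⟨y, hy, h, rfl⟩ := (h1.and hoℓ).exists
  have h0 : θ {g | g • o ∈ E} = 0 := by
    rw [← measure_smul_smul_mem θ h]; exact hy
  have h2 := lintegral_measure_smul_mem θ m hE
  have h3 : ∫⁻ y, θ {g | g • y ∈ E} ∂m = 0 := by
    rw [lintegral_congr_ae (g := fun _ => 0), lintegral_zero]
    filter_upwards [hom] with y hy
    obtain ⟨h, rfl⟩ := hy
    rw [measure_smul_smul_mem, h0]
  rw [h3] at h2
  exact (mul_eq_zero.1 h2.symm).resolve_left (by simpa using hθ)

theorem exists_eq_smul_of_transitive [MeasurableMul G] [θ.IsMulRightInvariant]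
    (hθ : θ ≠ 0) {ℓ : Measure Y} [SigmaFinite ℓ] [SMulInvariantMeasure G Y m]
    [SMulInvariantMeasure G Y ℓ] (hℓ : ℓ ≠ 0) (o : Y)
    (hom : ∀ᵐ y ∂m, ∃ h : G, y = h • o) (hoℓ : ∀ᵐ y ∂ℓ, ∃ h : G, y = h • o) :
    ∃ c : ℝ≥0∞, c ≠ ∞ ∧ m = c • ℓ := by
  have hac : m ≪ ℓ := absolutelyContinuous_of_transitive hθ hℓ o hom hoℓ
  set ρ := m.rnDeriv ℓ with hρ
  have hρm : Measurable ρ := Measure.measurable_rnDeriv m ℓ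
  have hwd : ℓ.withDensity ρ = m := Measure.withDensity_rnDeriv_eq m ℓ hac
  have hpres : ∀ g : G, MeasurePreserving (fun y : Y => g • y) ℓ ℓ :=
    fun g => measurePreserving_smul g ℓ
  have hpresm : ∀ g : G, MeasurePreserving (fun y : Y => g • y) m m :=
    fun g => measurePreserving_smul g m
  have hinv : ∀ g : G, ∀ᵐ y ∂ℓ, ρ (g • y) = ρ y := by
    intro g
    have hgm : Measurable fun y => ρ (g • y) := hρm.comp (hpres g).measurable
    have : ℓ.withDensity (fun y => ρ (g • y)) = ℓ.withDensity ρ := by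
      ext E hE
      have hE' : MeasurableSet ((fun y : Y => g⁻¹ • y) ⁻¹' E) := (hpres g⁻¹).measurable hE
      have hEE : (fun y : Y => g • y) ⁻¹' ((fun y : Y => g⁻¹ • y) ⁻¹' E) = E := by
        ext y; simp
      rw [withDensity_apply _ hE]
      conv_lhs => rw [← hEE]
      rw [(hpres g).setLIntegral_comp_preimage hE' hρm, ← withDensity_apply _ hE', hwd,
        (hpresm g⁻¹).measure_preimage hE.nullMeasurableSet]
    exact (withDensity_eq_iff_of_sigmaFinite hgm.aemeasurable hρm.aemeasurable).1 this
  have hset : MeasurableSet {p : G × Y | ρ (p.1 • p.2) = ρ p.2} :=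
    measurableSet_eq_fun (hρm.comp measurable_smul) (hρm.comp measurable_snd)
  have hae : ∀ᵐ y ∂ℓ, ∀ᵐ g ∂θ, ρ (g • y) = ρ y := by
    have h1 : ∀ᵐ p ∂(θ.prod ℓ), ρ (p.1 • p.2) = ρ p.2 :=
      (Measure.ae_prod_iff_ae_ae hset).2 (Filter.Eventually.of_forall hinv)
    have h2 : ∀ᵐ p ∂(ℓ.prod θ), ρ (p.2 • p.1) = ρ p.1 := by
      rw [← Measure.prod_swap] at h1
      exact ae_of_ae_map measurable_swap.aemeasurable h1
    exact Measure.ae_ae_of_ae_prod h2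
  have hae' : ∀ᵐ y ∂ℓ, ∀ᵐ g ∂θ, ρ (g • o) = ρ y := by
    filter_upwards [hae, hoℓ] with y hy ho
    obtain ⟨h, rfl⟩ := ho
    have := measure_smul_smul_mem θ h o {z | ¬ ρ z = ρ (h • o)}
    rw [ae_iff] at hy ⊢
    exact this.symm.trans hy
  have : (ae ℓ).NeBot := ae_neBot.2 hℓ
  have : (ae θ).NeBot := ae_neBot.2 hθ
  obtain ⟨y₀, hy₀, hfin⟩ := (hae'.and (Measure.rnDeriv_lt_top m ℓ)).exists
  refine ⟨ρ y₀, hfin.ne, ?_⟩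
  have hconst : ρ =ᵐ[ℓ] fun _ => ρ y₀ := by
    filter_upwards [hae'] with y hy
    obtain ⟨g, h1, h2⟩ := (hy.and hy₀).exists
    exact h1.symm.trans h2
  rw [← hwd, withDensity_congr_ae hconst, withDensity_const]

end Homogeneous

section NullTransfer

variable {G : Type*} [Group G] [MeasurableSpace G] [MeasurableMul₂ G]

/-- A set which is null for a nonzero right-invariant measure is null for every left-invariant
measure. -/
theorem null_of_null_right {θ ν : Measure G} [SigmaFinite θ] [SigmaFinite ν]
    [θ.IsMulRightInvariant] [ν.IsMulLeftInvariant] (hθ : θ ≠ 0) {E : Set G} (hE : θ E = 0) :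
    ν E = 0 := by
  set F := toMeasurable θ E
  have hF : MeasurableSet F := measurableSet_toMeasurable _ _
  have hF0 : θ F = 0 := by rw [measure_toMeasurable, hE]
  have h := lintegral_measure_smul_mem (Y := G) θ ν hF
  have h0 : ∀ y : G, θ {g | g • y ∈ F} = 0 := fun y => by
    have := measure_preimage_mul_right θ y F
    rw [hF0] at this; exact this
  simp only [h0, lintegral_zero] at h
  refine measure_mono_null (subset_toMeasurable θ E) ?_
  exact (mul_eq_zero.1 h.symm).resolve_left (by simpa using hθ)

end NullTransfer

/-! ### A bi-invariant measure on `SL_d(ℝ)` -/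

/-- Real `d × d` arrays; an array `B` lists the vectors `B 0, …, B (d-1)` of `ℝ^d`. -/
abbrev Arr (d : ℕ) : Type := Fin d → Fin d → ℝ

/-- The determinant of an array. -/
def Arr.det {d : ℕ} (B : Arr d) : ℝ := (Matrix.of B).det

theorem Arr.continuous_det {d : ℕ} : Continuous (Arr.det (d := d)) := by
  unfold Arr.det
  exact Continuous.matrix_det (A := fun B : Arr d => Matrix.of B) continuous_id

theorem Arr.measurable_det {d : ℕ} : Measurable (Arr.det (d := d)) :=
  Arr.continuous_det.measurable

theorem Arr.det_smul {d : ℕ} (c : ℝ) (B : Arr d) : (c • B).det = c ^ d * B.det := by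
  have := Matrix.det_smul (Matrix.of B) c
  simpa [Arr.det] using this

namespace SLR

variable {d : ℕ}

/-- The array of columns of an element of `SL_d(ℝ)`. -/
def cols (g : SLR d) : Arr d := fun j i => (g : Matrix (Fin d) (Fin d) ℝ) i j

theorem smul_apply (g : SLR d) (x : Fin d → ℝ) (i : Fin d) :
    (g • x) i = ∑ k, (g : Matrix (Fin d) (Fin d) ℝ) i k * x k := rfl

theorem coe_mul_apply (g h : SLR d) (i j : Fin d) :
    ((g * h : SLR d) : Matrix (Fin d) (Fin d) ℝ) i j =
      ∑ k, (g : Matrix (Fin d) (Fin d) ℝ) i k * (h : Matrix (Fin d) (Fin d) ℝ) k j := by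
  exact Matrix.mul_apply (M := g.1) (N := h.1)

theorem cols_mul (g h : SLR d) : cols (g * h) = fun j => g • cols h j := by
  ext j i
  exact coe_mul_apply g h i j

theorem det_cols (g : SLR d) : (cols g).det = 1 := by
  have : Matrix.of (cols g) = (g : Matrix (Fin d) (Fin d) ℝ)ᵀ := rfl
  rw [Arr.det, this, Matrix.det_transpose]; exact g.2

theorem isClosedEmbedding_cols : Topology.IsClosedEmbedding (cols (d := d)) :=
  (Homeomorph.isClosedEmbedding
    { toFun := fun A : Matrix (Fin d) (Fin d) ℝ => (Aᵀ : Matrix (Fin d) (Fin d) ℝ)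
      invFun := fun A => Aᵀ
      left_inv := fun _ => rfl
      right_inv := fun _ => rfl
      continuous_toFun := continuous_id.matrix_transpose
      continuous_invFun := continuous_id.matrix_transpose }).comp isClosedEmbedding_coe

theorem measurableEmbedding_cols : MeasurableEmbedding (cols (d := d)) :=
  isClosedEmbedding_cols.measurableEmbedding

theorem cols_injective : Function.Injective (cols (d := d)) := isClosedEmbedding_cols.injective

/-- The element of `SL_d(ℝ)` whose columns are proportional to `B`, for `det B > 0`. -/
noncomputable def nrm [NeZero d] (B : Arr d) : SLR d :=
  if h : 0 < B.det then
    ⟨(Matrix.of ((B.det ^ (-(1 / d : ℝ))) • B))ᵀ, by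
      have h0 : (d : ℝ) ≠ 0 := Nat.cast_ne_zero.2 (NeZero.ne d)
      rw [Matrix.det_transpose]
      change Arr.det _ = 1
      rw [Arr.det_smul, ← Real.rpow_natCast, ← Real.rpow_mul h.le, neg_mul,
        one_div_mul_cancel h0, Real.rpow_neg_one, inv_mul_cancel₀ h.ne']⟩
  else 1

theorem cols_nrm [NeZero d] {B : Arr d} (h : 0 < B.det) :
    cols (nrm B) = (B.det ^ (-(1 / d : ℝ))) • B := by
  have : nrm B = _ := dif_pos h
  rw [this]; rfl

theorem nrm_eq_of_cols [NeZero d] {B : Arr d} (h : 0 < B.det) {g : SLR d}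
    (hg : cols g = (B.det ^ (-(1 / d : ℝ))) • B) : nrm B = g :=
  cols_injective ((cols_nrm h).trans hg.symm)

theorem measurable_nrm [NeZero d] : Measurable (nrm (d := d)) := by
  rw [← measurableEmbedding_cols.measurable_comp_iff]
  have h : (cols ∘ nrm : Arr d → Arr d) =
      fun B => if 0 < B.det then (B.det ^ (-(1 / d : ℝ))) • B else cols 1 := by
    funext B
    split_ifs with h
    · exact cols_nrm h
    · exact congrArg cols (dif_neg h)
  rw [h]
  refine Measurable.ite (measurableSet_lt measurable_const Arr.measurable_det) ?_
    measurable_const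
  exact (Arr.measurable_det.pow_const _).smul measurable_id

/-- The arrays used to define the invariant measure. -/
def cone (d : ℕ) : Set (Arr d) := {B | 0 < B.det ∧ B.det ≤ 1}

theorem measurableSet_cone : MeasurableSet (cone d) :=
  (measurableSet_lt measurable_const Arr.measurable_det).inter
    (measurableSet_le Arr.measurable_det measurable_const)

/-- A bi-invariant measure on `SL_d(ℝ)`. -/
noncomputable def haar (d : ℕ) [NeZero d] : Measure (SLR d) := (volume.restrict (cone d)).map nrm

theorem lintegral_haar [NeZero d] {f : SLR d → ℝ≥0∞} (hf : Measurable f) :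
    ∫⁻ g, f g ∂haar d = ∫⁻ B in cone d, f (nrm B) := by
  rw [haar, lintegral_map hf measurable_nrm]

theorem map_haar_eq [NeZero d] {φ : SLR d → SLR d} {Φ : Arr d → Arr d} (hφ : Measurable φ)
    (hΦ : MeasurePreserving Φ) (hdet : ∀ B, (Φ B).det = B.det)
    (hcomm : ∀ B, 0 < B.det → nrm (Φ B) = φ (nrm B)) : (haar d).map φ = haar d := by
  have hpre : Φ ⁻¹' (cone d) = cone d := by
    ext B; simp [cone, hdet]
  have h1 : MeasurePreserving Φ (volume.restrict (cone d)) (volume.restrict (cone d)) := by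
    have := hΦ.restrict_preimage (measurableSet_cone (d := d))
    rwa [hpre] at this
  rw [haar, Measure.map_map hφ measurable_nrm]
  conv_rhs => rw [← h1.map_eq, Measure.map_map measurable_nrm hΦ.measurable]
  refine Measure.map_congr ?_
  filter_upwards [ae_restrict_mem measurableSet_cone] with B hB
  exact (hcomm B hB.1).symm

instance [NeZero d] : (haar d).IsMulLeftInvariant := by
  refine ⟨fun g => ?_⟩
  have hdet : ∀ B : Arr d, Arr.det (fun j => g • B j) = B.det := fun B => by
    have h : Matrix.of (fun j => g • B j) = Matrix.of B * (g : Matrix (Fin d) (Fin d) ℝ)ᵀ := by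
      ext j i
      rw [Matrix.mul_apply]
      exact (smul_apply g (B j) i).trans
        (Finset.sum_congr rfl fun k _ => mul_comm (g.1 i k) (B j k))
    rw [Arr.det, h, Matrix.det_mul, Matrix.det_transpose]
    have : (g : Matrix (Fin d) (Fin d) ℝ).det = 1 := g.2
    rw [this, mul_one]; rfl
  refine map_haar_eq (Φ := fun B j => g • B j) (measurable_const_mul g)
    (volume_preserving_pi fun _ => measurePreserving_smul g) hdet ?_
  · intro B hB
    refine nrm_eq_of_cols (by rwa [hdet]) ?_
    rw [cols_mul, cols_nrm hB, hdet]
    ext j i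
    simp [smul_comm]

theorem measurePreserving_swap :
    MeasurePreserving (fun (B : Arr d) i j => B j i) := by
  let f : Arr d →ₗ[ℝ] Arr d :=
    { toFun := fun B i j => B j i, map_add' := fun _ _ => rfl, map_smul' := fun _ _ => rfl }
  have hff : f ∘ₗ f = LinearMap.id := rfl
  have hdet : LinearMap.det f * LinearMap.det f = 1 := by
    rw [← LinearMap.det_comp, hff, LinearMap.det_id]
  have habs : |LinearMap.det f| = 1 := by
    have : |LinearMap.det f| * |LinearMap.det f| = 1 := by rw [← abs_mul, hdet, abs_one]
    nlinarith [abs_nonneg (LinearMap.det f)]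
  have h0 : LinearMap.det f ≠ 0 := fun h => by simp [h] at habs
  have := Measure.map_linearMap_addHaar_eq_smul_addHaar (volume : Measure (Arr d)) h0
  rw [abs_inv, habs, inv_one, ofReal_one, one_smul] at this
  exact ⟨(LinearMap.continuous_of_finiteDimensional f).measurable, this⟩

instance [NeZero d] : (haar d).IsMulRightInvariant := by
  refine ⟨fun g => ?_⟩
  let gt : SLR d := ⟨(g : Matrix (Fin d) (Fin d) ℝ)ᵀ, by rw [Matrix.det_transpose]; exact g.2⟩
  have hdet : ∀ B : Arr d, Arr.det (fun j i => (gt • fun k => B k i) j) = B.det := fun B => by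
    have h : Matrix.of (fun j i => (gt • fun k => B k i) j) =
        (g : Matrix (Fin d) (Fin d) ℝ)ᵀ * Matrix.of B := by
      ext j i
      rw [Matrix.mul_apply]; rfl
    rw [Arr.det, h, Matrix.det_mul, Matrix.det_transpose]
    have : (g : Matrix (Fin d) (Fin d) ℝ).det = 1 := g.2
    rw [this, one_mul]; rfl
  refine map_haar_eq (Φ := fun B j i => (gt • fun k => B k i) j) (measurable_mul_const g)
    ?_ hdet ?_
  · exact (measurePreserving_swap.comp
      (volume_preserving_pi fun _ => measurePreserving_smul gt)).comp measurePreserving_swap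
  · intro B hB
    refine nrm_eq_of_cols (by rwa [hdet]) ?_
    rw [hdet]
    ext j i
    have h1 : ∀ k, (nrm B : Matrix (Fin d) (Fin d) ℝ) i k =
        (B.det ^ (-(1 / d : ℝ))) * B k i := fun k => congrFun (congrFun (cols_nrm hB) k) i
    refine (coe_mul_apply _ _ i j).trans ?_
    change _ = _ * ((gt • fun k => B k i) j)
    rw [smul_apply, Finset.mul_sum]
    refine Finset.sum_congr rfl fun k _ => ?_
    rw [h1]; simp only [gt, Matrix.transpose_apply]; ring

theorem haar_ne_zero [NeZero d] : haar d ≠ 0 := by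
  intro h
  have h1 : haar d Set.univ = 0 := by rw [h]; rfl
  rw [haar, Measure.map_apply measurable_nrm MeasurableSet.univ, Set.preimage_univ,
    Measure.restrict_apply_univ] at h1
  have hopen : IsOpen {B : Arr d | 0 < B.det ∧ B.det < 1} :=
    (isOpen_lt continuous_const Arr.continuous_det).inter
      (isOpen_lt Arr.continuous_det continuous_const)
  have hne : {B : Arr d | 0 < B.det ∧ B.det < 1}.Nonempty := by
    refine ⟨(1 / 2 : ℝ) • cols 1, ?_⟩
    rw [Set.mem_ofPred_eq, Arr.det_smul, det_cols, mul_one]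
    exact ⟨by positivity, pow_lt_one₀ (by norm_num) (by norm_num) (NeZero.ne d)⟩
  exact (hopen.measure_pos volume hne).ne'
    (measure_mono_null (fun B (hB : 0 < B.det ∧ B.det < 1) =>
      show B ∈ cone d from ⟨hB.1, hB.2.le⟩) h1)

theorem one_le_det_rpow [NeZero d] {B : Arr d} (hB : B ∈ cone d) :
    1 ≤ B.det ^ (-(1 / d : ℝ)) := by
  apply Real.one_le_rpow_of_pos_of_le_one_of_nonpos hB.1 hB.2
  rw [neg_nonpos]; positivity

instance [NeZero d] : SigmaFinite (haar d) := by
  refine ⟨⟨⟨fun n : ℕ => {g | ‖cols g‖ ≤ n}, fun _ => trivial, fun n => ?_, ?_⟩⟩⟩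
  · have hm : MeasurableSet {g : SLR d | ‖cols g‖ ≤ n} :=
      measurableSet_le measurableEmbedding_cols.measurable.norm measurable_const
    rw [haar, Measure.map_apply measurable_nrm hm, Measure.restrict_apply (measurable_nrm hm)]
    refine (measure_mono ?_).trans_lt
      (measure_closedBall_lt_top (x := (0 : Arr d)) (r := (n : ℝ)))
    rintro B ⟨h1, h2⟩
    rw [Set.mem_preimage, Set.mem_ofPred_eq, cols_nrm h2.1, norm_smul, Real.norm_eq_abs] at h1
    have h3 := one_le_det_rpow h2
    rw [abs_of_pos (by positivity)] at h1
    rw [mem_closedBall_zero_iff]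
    nlinarith [norm_nonneg B]
  · refine Set.eq_univ_of_forall fun g => Set.mem_iUnion.2 ?_
    exact ⟨⌈‖cols g‖⌉₊, show ‖cols g‖ ≤ _ from Nat.le_ceil _⟩

end SLR

/-! ### Integral changes of basis -/

/-- Every integer vector is an integer multiple of the first column of a matrix in `SL(ℤ)`. -/
theorem exists_sl_first_col {n : ℕ} (v : Fin (n + 1) → ℤ) :
    ∃ γ : SpecialLinearGroup (Fin (n + 1)) ℤ, ∃ k : ℤ,
      ∀ j, v j = k * (γ : Matrix (Fin (n + 1)) (Fin (n + 1)) ℤ) j 0 := by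
  by_cases hv : v = 0
  · exact ⟨1, 0, by simp [hv]⟩
  obtain ⟨m, snf⟩ := Submodule.smithNormalForm (Pi.basisFun ℤ (Fin (n + 1))) (Submodule.span ℤ {v})
  obtain ⟨b, j₀, k, hk⟩ : ∃ b : Module.Basis (Fin (n + 1)) ℤ (Fin (n + 1) → ℤ), ∃ j₀, ∃ k : ℤ,
      v = k • b j₀ := by
    let w : Submodule.span ℤ {v} := ⟨v, Submodule.mem_span_singleton_self v⟩
    have hw : w ≠ 0 := fun h => hv (congrArg Subtype.val h)
    have hd : ∀ u : Submodule.span ℤ {v}, ∃ c : ℤ, u = c • w := fun u => by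
      obtain ⟨c, hc⟩ := Submodule.mem_span_singleton.1 u.2
      exact ⟨c, Subtype.ext hc.symm⟩
    obtain ⟨i, hi⟩ : ∃ i, snf.bN.repr w i ≠ 0 := by
      by_contra! h
      exact hw (snf.bN.repr.map_eq_zero_iff.1 (Finsupp.ext h))
    obtain ⟨c, hc⟩ := hd (snf.bN i)
    have hc0 : c ≠ 0 := by
      rintro rfl
      exact snf.bN.ne_zero i (by rw [hc, zero_smul])
    have hrepr : ∀ l, l ≠ i → snf.bN.repr w l = 0 := fun l hl => by
      have h1 : snf.bN.repr (snf.bN i) l = c * snf.bN.repr w l := by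
        conv_lhs => rw [hc]
        simp
      rw [snf.bN.repr_self, Finsupp.single_eq_of_ne hl] at h1
      exact (mul_eq_zero.1 h1.symm).resolve_left hc0
    have hw' : w = snf.bN.repr w i • snf.bN i := by
      conv_lhs => rw [← snf.bN.sum_repr w]
      exact Finset.sum_eq_single i (fun l _ hl => by rw [hrepr l hl, zero_smul]) (by simp)
    refine ⟨snf.bM, snf.f i, snf.bN.repr w i * snf.a i, ?_⟩
    have := congrArg Subtype.val hw'
    rw [Submodule.coe_smul, snf.snf, smul_smul] at this
    exact this
  let b' := b.reindex (Equiv.swap 0 j₀)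
  have hb' : b' 0 = b j₀ := by simp [b']
  let M : Matrix (Fin (n + 1)) (Fin (n + 1)) ℤ := fun i j => b' j i
  have hM : M = (Pi.basisFun ℤ (Fin (n + 1))).toMatrix b' := by
    ext i j; simp [M, Module.Basis.toMatrix_apply]
  have hu : IsUnit M.det := by
    rw [hM]
    have : (Pi.basisFun ℤ (Fin (n + 1))).toMatrix b' * b'.toMatrix (Pi.basisFun ℤ (Fin (n + 1)))
      = 1 := Module.Basis.toMatrix_mul_toMatrix_flip _ _
    exact IsUnit.of_mul_eq_one _ (by rw [← Matrix.det_mul, this, Matrix.det_one])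
  have hu2 : M.det * M.det = 1 := Int.isUnit_mul_self hu
  refine ⟨⟨M.updateCol 0 (M.det • fun i => M i 0), ?_⟩, k * M.det, fun j => ?_⟩
  · rw [Matrix.det_updateCol_smul]
    have : M.updateCol 0 (fun i => M i 0) = M := Matrix.updateCol_eq_self M 0
    rw [this, hu2]
  · have : v j = k * M j 0 := by
      rw [hk]; simp [M, hb']
    simp only [Matrix.updateCol_self, Pi.smul_apply, smul_eq_mul]
    rw [this]
    linear_combination (-k * M j 0) * hu2

/-! ### Change of basis on arrays -/

namespace Arr

variable {n : ℕ}

/-- The integer combination of the vectors of `B` with coefficients `v`. -/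
def lat (B : Arr n) (v : Fin n → ℤ) : Fin n → ℝ := ∑ k, (v k : ℝ) • B k

theorem lat_apply (B : Arr n) (v : Fin n → ℤ) (i : Fin n) :
    lat B v i = ∑ k, (v k : ℝ) * B k i := by simp [lat]

/-- Change of basis of an array by an integral matrix. -/
def chg (B : Arr n) (γ : SpecialLinearGroup (Fin n) ℤ) : Arr n :=
  fun j => lat B fun k => (γ : Matrix (Fin n) (Fin n) ℤ) k j

theorem chg_apply (B : Arr n) (γ : SpecialLinearGroup (Fin n) ℤ) (j i : Fin n) :
    chg B γ j i = ∑ k, ((γ : Matrix (Fin n) (Fin n) ℤ) k j : ℝ) * B k i := lat_apply _ _ _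

theorem of_chg (B : Arr n) (γ : SpecialLinearGroup (Fin n) ℤ) :
    Matrix.of (chg B γ) =
      ((γ : Matrix (Fin n) (Fin n) ℤ).map (Int.cast : ℤ → ℝ))ᵀ * Matrix.of B := by
  ext j i
  rw [Matrix.mul_apply]
  exact chg_apply B γ j i

theorem chg_mul (B : Arr n) (γ γ' : SpecialLinearGroup (Fin n) ℤ) :
    chg B (γ * γ') = chg (chg B γ) γ' := by
  apply Matrix.of.injective
  rw [of_chg, of_chg, of_chg, ← Matrix.mul_assoc, ← Matrix.transpose_mul]
  have h : (γ.1 * γ'.1).map (Int.cast : ℤ → ℝ) = γ.1.map Int.cast * γ'.1.map Int.cast :=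
    Matrix.map_mul (f := Int.castRingHom ℝ)
  exact congrArg (fun A => Aᵀ * Matrix.of B) h

theorem det_chg (B : Arr n) (γ : SpecialLinearGroup (Fin n) ℤ) : (chg B γ).det = B.det := by
  have h : ((γ : Matrix (Fin n) (Fin n) ℤ).map (Int.cast : ℤ → ℝ)).det = 1 := by
    have := (SpecialLinearGroup.map (Int.castRingHom ℝ) γ).2
    exact this
  rw [det, of_chg, Matrix.det_mul, Matrix.det_transpose, h, one_mul]; rfl

theorem exists_short_vector (B : Arr (n + 1)) (hB : B.det ≠ 0) :
    ∃ v : Fin (n + 1) → ℤ, v ≠ 0 ∧ ‖lat B v‖ ^ (n + 1) ≤ |B.det| := by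
  have hli : LinearIndependent ℝ B :=
    Matrix.linearIndependent_rows_of_det_ne_zero (A := Matrix.of B) hB
  let b : Module.Basis (Fin (n + 1)) ℝ (Fin (n + 1) → ℝ) :=
    basisOfLinearIndependentOfCardEqFinrank hli (by simp)
  have hb : (b : Fin (n + 1) → Fin (n + 1) → ℝ) = B :=
    coe_basisOfLinearIndependentOfCardEqFinrank hli (by simp)
  set r : ℝ := |B.det| ^ (1 / (n + 1 : ℕ) : ℝ) with hr
  have hr0 : 0 ≤ r := by positivity
  have hrn : r ^ (n + 1) = |B.det| := by
    rw [hr, ← Real.rpow_natCast, ← Real.rpow_mul (abs_nonneg _), one_div_mul_cancel (by positivity),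
      Real.rpow_one]
  have : Countable (Submodule.span ℤ (Set.range b)).toAddSubgroup :=
    inferInstanceAs (Countable (Submodule.span ℤ (Set.range b)))
  obtain ⟨x, hx0, hx⟩ := exists_ne_zero_mem_lattice_of_measure_mul_two_pow_le_measure
    (μ := volume) (s := Metric.closedBall (0 : Fin (n + 1) → ℝ) r)
    (ZSpan.isAddFundamentalDomain' b volume) (by simp) (convex_closedBall _ _)
    (isCompact_closedBall _ _) (by
      rw [ZSpan.volume_fundamentalDomain, Real.volume_pi_closedBall _ hr0, hb, Fintype.card_fin,
        mul_pow, hrn, ofReal_mul (by positivity), mul_comm, ofReal_pow (by norm_num)]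
      simp [det])
  have hxm : (x : Fin (n + 1) → ℝ) ∈ Submodule.span ℤ (Set.range b) := x.2
  obtain ⟨c, hc⟩ := (Submodule.mem_span_range_iff_exists_fun ℤ).1 hxm
  have hlat : lat B c = x := by
    rw [← hc, lat, hb]
    exact Finset.sum_congr rfl fun k _ => by ext; simp
  refine ⟨c, ?_, ?_⟩
  · rintro rfl
    apply hx0
    ext1
    rw [← hlat]; simp [lat]
  · rw [hlat, ← hrn]
    exact pow_le_pow_left₀ (norm_nonneg _) (mem_closedBall_zero_iff.1 hx) _

end Arr

/-! ### Reduction theory -/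

namespace Arr

variable {n : ℕ}

/-- Size of the later vectors of `B` in the direction of the first one, measured on
coordinate `i`. -/
noncomputable def tc (i : Fin (n + 1)) (B : Arr (n + 1)) (j : Fin n) : ℝ := B j.succ i / B 0 i

/-- The later vectors of `B`, projected along the first one to the hyperplane `x_i = 0`. -/
noncomputable def yc (i : Fin (n + 1)) (B : Arr (n + 1)) : Arr n :=
  fun j k => B j.succ (i.succAbove k) - tc i B j * B 0 (i.succAbove k)

/-- Arrays which are reduced relative to their first vector and whose projection is in `H`. -/
def lift (H : Set (Arr n)) : Set (Arr (n + 1)) :=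
  {B | ∃ i, B 0 i ≠ 0 ∧ (∀ k, |B 0 k| ≤ |B 0 i|) ∧ (∀ j, |tc i B j| ≤ 1 / 2) ∧ yc i B ∈ H}

/-- A reduced set of arrays. -/
def red : (n : ℕ) → Set (Arr n)
  | 0 => Set.univ
  | n + 1 => lift (red n) ∩ {B | ‖B 0‖ ^ (n + 1) ≤ |B.det|}

theorem abs_det (i : Fin (n + 1)) (B : Arr (n + 1)) (hi : B 0 i ≠ 0) :
    |B.det| = |B 0 i| * |(yc i B).det| := by
  let C : Matrix (Fin (n + 1)) (Fin (n + 1)) ℝ :=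
    Matrix.of (Fin.cons (B 0) fun j k => B j.succ k - tc i B j * B 0 k)
  have h1 : (Matrix.of B).det = C.det := by
    refine Matrix.det_eq_of_forall_row_eq_smul_add_const (Fin.cons 0 (tc i B)) 0 rfl ?_
    intro j k
    refine Fin.cases ?_ (fun j => ?_) j
    · simp [C]
    · simp [C]
  rw [det, h1, Matrix.det_succ_column C i, Fin.sum_univ_succ, Finset.sum_eq_zero, add_zero]
  · rw [abs_mul, abs_mul, abs_pow, abs_neg, abs_one, one_pow, one_mul]
    rfl
  · intro j _
    have : C j.succ i = 0 := by
      simp [C, tc, div_mul_cancel₀ _ hi]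
    rw [this]; ring

theorem exists_max_coord {x : Fin (n + 1) → ℝ} (hx : x ≠ 0) :
    ∃ i, x i ≠ 0 ∧ ∀ k, |x k| ≤ |x i| := by
  obtain ⟨i, -, hi⟩ := Finset.exists_max_image Finset.univ (fun k => |x k|) Finset.univ_nonempty
  refine ⟨i, fun h => hx ?_, fun k => hi k (Finset.mem_univ k)⟩
  ext k
  have := hi k (Finset.mem_univ k)
  rw [h, abs_zero] at this
  exact abs_nonpos_iff.1 this

theorem first_ne_zero {B : Arr (n + 1)} (hB : B.det ≠ 0) : B 0 ≠ 0 := fun h =>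
  hB (Matrix.det_eq_zero_of_row_eq_zero (A := Matrix.of B) 0 (congrFun h))

/-- The block matrix with first column the first basis vector, first row `(1, m)` and lower right
block `γ`. -/
def blockSL (m : Fin n → ℤ) (γ : SpecialLinearGroup (Fin n) ℤ) :
    SpecialLinearGroup (Fin (n + 1)) ℤ :=
  ⟨Matrix.of (Fin.cons (Fin.cons 1 m) fun k => Fin.cons 0 (γ.1 k)), by
    rw [Matrix.det_succ_column_zero, Fin.sum_univ_succ, Finset.sum_eq_zero]
    · have h : γ.1.det = 1 := γ.2
      simp only [Fin.val_zero, pow_zero, one_mul, add_zero, Matrix.of_apply, Fin.cons_zero]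
      exact h
    · intro j _; simp⟩

theorem blockSL_zero_zero (m : Fin n → ℤ) (γ : SpecialLinearGroup (Fin n) ℤ) :
    (blockSL m γ).1 0 0 = 1 := rfl

theorem blockSL_succ_zero (m : Fin n → ℤ) (γ : SpecialLinearGroup (Fin n) ℤ) (k : Fin n) :
    (blockSL m γ).1 k.succ 0 = 0 := rfl

theorem blockSL_zero_succ (m : Fin n → ℤ) (γ : SpecialLinearGroup (Fin n) ℤ) (j : Fin n) :
    (blockSL m γ).1 0 j.succ = m j := rfl

theorem blockSL_succ_succ (m : Fin n → ℤ) (γ : SpecialLinearGroup (Fin n) ℤ) (k j : Fin n) :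
    (blockSL m γ).1 k.succ j.succ = γ.1 k j := rfl

theorem chg_blockSL_zero (B : Arr (n + 1)) (m : Fin n → ℤ) (γ : SpecialLinearGroup (Fin n) ℤ) :
    chg B (blockSL m γ) 0 = B 0 := by
  ext i
  rw [chg_apply, Fin.sum_univ_succ, blockSL_zero_zero, Finset.sum_eq_zero]
  · simp
  · intro k _; rw [blockSL_succ_zero]; simp

theorem chg_blockSL_succ (B : Arr (n + 1)) (m : Fin n → ℤ) (γ : SpecialLinearGroup (Fin n) ℤ)
    (j : Fin n) (i : Fin (n + 1)) :
    chg B (blockSL m γ) j.succ i = m j * B 0 i + ∑ k : Fin n, (γ.1 k j : ℝ) * B k.succ i := by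
  rw [chg_apply, Fin.sum_univ_succ, blockSL_zero_succ]
  simp only [blockSL_succ_succ]

theorem tc_chg_blockSL {i : Fin (n + 1)} {B : Arr (n + 1)} (hi : B 0 i ≠ 0) (m : Fin n → ℤ)
    (γ : SpecialLinearGroup (Fin n) ℤ) (j : Fin n) :
    tc i (chg B (blockSL m γ)) j = m j + ∑ k : Fin n, (γ.1 k j : ℝ) * tc i B k := by
  rw [tc, chg_blockSL_succ, chg_blockSL_zero, add_div, mul_div_cancel_right₀ _ hi, Finset.sum_div]
  simp only [tc, mul_div_assoc]

theorem yc_chg_blockSL {i : Fin (n + 1)} {B : Arr (n + 1)} (hi : B 0 i ≠ 0) (m : Fin n → ℤ)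
    (γ : SpecialLinearGroup (Fin n) ℤ) :
    yc i (chg B (blockSL m γ)) = chg (yc i B) γ := by
  ext j k
  rw [yc, tc_chg_blockSL hi, chg_blockSL_succ, chg_blockSL_zero, chg_apply]
  simp only [yc, mul_sub, Finset.sum_sub_distrib, add_mul, Finset.sum_mul, mul_assoc]
  ring

theorem exists_blockSL_mem_lift {H : Set (Arr n)} {i : Fin (n + 1)} {B : Arr (n + 1)}
    (hi : B 0 i ≠ 0) (hmax : ∀ k, |B 0 k| ≤ |B 0 i|) {γ : SpecialLinearGroup (Fin n) ℤ}
    (hγ : chg (yc i B) γ ∈ H) : ∃ m, chg B (blockSL m γ) ∈ lift H := by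
  refine ⟨fun j => -round (∑ k : Fin n, (γ.1 k j : ℝ) * tc i B k), i, ?_, ?_, fun j => ?_, ?_⟩
  · rwa [chg_blockSL_zero]
  · rwa [chg_blockSL_zero]
  · rw [tc_chg_blockSL hi, Int.cast_neg, neg_add_eq_sub]
    exact abs_sub_round _
  · rwa [yc_chg_blockSL hi]

theorem det_yc_ne_zero {i : Fin (n + 1)} {B : Arr (n + 1)} (hB : B.det ≠ 0) (hi : B 0 i ≠ 0) :
    (yc i B).det ≠ 0 := fun h => hB (by
  have := abs_det i B hi
  rwa [h, abs_zero, mul_zero, abs_eq_zero] at this)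

theorem exists_chg_mem_lift {H : Set (Arr n)}
    (hH : ∀ Y : Arr n, Y.det ≠ 0 → ∃ γ : SpecialLinearGroup (Fin n) ℤ, chg Y γ ∈ H)
    {B : Arr (n + 1)} (hB : B.det ≠ 0) : ∃ m γ, chg B (blockSL m γ) ∈ lift H := by
  obtain ⟨i, hi, hmax⟩ := exists_max_coord (first_ne_zero hB)
  obtain ⟨γ, hγ⟩ := hH _ (det_yc_ne_zero hB hi)
  obtain ⟨m, hm⟩ := exists_blockSL_mem_lift hi hmax hγ
  exact ⟨m, γ, hm⟩

theorem lat_smul_col (B : Arr (n + 1)) (γ : SpecialLinearGroup (Fin (n + 1)) ℤ) {k : ℤ}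
    {v : Fin (n + 1) → ℤ} (hv : ∀ j, v j = k * γ.1 j 0) : lat B v = (k : ℝ) • chg B γ 0 := by
  ext i
  rw [lat_apply, Pi.smul_apply, chg_apply, smul_eq_mul, Finset.mul_sum]
  refine Finset.sum_congr rfl fun j _ => ?_
  rw [hv]; push_cast; ring

theorem exists_chg_mem_red {n : ℕ} (B : Arr n) (hB : B.det ≠ 0) :
    ∃ γ : SpecialLinearGroup (Fin n) ℤ, chg B γ ∈ red n := by
  induction n with
  | zero => exact ⟨1, trivial⟩
  | succ n ih =>
    obtain ⟨v, hv0, hv⟩ := exists_short_vector B hB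
    obtain ⟨γ, k, hk⟩ := exists_sl_first_col v
    have hk0 : k ≠ 0 := by
      rintro rfl
      exact hv0 (funext fun j => by simp [hk j])
    have hk1 : (1 : ℝ) ≤ ‖(k : ℝ)‖ := by
      rw [Real.norm_eq_abs]; exact_mod_cast Int.one_le_abs hk0
    have hdet : (chg B γ).det ≠ 0 := by rwa [det_chg]
    obtain ⟨m, γ', h'⟩ := exists_chg_mem_lift (fun Y hY => ih Y hY) hdet
    refine ⟨γ * blockSL m γ', ?_⟩
    rw [chg_mul]
    refine ⟨h', ?_⟩
    change ‖chg (chg B γ) (blockSL m γ') 0‖ ^ (n + 1) ≤ |(chg (chg B γ) (blockSL m γ')).det|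
    rw [det_chg, det_chg, chg_blockSL_zero]
    refine le_trans (pow_le_pow_left₀ (norm_nonneg _) ?_ _) hv
    rw [lat_smul_col B γ hk, norm_smul]
    exact le_mul_of_one_le_left (norm_nonneg _) hk1

/-! Invariance under scaling. -/

theorem tc_smul {c : ℝ} (hc : c ≠ 0) (i : Fin (n + 1)) (B : Arr (n + 1)) :
    tc i (c • B) = tc i B := by
  ext j; exact mul_div_mul_left _ _ hc

theorem yc_smul {c : ℝ} (hc : c ≠ 0) (i : Fin (n + 1)) (B : Arr (n + 1)) :
    yc i (c • B) = c • yc i B := by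
  ext j k
  simp only [yc, tc_smul hc, Pi.smul_apply, smul_eq_mul]; ring

/-- A set of arrays which is stable under nonzero scaling. -/
def IsCone (H : Set (Arr n)) : Prop := ∀ c : ℝ, c ≠ 0 → ∀ B, c • B ∈ H ↔ B ∈ H

theorem IsCone.lift {H : Set (Arr n)} (hH : IsCone H) : IsCone (lift H) := by
  intro c hc B
  refine exists_congr fun i => ?_
  have hc' : 0 < |c| := abs_pos.2 hc
  simp only [Pi.smul_apply, smul_eq_mul, abs_mul, tc_smul hc, yc_smul hc, hH c hc, ne_eq,
    mul_eq_zero, hc, false_or, mul_le_mul_iff_of_pos_left hc']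

theorem isCone_red : ∀ n, IsCone (red n)
  | 0 => fun _ _ _ => Iff.rfl
  | n + 1 => fun c hc B => by
    refine and_congr ((isCone_red n).lift c hc B) ?_
    change ‖c • B 0‖ ^ (n + 1) ≤ |(c • B).det| ↔ ‖B 0‖ ^ (n + 1) ≤ |B.det|
    rw [det_smul, norm_smul, mul_pow, abs_mul, abs_pow, Real.norm_eq_abs,
      mul_le_mul_iff_of_pos_left (pow_pos (abs_pos.2 hc) _)]

/-! Measurability. -/

theorem measurable_entry (j i : Fin n) : Measurable fun B : Arr n => B j i :=
  (measurable_pi_apply i).comp (measurable_pi_apply j)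

theorem measurable_tc (i : Fin (n + 1)) (j : Fin n) :
    Measurable fun B : Arr (n + 1) => tc i B j :=
  (measurable_entry _ _).div (measurable_entry _ _)

theorem measurable_yc (i : Fin (n + 1)) : Measurable (yc i) :=
  measurable_pi_lambda _ fun j => measurable_pi_lambda _ fun _ =>
    (measurable_entry _ _).sub ((measurable_tc i j).mul (measurable_entry _ _))

/-- The part of `lift H` with a prescribed maximal coordinate of the first vector. -/
def liftAt (i : Fin (n + 1)) (H : Set (Arr n)) : Set (Arr (n + 1)) :=
  {B | B 0 i ≠ 0 ∧ (∀ k, |B 0 k| ≤ |B 0 i|) ∧ (∀ j, |tc i B j| ≤ 1 / 2) ∧ yc i B ∈ H}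

theorem lift_eq_iUnion (H : Set (Arr n)) : lift H = ⋃ i, liftAt i H := by
  ext B; simp [lift, liftAt]

theorem measurableSet_liftAt (i : Fin (n + 1)) {H : Set (Arr n)} (hH : MeasurableSet H) :
    MeasurableSet (liftAt i H) := by
  refine MeasurableSet.inter ?_ (MeasurableSet.inter ?_ (MeasurableSet.inter ?_ ?_))
  · exact measurable_entry 0 i (measurableSet_singleton 0).compl
  · have h : {B : Arr (n + 1) | ∀ k, |B 0 k| ≤ |B 0 i|} =
        ⋂ k, {B : Arr (n + 1) | |B 0 k| ≤ |B 0 i|} := by ext; simp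
    change MeasurableSet {B : Arr (n + 1) | ∀ k, |B 0 k| ≤ |B 0 i|}
    rw [h]
    exact MeasurableSet.iInter fun k =>
      measurableSet_le (measurable_entry 0 k).norm (measurable_entry 0 i).norm
  · have h : {B : Arr (n + 1) | ∀ j, |tc i B j| ≤ 1 / 2} =
        ⋂ j, {B : Arr (n + 1) | |tc i B j| ≤ 1 / 2} := by ext; simp
    change MeasurableSet {B : Arr (n + 1) | ∀ j, |tc i B j| ≤ 1 / 2}
    rw [h]
    exact MeasurableSet.iInter fun j =>
      measurableSet_le (measurable_tc i j).norm measurable_const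
  · exact measurable_yc i hH

theorem measurableSet_lift {H : Set (Arr n)} (hH : MeasurableSet H) : MeasurableSet (lift H) := by
  rw [lift_eq_iUnion]
  exact MeasurableSet.iUnion fun i => measurableSet_liftAt i hH

theorem measurableSet_red : ∀ n, MeasurableSet (red n)
  | 0 => MeasurableSet.univ
  | n + 1 => (measurableSet_lift (measurableSet_red n)).inter
      (measurableSet_le ((measurable_pi_apply (0 : Fin (n + 1))).norm.pow_const _)
        measurable_det.norm)

end Arr

/-! ### Volumes of reduced sets -/

namespace Arr

variable {n : ℕ}

/-- Separate the first vector, the `i`-th coordinates, and the remaining entries of an array. -/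
def split (i : Fin (n + 1)) (B : Arr (n + 1)) : (Fin (n + 1) → ℝ) × (Fin n → ℝ) × Arr n :=
  (B 0, fun j => B j.succ i, fun j k => B j.succ (i.succAbove k))

theorem measurePreserving_split (i : Fin (n + 1)) : MeasurePreserving (split (n := n) i) := by
  have h1 := volume_preserving_piFinSuccAbove (fun _ : Fin (n + 1) => Fin (n + 1) → ℝ) 0
  have h2 : MeasurePreserving (fun (Z : Fin n → Fin (n + 1) → ℝ) j =>
      MeasurableEquiv.piFinSuccAbove (fun _ : Fin (n + 1) => ℝ) i (Z j)) :=
    volume_preserving_pi fun _ => volume_preserving_piFinSuccAbove (fun _ : Fin (n + 1) => ℝ) i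
  have h3 := volume_measurePreserving_arrowProdEquivProdArrow ℝ (Fin n → ℝ) (Fin n)
  exact ((MeasurePreserving.id _).prod (h3.comp h2)).comp h1

/-- The arrays which are reduced with respect to the `i`-th coordinate of their first vector. -/
def sizeReduced (i : Fin (n + 1)) : Set (Arr (n + 1)) := {B | B 0 i ≠ 0 ∧ ∀ j, |tc i B j| ≤ 1 / 2}

theorem lintegral_reduced_le (i : Fin (n + 1)) {φ : (Fin (n + 1) → ℝ) × Arr n → ℝ≥0∞}
    (hφ : Measurable φ) :
    ∫⁻ B : Arr (n + 1), (sizeReduced i).indicator (fun B => φ (B 0, yc i B)) B ≤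
    ∫⁻ b, ENNReal.ofReal |b i| ^ n * ∫⁻ y, φ (b, y) := by
  let f : (Fin (n + 1) → ℝ) × (Fin n → ℝ) × Arr n → ℝ≥0∞ := fun p =>
    {p : (Fin (n + 1) → ℝ) × (Fin n → ℝ) × Arr n | p.1 i ≠ 0 ∧ ∀ j, |p.2.1 j / p.1 i| ≤ 1 / 2}.indicator
      (fun p => φ (p.1, fun j k => p.2.2 j k - p.2.1 j / p.1 i * p.1 (i.succAbove k))) p
  have hset : MeasurableSet {p : (Fin (n + 1) → ℝ) × (Fin n → ℝ) × Arr n |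
      p.1 i ≠ 0 ∧ ∀ j, |p.2.1 j / p.1 i| ≤ 1 / 2} := by
    refine MeasurableSet.inter (s₂ :=
        {p : (Fin (n + 1) → ℝ) × (Fin n → ℝ) × Arr n | ∀ j, |p.2.1 j / p.1 i| ≤ 1 / 2}) ?_ ?_
    · exact ((measurable_pi_apply i).comp measurable_fst) (measurableSet_singleton 0).compl
    · have h : {p : (Fin (n + 1) → ℝ) × (Fin n → ℝ) × Arr n | ∀ j, |p.2.1 j / p.1 i| ≤ 1 / 2} =
          ⋂ j, {p | |p.2.1 j / p.1 i| ≤ 1 / 2} := by ext; simp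
      rw [h]
      refine MeasurableSet.iInter fun j => ?_
      have h : Measurable fun p : (Fin (n + 1) → ℝ) × (Fin n → ℝ) × Arr n => p.2.1 j / p.1 i := by
        fun_prop
      exact measurableSet_le h.norm measurable_const
  have hf : Measurable f := by
    refine Measurable.indicator (hφ.comp ?_) hset
    fun_prop
  have h1 : ∫⁻ B : Arr (n + 1), (sizeReduced i).indicator (fun B => φ (B 0, yc i B)) B =
      ∫⁻ p, f p :=
    (measurePreserving_split i).lintegral_comp hf
  rw [h1, Measure.volume_eq_prod, lintegral_prod _ hf.aemeasurable]
  refine lintegral_mono fun b => ?_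
  have hfb : Measurable fun q : (Fin n → ℝ) × Arr n => f (b, q) := hf.comp measurable_prodMk_left
  rw [Measure.volume_eq_prod, lintegral_prod _ hfb.aemeasurable]
  have h2 : ∀ x : Fin n → ℝ, ∫⁻ W : Arr n, f (b, x, W) ≤
      (Metric.closedBall (0 : Fin n → ℝ) (|b i| / 2)).indicator (fun _ => ∫⁻ y, φ (b, y)) x := by
    intro x
    by_cases hx : b i ≠ 0 ∧ ∀ j, |x j / b i| ≤ 1 / 2
    · have hxm : x ∈ Metric.closedBall (0 : Fin n → ℝ) (|b i| / 2) := by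
        rw [mem_closedBall_zero_iff, pi_norm_le_iff_of_nonneg (by positivity)]
        intro j
        have := hx.2 j
        rw [abs_div, div_le_iff₀ (abs_pos.2 hx.1)] at this
        rw [Real.norm_eq_abs]; linarith
      rw [Set.indicator_of_mem hxm]
      have h3 : ∀ W : Arr n, f (b, x, W) =
          φ (b, W - fun j k => x j / b i * b (i.succAbove k)) := fun W =>
        Set.indicator_of_mem (s := {p : (Fin (n + 1) → ℝ) × (Fin n → ℝ) × Arr n |
          p.1 i ≠ 0 ∧ ∀ j, |p.2.1 j / p.1 i| ≤ 1 / 2}) (a := (b, x, W)) hx _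
      simp only [h3]
      exact (lintegral_sub_right_eq_self (fun W : Arr n => φ (b, W)) _).le
    · have h3 : ∀ W : Arr n, f (b, x, W) = 0 := fun W =>
        Set.indicator_of_notMem (s := {p : (Fin (n + 1) → ℝ) × (Fin n → ℝ) × Arr n |
          p.1 i ≠ 0 ∧ ∀ j, |p.2.1 j / p.1 i| ≤ 1 / 2}) (a := (b, x, W)) hx _
      simp [h3]
  refine (lintegral_mono h2).trans ?_
  rw [lintegral_indicator_const measurableSet_closedBall,
    Real.volume_pi_closedBall _ (by positivity), mul_comm, Fintype.card_fin,
    ofReal_pow (by positivity), mul_div_cancel₀ _ two_ne_zero]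

theorem measurableSet_abs_mul_det_le (i : Fin (n + 1)) (D : ℝ) :
    MeasurableSet {p : (Fin (n + 1) → ℝ) × Arr n | |p.1 i| * |p.2.det| ≤ D} :=
  measurableSet_le ((((measurable_pi_apply i).comp measurable_fst).norm).mul
    (measurable_det.comp measurable_snd).norm) measurable_const

theorem measurableSet_coord_ne_zero_norm_le (i : Fin (n + 1)) (R : ℝ) :
    MeasurableSet {b : Fin (n + 1) → ℝ | b i ≠ 0 ∧ ‖b‖ ≤ R} :=
  MeasurableSet.inter (measurable_pi_apply i (measurableSet_singleton 0).compl)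
    (measurableSet_le measurable_norm measurable_const)

theorem volume_norm_le (R : ℝ) (hR : 0 < R) :
    volume {b : Fin n → ℝ | ‖b‖ ≤ R} = ENNReal.ofReal ((2 * R) ^ n) := by
  have : {b : Fin n → ℝ | ‖b‖ ≤ R} = Metric.closedBall 0 R := by ext; simp
  rw [this, Real.volume_pi_closedBall _ hR.le, Fintype.card_fin]

/-- The volume of the arrays in `H` of determinant at most `D` is at most `C * D ^ n`. -/
def VolLe (H : Set (Arr n)) (C : ℝ≥0∞) : Prop :=
  ∀ D : ℝ, 0 < D → volume {B | B ∈ H ∧ |B.det| ≤ D} ≤ C * ENNReal.ofReal D ^ n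

theorem VolLe.lift {H : Set (Arr n)} (hH : MeasurableSet H) {C : ℝ≥0∞} (hC : VolLe H C)
    {R D : ℝ} (hR : 0 < R) (hD : 0 < D) :
    volume {B | B ∈ lift H ∧ ‖B 0‖ ≤ R ∧ |B.det| ≤ D} ≤
      (n + 1) * (C * ENNReal.ofReal D ^ n * ENNReal.ofReal ((2 * R) ^ (n + 1))) := by
  let E : Fin (n + 1) → Set (Arr (n + 1)) := fun i =>
    {B | B ∈ liftAt i H ∧ ‖B 0‖ ≤ R ∧ |B.det| ≤ D}
  have hsub : {B | B ∈ Arr.lift H ∧ ‖B 0‖ ≤ R ∧ |B.det| ≤ D} ⊆ ⋃ i, E i := by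
    rintro B ⟨⟨i, hB⟩, h⟩
    exact Set.mem_iUnion.2 ⟨i, hB, h⟩
  refine (measure_mono hsub).trans ((measure_iUnion_le _).trans ?_)
  rw [tsum_fintype]
  refine (Finset.sum_le_card_nsmul _ _
    (C * ENNReal.ofReal D ^ n * ENNReal.ofReal ((2 * R) ^ (n + 1))) fun i _ => ?_).trans ?_
  swap
  · simp
  have hE : MeasurableSet (E i) := (measurableSet_liftAt i hH).inter
    ((measurableSet_le (measurable_pi_apply (0 : Fin (n + 1))).norm measurable_const).inter
      (measurableSet_le measurable_det.norm measurable_const))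
  let S : Set ((Fin (n + 1) → ℝ) × Arr n) :=
    {p | (p.1 i ≠ 0 ∧ ‖p.1‖ ≤ R) ∧ p.2 ∈ H ∧ |p.1 i| * |p.2.det| ≤ D}
  have hS : MeasurableSet S :=
    (measurable_fst (measurableSet_coord_ne_zero_norm_le i R)).inter
      ((measurable_snd hH).inter (measurableSet_abs_mul_det_le i D))
  have h1 := lintegral_reduced_le i (φ := S.indicator 1) (measurable_one.indicator hS)
  rw [← lintegral_indicator_one hE]
  refine (lintegral_mono fun B => ?_).trans (h1.trans ?_)
  · refine Set.indicator_apply_le fun hB => ?_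
    obtain ⟨⟨hi, hm, ht, hy⟩, hn, hd⟩ := hB
    have h2 : (B 0, yc i B) ∈ S := ⟨⟨hi, hn⟩, hy, by rwa [← abs_det i B hi]⟩
    rw [Set.indicator_of_mem (show B ∈ sizeReduced i from ⟨hi, ht⟩), Set.indicator_of_mem h2]
    rfl
  · rw [mul_comm, ← volume_norm_le R hR, mul_comm, ← setLIntegral_const,
      ← lintegral_indicator (measurableSet_le measurable_norm measurable_const)]
    refine lintegral_mono fun b => ?_
    by_cases hb : b i ≠ 0 ∧ ‖b‖ ≤ R
    · have hbi : 0 < |b i| := abs_pos.2 hb.1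
      have h3 : ∀ y, S.indicator (1 : (Fin (n + 1) → ℝ) × Arr n → ℝ≥0∞) (b, y) =
          {y | y ∈ H ∧ |y.det| ≤ D / |b i|}.indicator 1 y := by
        intro y
        have : (b, y) ∈ S ↔ y ∈ {y | y ∈ H ∧ |y.det| ≤ D / |b i|} := by
          simp only [S, Set.mem_ofPred_eq, hb, ne_eq, not_false_eq_true, true_and,
            le_div_iff₀' hbi, and_self]
        by_cases hy : (b, y) ∈ S
        · rw [Set.indicator_of_mem hy, Set.indicator_of_mem (this.1 hy)]; rfl
        · rw [Set.indicator_of_notMem hy, Set.indicator_of_notMem (mt this.2 hy)]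
      simp only [h3]
      have hm : MeasurableSet {y : Arr n | y ∈ H ∧ |y.det| ≤ D / |b i|} :=
        hH.inter (measurableSet_le measurable_det.norm measurable_const)
      rw [Set.indicator_of_mem (show b ∈ {b | ‖b‖ ≤ R} from hb.2), lintegral_indicator_one hm]
      refine (mul_le_mul_right (hC _ (div_pos hD hbi)) _).trans (le_of_eq ?_)
      rw [mul_left_comm, ← mul_pow, ← ENNReal.ofReal_mul hbi.le, mul_div_cancel₀ _ hbi.ne']
    · have h3 : ∀ y, S.indicator (1 : (Fin (n + 1) → ℝ) × Arr n → ℝ≥0∞) (b, y) = 0 := fun y =>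
        Set.indicator_of_notMem (fun h => hb h.1) _
      simp [h3]

theorem exists_volLe_red : ∀ n, ∃ C : ℝ≥0∞, C ≠ ∞ ∧ VolLe (red n) C
  | 0 => ⟨1, one_ne_top, fun D _ => by
      refine (measure_mono (Set.subset_univ _)).trans ?_
      rw [pow_zero, mul_one, show (Set.univ : Set (Arr 0)) =
          Set.pi Set.univ fun _ => Set.univ by simp,
        volume_pi_pi]
      simp⟩
  | n + 1 => by
    obtain ⟨C, hC, h⟩ := exists_volLe_red n
    refine ⟨(n + 1) * (C * ENNReal.ofReal (2 ^ (n + 1))), ?_, fun D hD => ?_⟩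
    · exact mul_ne_top (by finiteness) (mul_ne_top hC ofReal_ne_top)
    have hR : 0 < D ^ (1 / (n + 1 : ℝ)) := Real.rpow_pos_of_pos hD _
    have hRp : (D ^ (1 / (n + 1 : ℝ))) ^ (n + 1) = D := by
      rw [← Real.rpow_natCast, ← Real.rpow_mul hD.le]
      push_cast
      rw [one_div_mul_cancel (by positivity), Real.rpow_one]
    refine (measure_mono ?_).trans ((h.lift (measurableSet_red n) hR hD).trans (le_of_eq ?_))
    · rintro B ⟨hB, hd⟩
      refine ⟨hB.1, ?_, hd⟩
      refine le_of_pow_le_pow_left₀ (n := n + 1) (by simp) hR.le ?_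
      rw [hRp]
      exact le_trans hB.2 hd
    · rw [mul_pow, hRp, ENNReal.ofReal_mul (by positivity), pow_succ]
      ring

theorem tsum_abs_add_le (x r : ℝ) (hr : 0 ≤ r) :
    ∑' a : ℤ, {a : ℤ | |(a : ℝ) + x| ≤ r}.indicator (1 : ℤ → ℝ≥0∞) a ≤
      ENNReal.ofReal (2 * r + 1) := by
  have h : {a : ℤ | |(a : ℝ) + x| ≤ r} = (Finset.Icc ⌈-x - r⌉ ⌊-x + r⌋ : Finset ℤ) := by
    ext a
    rw [Set.mem_ofPred_eq, abs_le, Finset.coe_Icc, Set.mem_Icc, Int.ceil_le, Int.le_floor]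
    constructor <;> rintro ⟨h1, h2⟩ <;> constructor <;> linarith
  rw [h, ← tsum_subtype, Finset.tsum_subtype']
  simp only [Pi.one_apply, Finset.sum_const, nsmul_eq_mul, mul_one, Int.card_Icc]
  rw [← ENNReal.ofReal_natCast]
  refine ENNReal.ofReal_le_ofReal ?_
  have h1 := Int.floor_le (-x + r)
  have h2 := Int.le_ceil (-x - r)
  rcases le_total 0 (⌊-x + r⌋ + 1 - ⌈-x - r⌉) with h3 | h3
  · have : (((⌊-x + r⌋ + 1 - ⌈-x - r⌉).toNat : ℤ) : ℝ) = ((⌊-x + r⌋ + 1 - ⌈-x - r⌉ : ℤ) : ℝ) := by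
      rw [Int.toNat_of_nonneg h3]
    push_cast at this ⊢
    linarith
  · rw [Int.toNat_of_nonpos h3]; simp; linarith

/-- The number of pairs `(B 0, a • B 0 + q • B 1)` with `q ≠ 0` and norms at most `R`. -/
noncomputable def pairCount (R : ℝ) (B : Arr (n + 2)) : ℝ≥0∞ :=
  ∑' q : ℤ, ∑' a : ℤ, {B : Arr (n + 2) | q ≠ 0 ∧ ‖B 0‖ ≤ R ∧
    ‖(a : ℝ) • B 0 + (q : ℝ) • B 1‖ ≤ R}.indicator (1 : Arr (n + 2) → ℝ≥0∞) B

theorem pair_bounds {R : ℝ} {i : Fin (n + 2)} {B : Arr (n + 2)} (hi : B 0 i ≠ 0)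
    (hm : ∀ k, |B 0 k| ≤ |B 0 i|) {a q : ℤ} (hq : q ≠ 0)
    (h : ‖(a : ℝ) • B 0 + (q : ℝ) • B 1‖ ≤ R) :
    |(a : ℝ) + q * tc i B 0| ≤ R / |B 0 i| ∧ ‖yc i B 0‖ ≤ 2 * R / |(q : ℝ)| := by
  have hi' : 0 < |B 0 i| := abs_pos.2 hi
  have hR : 0 ≤ R := (norm_nonneg _).trans h
  have hq' : 0 < |(q : ℝ)| := abs_pos.2 (Int.cast_ne_zero.2 hq)
  have hc : ∀ k, |(a : ℝ) * B 0 k + q * B 1 k| ≤ R := fun k =>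
    (norm_le_pi_norm ((a : ℝ) • B 0 + (q : ℝ) • B 1) k).trans h
  have ht : tc i B 0 * B 0 i = B 1 i := div_mul_cancel₀ _ hi
  have h1 : |(a : ℝ) + q * tc i B 0| ≤ R / |B 0 i| := by
    rw [le_div_iff₀ hi', ← abs_mul]
    refine le_of_eq_of_le (congrArg _ ?_) (hc i)
    rw [← ht]; ring
  refine ⟨h1, ?_⟩
  rw [pi_norm_le_iff_of_nonneg (by positivity)]
  intro k
  rw [Real.norm_eq_abs, le_div_iff₀ hq', ← abs_mul]
  have h2 : yc i B 0 k * q = ((a : ℝ) * B 0 (i.succAbove k) + q * B 1 (i.succAbove k)) -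
      (a + q * tc i B 0) * B 0 (i.succAbove k) := by
    have : yc i B 0 k = B 1 (i.succAbove k) - tc i B 0 * B 0 (i.succAbove k) := rfl
    rw [this]; ring
  rw [h2]
  refine (abs_sub _ _).trans ?_
  have h3 : |((a : ℝ) + q * tc i B 0) * B 0 (i.succAbove k)| ≤ R := by
    rw [abs_mul]
    refine (mul_le_mul h1 (hm _) (abs_nonneg _) (by positivity)).trans (le_of_eq ?_)
    rw [div_mul_cancel₀ _ hi'.ne']
  linarith [hc (i.succAbove k)]

/-- The pairs of a first vector and a projection which can contribute to `pairCount` for `q`. -/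
def pairSet (R : ℝ) (i : Fin (n + 2)) (H : Set (Arr n)) (q : ℤ) :
    Set ((Fin (n + 2) → ℝ) × Arr (n + 1)) :=
  {p | q ≠ 0 ∧ |p.1 i| * |p.2.det| ≤ 1 ∧ p.2 ∈ lift H ∧ ‖p.2 0‖ ≤ 2 * R / |(q : ℝ)|}

/-- An upper bound for `pairCount` in terms of the first vector and the projection. -/
noncomputable def pairMaj (R : ℝ) (i : Fin (n + 2)) (H : Set (Arr n))
    (p : (Fin (n + 2) → ℝ) × Arr (n + 1)) : ℝ≥0∞ :=
  {b : Fin (n + 2) → ℝ | b i ≠ 0 ∧ ‖b‖ ≤ R}.indicator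
    (fun b => ENNReal.ofReal (2 * (R / |b i|) + 1)) p.1 *
  ∑' q : ℤ, (pairSet R i H q).indicator
      (1 : (Fin (n + 2) → ℝ) × Arr (n + 1) → ℝ≥0∞) p

theorem measurableSet_pairSet (R : ℝ) (i : Fin (n + 2)) {H : Set (Arr n)} (hH : MeasurableSet H)
    (q : ℤ) : MeasurableSet (pairSet R i H q) :=
  (MeasurableSet.const _).inter ((measurableSet_abs_mul_det_le i 1).inter
    ((measurable_snd (measurableSet_lift hH)).inter (measurableSet_le
      ((measurable_pi_apply (0 : Fin (n + 1))).comp measurable_snd).norm measurable_const)))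

theorem measurable_pairMaj (R : ℝ) (i : Fin (n + 2)) {H : Set (Arr n)} (hH : MeasurableSet H) :
    Measurable (pairMaj R i H) := by
  refine Measurable.mul ?_ (Measurable.tsum fun q =>
    measurable_one.indicator (measurableSet_pairSet R i hH q))
  refine (Measurable.indicator ?_ (measurableSet_coord_ne_zero_norm_le i R)).comp measurable_fst
  have : Measurable fun b : Fin (n + 2) → ℝ => |b i| := (measurable_pi_apply i).norm
  fun_prop

theorem pairCount_le {R : ℝ} {i : Fin (n + 2)} {H : Set (Arr n)} {B : Arr (n + 2)}
    (hB : B ∈ liftAt i (lift H)) (hd : |B.det| ≤ 1) :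
    pairCount R B ≤ pairMaj R i H (B 0, yc i B) := by
  obtain ⟨hi, hm, ht, hy⟩ := hB
  by_cases hR : ‖B 0‖ ≤ R
  swap
  · have : pairCount R B = 0 := by
      simp only [pairCount, ENNReal.tsum_eq_zero]
      exact fun q a => Set.indicator_of_notMem (fun h => hR h.2.1) _
    simp [this]
  have hR0 : 0 ≤ R := (norm_nonneg _).trans hR
  rw [pairMaj, Set.indicator_of_mem (show B 0 ∈ {b : Fin (n + 2) → ℝ | b i ≠ 0 ∧ ‖b‖ ≤ R} from
    ⟨hi, hR⟩), ← ENNReal.tsum_mul_left]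
  refine ENNReal.tsum_le_tsum fun q => ?_
  by_cases hex : ∃ a : ℤ, q ≠ 0 ∧ ‖(a : ℝ) • B 0 + (q : ℝ) • B 1‖ ≤ R
  swap
  · have h0 : ∑' a : ℤ, {B : Arr (n + 2) | q ≠ 0 ∧ ‖B 0‖ ≤ R ∧
        ‖(a : ℝ) • B 0 + (q : ℝ) • B 1‖ ≤ R}.indicator (1 : Arr (n + 2) → ℝ≥0∞) B = 0 := by
      refine ENNReal.tsum_eq_zero.2 fun a => ?_
      exact Set.indicator_of_notMem (fun h => hex ⟨a, h.1, h.2.2⟩) _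
    rw [h0]; exact zero_le
  obtain ⟨a₀, hq, h₀⟩ := hex
  rw [Set.indicator_of_mem (show (B 0, yc i B) ∈ (pairSet R i H q) from
    ⟨hq, by rwa [← abs_det i B hi], hy, (pair_bounds hi hm hq h₀).2⟩), Pi.one_apply, mul_one]
  refine le_trans (ENNReal.tsum_le_tsum fun a => ?_)
    (tsum_abs_add_le (q * tc i B 0) (R / |B 0 i|) (by positivity))
  by_cases h : q ≠ 0 ∧ ‖B 0‖ ≤ R ∧ ‖(a : ℝ) • B 0 + (q : ℝ) • B 1‖ ≤ R
  · rw [Set.indicator_of_mem (show a ∈ {a : ℤ | |(a : ℝ) + q * tc i B 0| ≤ R / |B 0 i|} from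
      (pair_bounds hi hm h.1 h.2.2).1), Set.indicator_of_mem (show B ∈ {B : Arr (n + 2) | q ≠ 0 ∧
        ‖B 0‖ ≤ R ∧ ‖(a : ℝ) • B 0 + (q : ℝ) • B 1‖ ≤ R} from h)]
    rfl
  · rw [Set.indicator_of_notMem (show B ∉ {B : Arr (n + 2) | q ≠ 0 ∧
        ‖B 0‖ ≤ R ∧ ‖(a : ℝ) • B 0 + (q : ℝ) • B 1‖ ≤ R} from h)]
    exact zero_le

theorem summable_inv_int_pow (hn : 1 ≤ n) :
    ∑' q : ℤ, ENNReal.ofReal ((1 / |(q : ℝ)|) ^ (n + 1)) ≠ ∞ := by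
  have h := (Real.summable_one_div_int_pow (p := n + 1)).2 (by omega)
  have h' := h.abs
  refine ne_of_eq_of_ne (tsum_congr fun q => ?_) h'.tsum_ofReal_ne_top
  rw [abs_div, abs_one, abs_pow, _root_.one_div_pow]

theorem lintegral_pairCount_lt_top (hn : 1 ≤ n) {H : Set (Arr n)} (hH : MeasurableSet H)
    {C : ℝ≥0∞} (hC : C ≠ ∞) (h : VolLe H C) {R : ℝ} (hR : 0 < R) :
    ∫⁻ B in {B : Arr (n + 2) | B ∈ lift (lift H) ∧ |B.det| ≤ 1}, pairCount R B < ∞ := by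
  let E : Fin (n + 2) → Set (Arr (n + 2)) := fun i => {B | B ∈ liftAt i (lift H) ∧ |B.det| ≤ 1}
  have hsub : {B : Arr (n + 2) | B ∈ lift (lift H) ∧ |B.det| ≤ 1} ⊆ ⋃ i, E i := by
    rintro B ⟨⟨i, hB⟩, h⟩
    exact Set.mem_iUnion.2 ⟨i, hB, h⟩
  refine (lintegral_mono_set hsub).trans_lt ((lintegral_iUnion_le _ _).trans_lt ?_)
  rw [tsum_fintype]
  refine ENNReal.sum_lt_top.2 fun i _ => ?_
  have hE : MeasurableSet (E i) := (measurableSet_liftAt i (measurableSet_lift hH)).inter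
      (measurableSet_le measurable_det.norm measurable_const)
  have h1 := lintegral_reduced_le i (measurable_pairMaj R i hH)
  rw [← lintegral_indicator hE]
  refine lt_of_le_of_lt ((lintegral_mono fun B => ?_).trans h1) ?_
  · refine Set.indicator_apply_le fun hB => ?_
    rw [Set.indicator_of_mem (show B ∈ sizeReduced i from ⟨hB.1.1, hB.1.2.2.1⟩)]
    exact pairCount_le hB.1 hB.2
  set Z := ∑' q : ℤ, ENNReal.ofReal ((1 / |(q : ℝ)|) ^ (n + 1)) with hZ
  set K : ℝ≥0∞ := ENNReal.ofReal (3 * R) * ((n + 1) * (C * ENNReal.ofReal ((4 * R) ^ (n + 1))) * Z)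
    with hK
  have hKt : K ≠ ∞ := mul_ne_top ofReal_ne_top (mul_ne_top (mul_ne_top (by finiteness)
    (mul_ne_top hC ofReal_ne_top)) (summable_inv_int_pow hn))
  refine lt_of_le_of_lt (b := ∫⁻ b : Fin (n + 2) → ℝ in {b | ‖b‖ ≤ R}, K) ?_ ?_
  swap
  · rw [setLIntegral_const, volume_norm_le R hR]
    exact mul_lt_top hKt.lt_top ofReal_lt_top
  rw [← lintegral_indicator (measurableSet_le measurable_norm measurable_const)]
  refine lintegral_mono fun b => ?_
  by_cases hb : b i ≠ 0 ∧ ‖b‖ ≤ R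
  swap
  · simp [pairMaj, Set.indicator_of_notMem (show b ∉ {b : Fin (n + 2) → ℝ | b i ≠ 0 ∧ ‖b‖ ≤ R}
      from hb)]
  have hbi : 0 < |b i| := abs_pos.2 hb.1
  rw [Set.indicator_of_mem (show b ∈ {b : Fin (n + 2) → ℝ | ‖b‖ ≤ R} from hb.2)]
  simp only [pairMaj, Set.indicator_of_mem (show b ∈ {b : Fin (n + 2) → ℝ | b i ≠ 0 ∧ ‖b‖ ≤ R}
      from hb)]
  have hmq : ∀ q : ℤ, MeasurableSet {y : Arr (n + 1) | (b, y) ∈ (pairSet R i H q)} := fun q =>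
    measurable_prodMk_left (measurableSet_pairSet R i hH q)
  have hmi : ∀ q : ℤ, Measurable fun y : Arr (n + 1) => (pairSet R i H q).indicator
      (1 : (Fin (n + 2) → ℝ) × Arr (n + 1) → ℝ≥0∞) (b, y) := fun q =>
    (measurable_one.indicator (measurableSet_pairSet R i hH q)).comp measurable_prodMk_left
  have hy : ∀ q : ℤ, ∫⁻ y : Arr (n + 1), (pairSet R i H q).indicator
      (1 : (Fin (n + 2) → ℝ) × Arr (n + 1) → ℝ≥0∞) (b, y) ≤
      (n + 1) * (C * ENNReal.ofReal ((4 * R) ^ (n + 1))) * ENNReal.ofReal (1 / |b i|) ^ n *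
        ENNReal.ofReal ((1 / |(q : ℝ)|) ^ (n + 1)) := by
    intro q
    refine le_trans (le_of_eq ((lintegral_indicator_one (hmq q)) :)) ?_
    change volume {y : Arr (n + 1) | (b, y) ∈ pairSet R i H q} ≤ _
    by_cases hq : q = 0
    · have : {y : Arr (n + 1) | (b, y) ∈ (pairSet R i H q)} = ∅ :=
        Set.eq_empty_of_forall_notMem fun y hy => hy.1 hq
      rw [this, measure_empty]
      exact zero_le
    have hq' : 0 < |(q : ℝ)| := abs_pos.2 (Int.cast_ne_zero.2 hq)
    refine (measure_mono ?_).trans ((h.lift hH (R := 2 * R / |(q : ℝ)|) (D := 1 / |b i|)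
      (by positivity) (by positivity)).trans (le_of_eq ?_))
    · rintro y ⟨-, h1, h2, h3⟩
      exact ⟨h2, h3, by rwa [le_div_iff₀' hbi]⟩
    · rw [show 2 * (2 * R / |(q : ℝ)|) = 4 * R * (1 / |(q : ℝ)|) by ring, mul_pow,
        ENNReal.ofReal_mul (by positivity)]
      ring
  rw [lintegral_const_mul _ (Measurable.tsum fun q => hmi q),
    lintegral_tsum fun q => (hmi q).aemeasurable]
  refine (mul_le_mul_right (mul_le_mul_right (ENNReal.tsum_le_tsum hy) _) _).trans ?_
  rw [ENNReal.tsum_mul_left, ← hZ]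
  have hfin : ENNReal.ofReal |b i| ^ (n + 1) * (ENNReal.ofReal (2 * (R / |b i|) + 1) *
      ENNReal.ofReal (1 / |b i|) ^ n) ≤ ENNReal.ofReal (3 * R) := by
    rw [← ENNReal.ofReal_pow (by positivity), ← ENNReal.ofReal_pow (by positivity),
      ← ENNReal.ofReal_mul (by positivity), ← ENNReal.ofReal_mul (by positivity)]
    refine ENNReal.ofReal_le_ofReal ?_
    have h1 : |b i| ^ (n + 1) * ((2 * (R / |b i|) + 1) * (1 / |b i|) ^ n) = 2 * R + |b i| := by
      rw [_root_.one_div_pow]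
      field_simp
      rw [pow_succ']
    rw [h1]
    have := (norm_le_pi_norm b i).trans hb.2
    rw [Real.norm_eq_abs] at this
    linarith
  calc _ = (ENNReal.ofReal |b i| ^ (n + 1) * (ENNReal.ofReal (2 * (R / |b i|) + 1) *
      ENNReal.ofReal (1 / |b i|) ^ n)) *
        ((n + 1) * (C * ENNReal.ofReal ((4 * R) ^ (n + 1))) * Z) := by ring
    _ ≤ K := mul_le_mul_left hfin _

end Arr

/-! ### Fundamental domains -/

namespace SLR

variable {d : ℕ} {L : Type*} [Group L]

/-- `D` contains exactly one point of each orbit for the right action of `L` through `ι`. -/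
def IsFD (ι : L →* SLR d) (D : Set (SLR d)) : Prop :=
  MeasurableSet D ∧ ∀ g, ∃! γ, g * ι γ ∈ D

theorem exists_isOpen_inv_mul_mem {G : Type*} [Group G] [TopologicalSpace G] [IsTopologicalGroup G]
    {V : Set G} (hV : IsOpen V) (h1 : 1 ∈ V) (g : G) :
    ∃ U, IsOpen U ∧ g ∈ U ∧ ∀ x ∈ U, ∀ y ∈ U, x⁻¹ * y ∈ V := by
  have hc : Continuous fun p : G × G => p.1⁻¹ * p.2 := by fun_prop
  have hg : (g, g) ∈ (fun p : G × G => p.1⁻¹ * p.2) ⁻¹' V := by simpa using h1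
  obtain ⟨u, v, hu, hv, hgu, hgv, huv⟩ := isOpen_prod_iff.1 (hV.preimage hc) g g hg
  exact ⟨u ∩ v, hu.inter hv, ⟨hgu, hgv⟩, fun x hx y hy => huv (Set.mk_mem_prod hx.1 hy.2)⟩

theorem exists_isFD [Countable L] (ι : L →* SLR d)
    (hι : ∀ γ, (∀ i j, |(ι γ).1 i j - (1 : Matrix (Fin d) (Fin d) ℝ) i j| < 1) → γ = 1) :
    ∃ D, IsFD ι D := by
  let V : Set (SLR d) := {h | ∀ i j, |h.1 i j - (1 : Matrix (Fin d) (Fin d) ℝ) i j| < 1}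
  have hV : IsOpen V := by
    have h : V = ⋂ i, ⋂ j, {h : SLR d | |h.1 i j - (1 : Matrix (Fin d) (Fin d) ℝ) i j| < 1} := by
      ext; simp [V]
    rw [h]
    refine isOpen_iInter_of_finite fun i => isOpen_iInter_of_finite fun j =>
      isOpen_lt (Continuous.abs (Continuous.sub ?_ continuous_const)) continuous_const
    exact (continuous_apply_apply i j).comp continuous_subtype_val
  have hU : ∀ g : SLR d, ∃ U, IsOpen U ∧ g ∈ U ∧ ∀ x ∈ U, ∀ y ∈ U, x⁻¹ * y ∈ V := by
    refine exists_isOpen_inv_mul_mem hV fun i j => ?_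
    change |(1 : Matrix (Fin d) (Fin d) ℝ) i j - (1 : Matrix (Fin d) (Fin d) ℝ) i j| < 1
    simp
  choose U hUo hgU hUV using hU
  obtain ⟨s, hs, hsU⟩ := TopologicalSpace.countable_cover_nhds fun g => (hUo g).mem_nhds (hgU g)
  have hsn : s.Nonempty := by
    have : (1 : SLR d) ∈ ⋃ x ∈ s, U x := hsU ▸ Set.mem_univ _
    obtain ⟨x, hx, -⟩ := Set.mem_iUnion₂.1 this
    exact ⟨x, hx⟩
  obtain ⟨f, rfl⟩ := hs.exists_eq_range hsn
  let W : ℕ → Set (SLR d) := fun k => {g | ∃ γ, g * ι γ ∈ U (f k)}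
  have hWγ : ∀ k g γ, g * ι γ ∈ W k ↔ g ∈ W k := by
    refine fun k g γ => ⟨fun ⟨γ', h⟩ => ⟨γ * γ', ?_⟩, fun ⟨γ', h⟩ => ⟨γ⁻¹ * γ', ?_⟩⟩
    · rwa [map_mul, ← mul_assoc]
    · rwa [map_mul, map_inv, mul_assoc, mul_inv_cancel_left]
  have hW : ∀ k, MeasurableSet (W k) := by
    intro k
    have h : W k = ⋃ γ, (fun g => g * ι γ) ⁻¹' U (f k) := by ext; simp [W]
    rw [h]
    exact (isOpen_iUnion fun γ => (hUo _).preimage (continuous_mul_const _)).measurableSet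
  refine ⟨{g | ∃ k, g ∈ U (f k) ∧ ∀ j < k, g ∉ W j}, ?_, fun g => ?_⟩
  · have h : {g | ∃ k, g ∈ U (f k) ∧ ∀ j < k, g ∉ W j} =
        ⋃ k, (U (f k) ∩ ⋂ j, ⋂ (_ : j < k), (W j)ᶜ) := by ext; simp
    rw [h]
    exact MeasurableSet.iUnion fun k => (hUo _).measurableSet.inter
      (MeasurableSet.iInter fun j => MeasurableSet.iInter fun _ => (hW j).compl)
  have hex : ∃ k, g ∈ W k := by
    have : g ∈ ⋃ x ∈ Set.range f, U x := hsU ▸ Set.mem_univ _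
    rw [Set.biUnion_range] at this
    obtain ⟨k, hk⟩ := Set.mem_iUnion.1 this
    exact ⟨k, 1, by simpa using hk⟩
  classical
  obtain ⟨γ, hγ⟩ := Nat.find_spec hex
  refine ⟨γ, ⟨Nat.find hex, hγ, fun j hj h => Nat.find_min hex hj ((hWγ j g γ).1 h)⟩, ?_⟩
  rintro γ' ⟨k, hk, hmin⟩
  have hkeq : k = Nat.find hex := by
    refine le_antisymm (not_lt.1 fun h => hmin _ h ((hWγ _ g γ').2 (Nat.find_spec hex)))
      (Nat.find_min' hex ⟨γ', hk⟩)
  rw [hkeq] at hk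
  have h1 := hUV _ _ hγ _ hk
  have h2 : (g * ι γ)⁻¹ * (g * ι γ') = ι (γ⁻¹ * γ') := by
    rw [map_mul, map_inv]; group
  rw [h2] at h1
  exact (inv_mul_eq_one.1 (hι _ h1)).symm

variable {ι : L →* SLR d} {D : Set (SLR d)}

theorem IsFD.tsum_indicator (hD : IsFD ι D) (g : SLR d) :
    ∑' γ, D.indicator (1 : SLR d → ℝ≥0∞) (g * ι γ) = 1 := by
  obtain ⟨γ, hγ, huniq⟩ := hD.2 g
  rw [tsum_eq_single γ fun γ' hγ' => Set.indicator_of_notMem (fun h => hγ' (huniq _ h)) _,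
    Set.indicator_of_mem hγ]
  rfl

theorem IsFD.tsum_indicator_inv (hD : IsFD ι D) (g : SLR d) :
    ∑' γ, D.indicator (1 : SLR d → ℝ≥0∞) (g * (ι γ)⁻¹) = 1 := by
  rw [← hD.tsum_indicator g, ← (Equiv.inv L).tsum_eq]
  simp

theorem setLIntegral_eq (θ : Measure (SLR d)) (hD : MeasurableSet D) (f : SLR d → ℝ≥0∞) :
    ∫⁻ g in D, f g ∂θ = ∫⁻ g, D.indicator (1 : SLR d → ℝ≥0∞) g * f g ∂θ := by
  rw [← lintegral_indicator hD]
  refine lintegral_congr fun g => ?_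
  by_cases h : g ∈ D <;> simp [h]

variable [Countable L] (θ : Measure (SLR d)) [θ.IsMulRightInvariant]

theorem IsFD.lintegral_eq (hD : IsFD ι D) {f : SLR d → ℝ≥0∞} (hf : Measurable f) :
    ∫⁻ g, f g ∂θ = ∫⁻ g in D, ∑' γ, f (g * ι γ) ∂θ := by
  have hm : ∀ γ, Measurable fun g => g * ι γ := fun γ => measurable_mul_const _
  rw [setLIntegral_eq θ hD.1]
  simp_rw [← ENNReal.tsum_mul_left]
  have h1 : Measurable (D.indicator (1 : SLR d → ℝ≥0∞)) := measurable_one.indicator hD.1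
  have h4 : ∀ γ, Measurable fun g => D.indicator (1 : SLR d → ℝ≥0∞) g * f (g * ι γ) := fun γ =>
    Measurable.mul h1 (hf.comp (hm γ))
  rw [lintegral_tsum fun γ => (h4 γ).aemeasurable]
  have h2 : ∀ γ, ∫⁻ g, D.indicator (1 : SLR d → ℝ≥0∞) g * f (g * ι γ) ∂θ =
      ∫⁻ g, D.indicator (1 : SLR d → ℝ≥0∞) (g * (ι γ)⁻¹) * f g ∂θ := fun γ => by
    rw [← lintegral_mul_right_eq_self (fun g => D.indicator (1 : SLR d → ℝ≥0∞) (g * (ι γ)⁻¹) * f g)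
      (ι γ)]
    simp only [mul_inv_cancel_right]
  simp_rw [h2]
  have h3 : ∀ γ, Measurable fun g => D.indicator (1 : SLR d → ℝ≥0∞) (g * (ι γ)⁻¹) * f g := fun γ =>
    Measurable.mul (h1.comp (measurable_mul_const _)) hf
  rw [← lintegral_tsum fun γ => (h3 γ).aemeasurable]
  refine lintegral_congr fun g => ?_
  rw [ENNReal.tsum_mul_right, hD.tsum_indicator_inv, one_mul]

theorem IsFD.setLIntegral_mul_left [θ.IsMulLeftInvariant] (hD : IsFD ι D) {Ψ : SLR d → ℝ≥0∞}
    (hΨ : Measurable Ψ) (hinv : ∀ g γ, Ψ (g * ι γ) = Ψ g) (h : SLR d) :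
    ∫⁻ g in D, Ψ (h * g) ∂θ = ∫⁻ g in D, Ψ g ∂θ := by
  have h1 : Measurable (D.indicator (1 : SLR d → ℝ≥0∞)) := measurable_one.indicator hD.1
  rw [setLIntegral_eq θ hD.1, ← lintegral_mul_left_eq_self _ h⁻¹, hD.lintegral_eq θ]
  · refine lintegral_congr fun g => ?_
    simp only [mul_inv_cancel_left, hinv, ENNReal.tsum_mul_right]
    simp only [← mul_assoc, hD.tsum_indicator, one_mul]
  · simp only [mul_inv_cancel_left]
    exact (h1.comp (measurable_const_mul _)).mul hΨ

theorem IsFD.lintegral_tsum_le {Λ F : Type*} [Group Λ] [Countable Λ] [Group F] [Fintype F]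
    {ι : Λ →* SLR d} {π : Λ →* F} (hD : IsFD (ι.comp π.ker.subtype) D)
    {f : SLR d → ℝ≥0∞} (hf : Measurable f) :
    ∫⁻ g in D, ∑' γ, f (g * ι γ) ∂θ ≤ Fintype.card F * ∫⁻ g, f g ∂θ := by
  let r : F → Λ := Function.invFun π
  let p : F × π.ker → Λ := fun x => x.2 * r x.1
  have hp : Function.Surjective p := by
    intro γ
    have hr : π (r (π γ)) = π γ := Function.invFun_eq (f := π) ⟨γ, rfl⟩
    refine ⟨(π γ, ⟨γ * (r (π γ))⁻¹, ?_⟩), ?_⟩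
    · rw [MonoidHom.mem_ker, map_mul, map_inv, hr, mul_inv_cancel]
    · simp [p]
  have h1 : ∀ g : SLR d, ∑' γ, f (g * ι γ) ≤
      ∑ c : F, ∑' γ : π.ker, f (g * ι γ * ι (r c)) := by
    intro g
    refine (ENNReal.tsum_le_tsum_comp_of_surjective hp _).trans (le_of_eq ?_)
    rw [ENNReal.tsum_prod', tsum_fintype]
    simp [p, mul_assoc]
  refine (lintegral_mono h1).trans ?_
  have hf' : ∀ c, Measurable fun g => f (g * ι (r c)) := fun c => hf.comp (measurable_mul_const _)
  rw [lintegral_finsetSum]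
  · have h2 : ∀ c, ∫⁻ g in D, ∑' γ : π.ker, f (g * ι γ * ι (r c)) ∂θ = ∫⁻ g, f g ∂θ := by
      intro c
      rw [← lintegral_mul_right_eq_self f (ι (r c)), hD.lintegral_eq θ (hf' c)]
      rfl
    simp [h2]
  · exact fun c _ => Measurable.tsum fun γ => (hf' c).comp (measurable_mul_const _)

end SLR

/-! ### Primitive vectors in reduced bases -/

namespace Arr

variable {n : ℕ}

theorem mul_blockSL_col_zero (γ : SpecialLinearGroup (Fin (n + 1)) ℤ) (m : Fin n → ℤ)
    (γ' : SpecialLinearGroup (Fin n) ℤ) (j : Fin (n + 1)) :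
    (γ * blockSL m γ').1 j 0 = γ.1 j 0 := by
  have : (γ * blockSL m γ').1 j 0 = ∑ k, γ.1 j k * (blockSL m γ').1 k 0 :=
    Matrix.mul_apply (M := γ.1) (N := (blockSL m γ').1)
  rw [this, Fin.sum_univ_succ, blockSL_zero_zero, Finset.sum_eq_zero]
  · ring
  · intro k _; rw [blockSL_succ_zero, mul_zero]

theorem mul_blockSL_col_succ (γ : SpecialLinearGroup (Fin (n + 1)) ℤ) (m : Fin n → ℤ)
    (γ' : SpecialLinearGroup (Fin n) ℤ) (j : Fin (n + 1)) (l : Fin n) :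
    (γ * blockSL m γ').1 j l.succ = γ.1 j 0 * m l + ∑ k, γ.1 j (Fin.succ k) * γ'.1 k l := by
  have : (γ * blockSL m γ').1 j l.succ = ∑ k, γ.1 j k * (blockSL m γ').1 k l.succ :=
    Matrix.mul_apply (M := γ.1) (N := (blockSL m γ').1)
  rw [this, Fin.sum_univ_succ, blockSL_zero_succ]
  simp only [blockSL_succ_succ]

theorem exists_unit_sl_first_col {v : Fin (n + 1) → ℤ} (hv : Finset.univ.gcd v = 1) :
    ∃ (γ : SpecialLinearGroup (Fin (n + 1)) ℤ) (k : ℤˣ), ∀ j, v j = k * γ.1 j 0 := by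
  obtain ⟨γ, k, h⟩ := exists_sl_first_col v
  have hk : IsUnit k := isUnit_of_dvd_one (hv ▸ Finset.dvd_gcd fun j _ => ⟨_, h j⟩)
  exact ⟨γ, hk.unit, h⟩

theorem exists_reduced_first {B : Arr (n + 1)} (hB : B.det ≠ 0) {v : Fin (n + 1) → ℤ}
    (hv : Finset.univ.gcd v = 1) :
    ∃ (γ : SpecialLinearGroup (Fin (n + 1)) ℤ) (k : ℤˣ), chg B γ ∈ lift (red n) ∧
      ∀ j, v j = k * γ.1 j 0 := by
  obtain ⟨γ, k, h⟩ := exists_unit_sl_first_col hv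
  have hdet : (chg B γ).det ≠ 0 := by rwa [det_chg]
  obtain ⟨m, γ', h'⟩ := exists_chg_mem_lift (fun Y hY => exists_chg_mem_red Y hY) hdet
  refine ⟨γ * blockSL m γ', k, by rwa [chg_mul], fun j => ?_⟩
  rw [mul_blockSL_col_zero, h]

theorem exists_mulVec_eq (γ : SpecialLinearGroup (Fin n) ℤ) (w : Fin n → ℤ) :
    ∃ u : Fin n → ℤ, ∀ j, w j = ∑ k, γ.1 j k * u k := by
  refine ⟨(γ⁻¹).1.mulVec w, fun j => ?_⟩
  have h : γ.1 * (γ⁻¹).1 = 1 := congrArg Subtype.val (mul_inv_cancel γ)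
  have : γ.1.mulVec ((γ⁻¹).1.mulVec w) = w := by rw [Matrix.mulVec_mulVec, h, Matrix.one_mulVec]
  exact (congrFun this j).symm

theorem exists_reduced_pair {B : Arr (n + 2)} (hB : B.det ≠ 0) {v : Fin (n + 2) → ℤ}
    (hv : Finset.univ.gcd v = 1) (w : Fin (n + 2) → ℤ) :
    ∃ (γ : SpecialLinearGroup (Fin (n + 2)) ℤ) (k : ℤˣ) (q a : ℤ),
      chg B γ ∈ lift (lift (red n)) ∧ (∀ j, v j = k * γ.1 j 0) ∧
        ∀ j, w j = a * γ.1 j 0 + q * γ.1 j 1 := by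
  obtain ⟨γ, k, h⟩ := exists_unit_sl_first_col hv
  have hdet : (chg B γ).det ≠ 0 := by rwa [det_chg]
  obtain ⟨u, hu⟩ := exists_mulVec_eq γ w
  obtain ⟨i, hi, hmax⟩ := exists_max_coord (first_ne_zero hdet)
  obtain ⟨γ₂, q, hq⟩ := exists_sl_first_col fun l => u (Fin.succ l)
  have hY : (chg (yc i (chg B γ)) γ₂).det ≠ 0 := by
    rw [det_chg]; exact det_yc_ne_zero hdet hi
  obtain ⟨m', γ₃, h₃⟩ := exists_chg_mem_lift (fun Y hY => exists_chg_mem_red Y hY) hY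
  rw [← chg_mul] at h₃
  obtain ⟨m, hm⟩ := exists_blockSL_mem_lift hi hmax h₃
  refine ⟨γ * blockSL m (γ₂ * blockSL m' γ₃), k, q, u 0 - q * m 0, by rwa [chg_mul], fun j => ?_,
    fun j => ?_⟩
  · rw [mul_blockSL_col_zero, h]
  · rw [mul_blockSL_col_zero, show (1 : Fin (n + 2)) = Fin.succ 0 from rfl, mul_blockSL_col_succ,
      hu, Fin.sum_univ_succ]
    simp only [mul_blockSL_col_zero]
    simp only [hq, mul_add, Finset.mul_sum]
    have : ∀ x : Fin (n + 1), γ.1 j x.succ * (q * γ₂.1 x 0) = q * (γ.1 j x.succ * γ₂.1 x 0) :=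
      fun x => by ring
    simp only [this]
    ring

theorem lat_pair (B : Arr (n + 2)) {γ : SpecialLinearGroup (Fin (n + 2)) ℤ} {w : Fin (n + 2) → ℤ}
    {q a : ℤ} (hw : ∀ j, w j = a * γ.1 j 0 + q * γ.1 j 1) :
    lat B w = (a : ℝ) • chg B γ 0 + (q : ℝ) • chg B γ 1 := by
  ext i
  rw [lat_apply, Pi.add_apply, Pi.smul_apply, Pi.smul_apply, chg_apply, chg_apply, smul_eq_mul,
    smul_eq_mul, Finset.mul_sum, Finset.mul_sum, ← Finset.sum_add_distrib]
  refine Finset.sum_congr rfl fun j _ => ?_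
  rw [hw]; push_cast; ring

theorem norm_lat_unit (B : Arr (n + 1)) {γ : SpecialLinearGroup (Fin (n + 1)) ℤ} {k : ℤˣ}
    {v : Fin (n + 1) → ℤ} (hv : ∀ j, v j = k * γ.1 j 0) : ‖lat B v‖ = ‖chg B γ 0‖ := by
  rw [lat_smul_col B γ hv, norm_smul]
  rcases Int.units_eq_one_or k with rfl | rfl <;> simp

/-- The pairs of primitive vectors which are not proportional. -/
def indepPairs (n : ℕ) : Set ((Fin n → ℤ) × (Fin n → ℤ)) :=
  {p | Finset.univ.gcd p.1 = 1 ∧ Finset.univ.gcd p.2 = 1 ∧ p.2 ≠ p.1 ∧ p.2 ≠ -p.1}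

theorem coeff_ne_zero {γ : SpecialLinearGroup (Fin (n + 2)) ℤ} {k : ℤˣ} {q a : ℤ}
    {p : (Fin (n + 2) → ℤ) × (Fin (n + 2) → ℤ)} (hp : p ∈ indepPairs (n + 2))
    (hv : ∀ j, p.1 j = k * γ.1 j 0) (hw : ∀ j, p.2 j = a * γ.1 j 0 + q * γ.1 j 1) : q ≠ 0 := by
  rintro rfl
  obtain ⟨-, h2, h3, h4⟩ := hp
  have ha : IsUnit a := isUnit_of_dvd_one (h2 ▸ Finset.dvd_gcd fun j _ =>
    ⟨γ.1 j 0, by rw [hw]; ring⟩)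
  have h : p.2 = p.1 ∨ p.2 = -p.1 := by
    rcases Int.isUnit_iff.1 ha with rfl | rfl <;> rcases Int.units_eq_one_or k with rfl | rfl
    · left; ext j; rw [hw, hv]; simp
    · right; ext j; rw [hw, Pi.neg_apply, hv]; simp
    · right; ext j; rw [hw, Pi.neg_apply, hv]; simp
    · left; ext j; rw [hw, hv]; simp
  exact h.elim h3 h4

/-- The number of primitive vectors of bounded length in the lattice spanned by `B` is bounded by
a sum over reduced bases. -/
theorem tsum_prim_le {B : Arr (n + 1)} (hB : B.det ≠ 0) (R : ℝ) :
    ∑' v : {v : Fin (n + 1) → ℤ | Finset.univ.gcd v = 1},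
      {x : Fin (n + 1) → ℝ | ‖x‖ ≤ R}.indicator (1 : (Fin (n + 1) → ℝ) → ℝ≥0∞) (lat B v) ≤
    2 * ∑' γ : SpecialLinearGroup (Fin (n + 1)) ℤ, {B : Arr (n + 1) | B ∈ lift (red n) ∧
      ‖B 0‖ ≤ R}.indicator (1 : Arr (n + 1) → ℝ≥0∞) (chg B γ) := by
  have hex := fun v : {v : Fin (n + 1) → ℤ | Finset.univ.gcd v = 1} => exists_reduced_first hB v.2
  choose γ k hγ hk using hex
  have hinj : Function.Injective fun v => (k v, γ v) := fun v v' h => by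
    obtain ⟨h1, h2⟩ := Prod.ext_iff.1 h
    refine Subtype.ext (funext fun j => ?_)
    rw [hk, hk]
    simp only at h1 h2
    rw [h1, h2]
  let F : ℤˣ × SpecialLinearGroup (Fin (n + 1)) ℤ → ℝ≥0∞ := fun x =>
    {B : Arr (n + 1) | B ∈ lift (red n) ∧ ‖B 0‖ ≤ R}.indicator (1 : Arr (n + 1) → ℝ≥0∞) (chg B x.2)
  have h1 : ∑' x, F x = 2 * ∑' γ : SpecialLinearGroup (Fin (n + 1)) ℤ, {B : Arr (n + 1) |
      B ∈ lift (red n) ∧ ‖B 0‖ ≤ R}.indicator (1 : Arr (n + 1) → ℝ≥0∞) (chg B γ) := by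
    rw [ENNReal.tsum_prod', tsum_fintype]
    simp [F]
  rw [← h1]
  refine le_trans (ENNReal.tsum_le_tsum fun v => ?_) (ENNReal.tsum_comp_le_tsum_of_injective hinj F)
  by_cases hv : ‖lat B v.1‖ ≤ R
  swap
  · rw [Set.indicator_of_notMem (show lat B v.1 ∉ {x | ‖x‖ ≤ R} from hv)]
    exact zero_le
  rw [Set.indicator_of_mem (show lat B v.1 ∈ {x | ‖x‖ ≤ R} from hv)]
  have hmem : chg B (γ v) ∈ {B : Arr (n + 1) | B ∈ lift (red n) ∧ ‖B 0‖ ≤ R} :=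
    ⟨hγ v, by rw [← norm_lat_unit B (hk v)]; exact hv⟩
  simp [F, Set.indicator_of_mem hmem]

theorem tsum_indepPairs_le {B : Arr (n + 2)} (hB : B.det ≠ 0) (R : ℝ) :
    ∑' p : indepPairs (n + 2), {x : (Fin (n + 2) → ℝ) × (Fin (n + 2) → ℝ) | ‖x‖ ≤ R}.indicator
      (1 : (Fin (n + 2) → ℝ) × (Fin (n + 2) → ℝ) → ℝ≥0∞) (lat B p.1.1, lat B p.1.2) ≤
    2 * ∑' γ : SpecialLinearGroup (Fin (n + 2)) ℤ,
      (lift (lift (red n))).indicator (pairCount R) (chg B γ) := by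
  have hex := fun p : indepPairs (n + 2) => exists_reduced_pair hB p.2.1 p.1.2
  choose γ k q a hγ hk hw using hex
  have hinj : Function.Injective fun v => (k v, γ v, q v, a v) := fun v v' h => by
    obtain ⟨h1, h2, h3, h4⟩ : k v = k v' ∧ γ v = γ v' ∧ q v = q v' ∧ a v = a v' := by
      simpa using h
    refine Subtype.ext (Prod.ext (funext fun j => ?_) (funext fun j => ?_))
    · rw [hk, hk, h1, h2]
    · rw [hw, hw, h2, h3, h4]
  let F : ℤˣ × SpecialLinearGroup (Fin (n + 2)) ℤ × ℤ × ℤ → ℝ≥0∞ := fun x =>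
    (lift (lift (red n))).indicator (fun B => {B : Arr (n + 2) | x.2.2.1 ≠ 0 ∧ ‖B 0‖ ≤ R ∧
      ‖(x.2.2.2 : ℝ) • B 0 + (x.2.2.1 : ℝ) • B 1‖ ≤ R}.indicator (1 : Arr (n + 2) → ℝ≥0∞) B)
      (chg B x.2.1)
  have h1 : ∑' x, F x = 2 * ∑' γ : SpecialLinearGroup (Fin (n + 2)) ℤ,
      (lift (lift (red n))).indicator (pairCount R) (chg B γ) := by
    rw [ENNReal.tsum_prod', tsum_fintype]
    simp only [F, Finset.sum_const, Finset.card_univ, Fintype.card_units_int, nsmul_eq_mul,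
      Nat.cast_ofNat]
    congr 1
    rw [ENNReal.tsum_prod']
    refine tsum_congr fun γ => ?_
    rw [ENNReal.tsum_prod']
    by_cases h : chg B γ ∈ lift (lift (red n))
    · simp only [Set.indicator_of_mem h]
      rfl
    · simp [Set.indicator_of_notMem h]
  rw [← h1]
  refine le_trans (ENNReal.tsum_le_tsum fun p => ?_) (ENNReal.tsum_comp_le_tsum_of_injective hinj F)
  by_cases hp : (lat B p.1.1, lat B p.1.2) ∈ {x : (Fin (n + 2) → ℝ) × (Fin (n + 2) → ℝ) | ‖x‖ ≤ R}
  swap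
  · rw [Set.indicator_of_notMem hp]
    exact zero_le
  rw [Set.indicator_of_mem hp]
  have hp' : ‖lat B p.1.1‖ ≤ R ∧ ‖lat B p.1.2‖ ≤ R := by
    simpa [Prod.norm_def] using hp
  have hmem : chg B (γ p) ∈ {B : Arr (n + 2) | q p ≠ 0 ∧ ‖B 0‖ ≤ R ∧
      ‖(a p : ℝ) • B 0 + (q p : ℝ) • B 1‖ ≤ R} :=
    ⟨coeff_ne_zero p.2 (hk p) (hw p), by rw [← norm_lat_unit B (hk p)]; exact hp'.1,
      by rw [← lat_pair B (hw p)]; exact hp'.2⟩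
  simp only [F, Set.indicator_of_mem (hγ p), Set.indicator_of_mem hmem]
  rfl

end Arr

/-! ### Congruence subgroups and finiteness of moments -/

namespace SLR

/-- The inclusion of `SL_d(ℤ)` in `SL_d(ℝ)`. -/
noncomputable def ofInt (d : ℕ) : SpecialLinearGroup (Fin d) ℤ →* SLR d :=
  SpecialLinearGroup.map (Int.castRingHom ℝ)

/-- Reduction of `SL_d(ℤ)` modulo `N`. -/
noncomputable def modN (N d : ℕ) :
    SpecialLinearGroup (Fin d) ℤ →* SpecialLinearGroup (Fin d) (ZMod N) :=
  SpecialLinearGroup.map (Int.castRingHom (ZMod N))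

/-- The inclusion of the principal congruence subgroup of level `N` in `SL_d(ℝ)`. -/
noncomputable abbrev congInc (N d : ℕ) : (modN N d).ker →* SLR d :=
  (ofInt d).comp (modN N d).ker.subtype

variable {d : ℕ}

theorem ofInt_apply (γ : SpecialLinearGroup (Fin d) ℤ) (i j : Fin d) :
    (ofInt d γ).1 i j = (γ.1 i j : ℝ) := rfl

theorem lat_cols (g : SLR d) (v : Fin d → ℤ) :
    Arr.lat (cols g) v = g • (fun j => (v j : ℝ)) := by
  ext i
  rw [Arr.lat_apply, smul_apply]
  exact Finset.sum_congr rfl fun k _ => mul_comm _ _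

theorem cols_mul_ofInt (g : SLR d) (γ : SpecialLinearGroup (Fin d) ℤ) :
    cols (g * ofInt d γ) = Arr.chg (cols g) γ := by
  rw [cols_mul]
  ext1 j
  exact (lat_cols g fun k => γ.1 k j).symm

instance : Countable (SpecialLinearGroup (Fin d) ℤ) :=
  have : Countable (Matrix (Fin d) (Fin d) ℤ) := inferInstanceAs (Countable (Fin d → Fin d → ℤ))
  Subtype.countable

theorem exists_isFD_congInc (N d : ℕ) : ∃ D, IsFD (congInc N d) D := by
  refine exists_isFD _ fun γ hγ => ?_
  refine Subtype.ext (Subtype.ext ?_)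
  ext i j
  have h := hγ i j
  have h2 : (1 : Matrix (Fin d) (Fin d) ℝ) i j = ((1 : Matrix (Fin d) (Fin d) ℤ) i j : ℝ) := by
    simp [Matrix.one_apply]
  have h3 : (congInc N d γ).1 i j = (γ.1.1 i j : ℝ) := rfl
  rw [h2, h3] at h
  have h4 : |γ.1.1 i j - (1 : Matrix (Fin d) (Fin d) ℤ) i j| < 1 := by exact_mod_cast h
  exact sub_eq_zero.1 (Int.abs_lt_one_iff.1 h4)

theorem lintegral_haar_cols_le [NeZero d] {F : Arr d → ℝ≥0∞} (hF : Measurable F)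
    (hc : ∀ c : ℝ, 1 ≤ c → ∀ B, F (c • B) ≤ F B) :
    ∫⁻ g, F (cols g) ∂haar d ≤ ∫⁻ B in cone d, F B := by
  refine (lintegral_haar (hF.comp measurableEmbedding_cols.measurable)).trans_le ?_
  refine setLIntegral_mono' measurableSet_cone fun B hB => ?_
  rw [Function.comp_apply, cols_nrm hB.1]
  exact hc _ (one_le_det_rpow hB) _

theorem lintegral_tsum_chg_lt_top [NeZero d] {N : ℕ} [NeZero N] {D : Set (SLR d)}
    (hD : IsFD (congInc N d) D) {F : Arr d → ℝ≥0∞} (hF : Measurable F)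
    (hc : ∀ c : ℝ, 1 ≤ c → ∀ B, F (c • B) ≤ F B) (hfin : ∫⁻ B in cone d, F B < ∞) :
    ∫⁻ g in D, ∑' γ : SpecialLinearGroup (Fin d) ℤ, F (Arr.chg (cols g) γ) ∂haar d < ∞ := by
  have : Fintype (SpecialLinearGroup (Fin d) (ZMod N)) := inferInstance
  have h := hD.lintegral_tsum_le (haar d) (hF.comp measurableEmbedding_cols.measurable)
  simp only [Function.comp_apply, cols_mul_ofInt] at h
  refine h.trans_lt (ENNReal.mul_lt_top (natCast_lt_top _) ?_)
  exact (lintegral_haar_cols_le hF hc).trans_lt hfin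

variable {n N : ℕ} [NeZero N]

theorem det_cols_ne_zero (g : SLR d) : (cols g).det ≠ 0 := by
  rw [det_cols]; exact one_ne_zero

theorem haar_fd_lt_top {D : Set (SLR (n + 1))} (hD : IsFD (congInc N (n + 1)) D) :
    haar (n + 1) D < ∞ := by
  obtain ⟨C, hC, h⟩ := Arr.exists_volLe_red (n + 1)
  have hm := Arr.measurableSet_red (n + 1)
  have key := lintegral_tsum_chg_lt_top hD
    (F := (Arr.red (n + 1)).indicator (1 : Arr (n + 1) → ℝ≥0∞)) (measurable_one.indicator hm)
    (fun c hc B => by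
      have := Arr.isCone_red (n + 1) c (by positivity) B
      by_cases hB : B ∈ Arr.red (n + 1)
      · rw [Set.indicator_of_mem hB, Set.indicator_of_mem (this.2 hB)]; rfl
      · rw [Set.indicator_of_notMem (mt this.1 hB)]; exact zero_le)
    (by
      rw [lintegral_indicator_one hm, Measure.restrict_apply hm]
      refine (measure_mono fun B hB => ?_).trans_lt ((h 1 one_pos).trans_lt ?_)
      · exact ⟨hB.1, by rw [abs_of_pos hB.2.1]; exact hB.2.2⟩
      · rw [ENNReal.ofReal_one, one_pow, mul_one]; exact hC.lt_top)
  refine lt_of_le_of_lt ?_ key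
  rw [← setLIntegral_one]
  refine setLIntegral_mono' hD.1 fun g _ => ?_
  obtain ⟨γ, hγ⟩ := Arr.exists_chg_mem_red (cols g) (det_cols_ne_zero g)
  refine le_trans ?_ (ENNReal.le_tsum γ)
  rw [Set.indicator_of_mem hγ]; rfl

theorem measurable_smul_vec (v : Fin d → ℝ) : Measurable fun g : SLR d => g • v :=
  measurable_id.smul_const v

theorem lintegral_prim_lt_top {D : Set (SLR (n + 1))} (hD : IsFD (congInc N (n + 1)) D)
    {R : ℝ} (hR : 0 < R) :
    ∫⁻ g in D, ∑' v : {v : Fin (n + 1) → ℤ | Finset.univ.gcd v = 1},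
      {x : Fin (n + 1) → ℝ | ‖x‖ ≤ R}.indicator (1 : (Fin (n + 1) → ℝ) → ℝ≥0∞)
        (g • fun j => (v.1 j : ℝ)) ∂haar (n + 1) < ∞ := by
  obtain ⟨C, hC, h⟩ := Arr.exists_volLe_red n
  let E : Set (Arr (n + 1)) := {B | B ∈ Arr.lift (Arr.red n) ∧ ‖B 0‖ ≤ R}
  have hm : MeasurableSet E := (Arr.measurableSet_lift (Arr.measurableSet_red n)).inter
    (measurableSet_le (measurable_pi_apply (0 : Fin (n + 1))).norm measurable_const)
  have key := lintegral_tsum_chg_lt_top hD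
    (F := E.indicator (1 : Arr (n + 1) → ℝ≥0∞)) (measurable_one.indicator hm)
    (fun c hc B => by
      have := (Arr.isCone_red n).lift c (by positivity) B
      by_cases hB : c • B ∈ E
      · have hB' : B ∈ E := ⟨this.1 hB.1, le_trans (by
          have h2 : ‖c • B 0‖ = c * ‖B 0‖ := by
            rw [norm_smul, Real.norm_of_nonneg (by positivity)]
          change ‖B 0‖ ≤ ‖c • B 0‖
          rw [h2]
          exact le_mul_of_one_le_left (norm_nonneg _) hc) hB.2⟩
        rw [Set.indicator_of_mem hB, Set.indicator_of_mem hB']; rfl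
      · rw [Set.indicator_of_notMem hB]; exact zero_le)
    (by
      rw [lintegral_indicator_one hm, Measure.restrict_apply hm]
      refine (measure_mono fun B hB => ?_).trans_lt
        ((h.lift (Arr.measurableSet_red n) hR one_pos).trans_lt ?_)
      · exact ⟨hB.1.1, hB.1.2, by rw [abs_of_pos hB.2.1]; exact hB.2.2⟩
      · rw [ENNReal.ofReal_one, one_pow, mul_one]
        exact ENNReal.mul_lt_top (by finiteness) (ENNReal.mul_lt_top hC.lt_top ofReal_lt_top))
  refine lt_of_le_of_lt ?_ (ENNReal.mul_lt_top (ofNat_lt_top (n := 2)) key)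
  rw [← lintegral_const_mul']
  swap; · finiteness
  refine setLIntegral_mono' hD.1 fun g _ => ?_
  have := Arr.tsum_prim_le (det_cols_ne_zero g) R
  simp only [lat_cols] at this
  exact this

theorem measurable_pairCount (R : ℝ) : Measurable (Arr.pairCount (n := n) R) := by
  refine Measurable.tsum fun q => Measurable.tsum fun a => ?_
  refine measurable_one.indicator ?_
  refine (MeasurableSet.const _).inter (MeasurableSet.inter ?_ ?_)
  · exact measurableSet_le (measurable_pi_apply _).norm measurable_const
  · refine measurableSet_le (Measurable.norm ?_) measurable_const
    exact ((measurable_pi_apply (0 : Fin (n + 2))).const_smul (a : ℝ)).add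
      ((measurable_pi_apply (1 : Fin (n + 2))).const_smul (q : ℝ))

theorem pairCount_smul_le (R : ℝ) {c : ℝ} (hc : 1 ≤ c) (B : Arr (n + 2)) :
    Arr.pairCount R (c • B) ≤ Arr.pairCount R B := by
  refine ENNReal.tsum_le_tsum fun q => ENNReal.tsum_le_tsum fun a => ?_
  have h2 : ∀ x : Fin (n + 2) → ℝ, ‖c • x‖ ≤ R → ‖x‖ ≤ R := fun x hx => by
    rw [norm_smul, Real.norm_of_nonneg (by positivity)] at hx
    exact (le_mul_of_one_le_left (norm_nonneg _) hc).trans hx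
  by_cases h : c • B ∈ {B : Arr (n + 2) | q ≠ 0 ∧ ‖B 0‖ ≤ R ∧
    ‖(a : ℝ) • B 0 + (q : ℝ) • B 1‖ ≤ R}
  · have h' : B ∈ {B : Arr (n + 2) | q ≠ 0 ∧ ‖B 0‖ ≤ R ∧
        ‖(a : ℝ) • B 0 + (q : ℝ) • B 1‖ ≤ R} := by
      refine ⟨h.1, h2 _ h.2.1, h2 _ ?_⟩
      have h3 := h.2.2
      rwa [Pi.smul_apply, Pi.smul_apply, smul_comm (a : ℝ) c, smul_comm (q : ℝ) c,
        ← smul_add] at h3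
    rw [Set.indicator_of_mem h, Set.indicator_of_mem h']; rfl
  · rw [Set.indicator_of_notMem h]; exact zero_le

theorem lintegral_indepPairs_lt_top (hn : 1 ≤ n) {D : Set (SLR (n + 2))}
    (hD : IsFD (congInc N (n + 2)) D) {R : ℝ} (hR : 0 < R) :
    ∫⁻ g in D, ∑' p : Arr.indepPairs (n + 2),
      {x : (Fin (n + 2) → ℝ) × (Fin (n + 2) → ℝ) | ‖x‖ ≤ R}.indicator
        (1 : (Fin (n + 2) → ℝ) × (Fin (n + 2) → ℝ) → ℝ≥0∞)
        (g • (fun j => (p.1.1 j : ℝ)), g • (fun j => (p.1.2 j : ℝ))) ∂haar (n + 2) < ∞ := by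
  obtain ⟨C, hC, h⟩ := Arr.exists_volLe_red n
  let E : Set (Arr (n + 2)) := Arr.lift (Arr.lift (Arr.red n))
  have hE : MeasurableSet E :=
    Arr.measurableSet_lift (Arr.measurableSet_lift (Arr.measurableSet_red n))
  have key := lintegral_tsum_chg_lt_top hD
    (F := E.indicator (Arr.pairCount R)) ((measurable_pairCount R).indicator hE)
    (fun c hc B => by
      have := (Arr.isCone_red n).lift.lift c (by positivity) B
      by_cases hB : B ∈ E
      · rw [Set.indicator_of_mem hB, Set.indicator_of_mem (this.2 hB)]
        exact pairCount_smul_le R hc B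
      · rw [Set.indicator_of_notMem (mt this.1 hB)]; exact zero_le)
    (by
      rw [setLIntegral_indicator hE]
      refine (lintegral_mono_set fun B hB => ?_).trans_lt
        (Arr.lintegral_pairCount_lt_top hn (Arr.measurableSet_red n) hC h hR)
      exact ⟨hB.1, by rw [abs_of_pos hB.2.1]; exact hB.2.2⟩)
  refine lt_of_le_of_lt ?_ (ENNReal.mul_lt_top (ofNat_lt_top (n := 2)) key)
  rw [← lintegral_const_mul']
  swap; · finiteness
  refine setLIntegral_mono' hD.1 fun g _ => ?_
  have := Arr.tsum_indepPairs_le (det_cols_ne_zero g) R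
  simp only [lat_cols] at this
  exact this

end SLR

/-! ### Mean values over lattices as multiples of Lebesgue measure -/

section Transitive

theorem exists_linearIndependent_extend {d : ℕ} : ∀ (m k : ℕ) (h : k + m = d)
    {v : Fin k → Fin d → ℝ} (_ : LinearIndependent ℝ v),
    ∃ B : Fin d → Fin d → ℝ, LinearIndependent ℝ B ∧ ∀ i : Fin k, B (i.castLE (by omega)) = v i
  | 0, k, h, v, hv => by
    obtain rfl : k = d := by omega
    exact ⟨v, hv, fun i => rfl⟩
  | m + 1, k, h, v, hv => by
    obtain ⟨x, hx⟩ := exists_linearIndependent_snoc_of_lt_finrank hv (by simp; omega)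
    obtain ⟨B, hB, hBv⟩ := exists_linearIndependent_extend m (k + 1) (by omega) hx
    refine ⟨B, hB, fun i => ?_⟩
    have := hBv i.castSucc
    rw [Fin.snoc_castSucc] at this
    exact this

theorem SLR.exists_smul_single_eq {d k : ℕ} (hk : k < d) {v : Fin k → Fin d → ℝ}
    (hv : LinearIndependent ℝ v) :
    ∃ g : SLR d, ∀ i : Fin k, g • (Pi.single (i.castLE hk.le) 1 : Fin d → ℝ) = v i := by
  obtain ⟨B, hB, hBv⟩ := exists_linearIndependent_extend (d - k) k (by omega) hv
  have hdet : (Matrix.of B).det ≠ 0 := fun h =>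
    Matrix.exists_vecMul_eq_zero_iff.2 h |>.elim fun w hw => hw.1 (by
      have h1 : ∑ i, w i • B i = 0 := by
        have := hw.2
        ext j
        have := congrFun this j
        simpa [Matrix.vecMul, dotProduct] using this
      ext i
      exact Fintype.linearIndependent_iff.1 hB w h1 i)
  let l : Fin d := ⟨k, hk⟩
  let C : Matrix (Fin d) (Fin d) ℝ := (Matrix.of B).updateRow l ((Matrix.of B).det⁻¹ • B l)
  have hC : C.det = 1 := by
    rw [Matrix.det_updateRow_smul]
    have : (Matrix.of B).updateRow l (B l) = Matrix.of B := Matrix.updateRow_eq_self _ l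
    rw [this, inv_mul_cancel₀ hdet]
  let g : SLR d := ⟨Cᵀ, by rw [Matrix.det_transpose, hC]⟩
  refine ⟨g, fun i => ?_⟩
  ext j
  rw [SLR.smul_apply, Finset.sum_eq_single (i.castLE hk.le)]
  · have hne : i.castLE hk.le ≠ l := by
      intro h
      have := congrArg Fin.val h
      have := i.2
      simp [l] at *
      omega
    simp only [Pi.single_eq_same, mul_one]
    change C (i.castLE hk.le) j = v i j
    exact (congrFun (Matrix.updateRow_ne hne) j).trans (congrFun (hBv i) j)
  · intro b _ hb
    rw [Pi.single_eq_of_ne hb, mul_zero]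
  · simp

end Transitive

section Mean

variable {d : ℕ} [NeZero d] {L : Type*} [Group L] [Countable L] {ι : L →* SLR d} {D : Set (SLR d)}

variable {Y : Type*} [MeasurableSpace Y] [MulAction (SLR d) Y] [MeasurableSMul₂ (SLR d) Y]
  {I : Type*} [Countable I]

/-- If the orbit of a family of points under a lattice only permutes the family, then the mean of
the corresponding sum over a fundamental domain is a multiple of the invariant measure. -/
theorem SLR.IsFD.exists_mean_eq (hD : IsFD ι D) (w : I → Y)
    (hw : ∀ γ, ∃ e : I ≃ I, ∀ i, ι γ • w i = w (e i))
    (ℓ : Measure Y) [SigmaFinite ℓ] [SMulInvariantMeasure (SLR d) Y ℓ] (hℓ : ℓ ≠ 0)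
    (o : Y) {Y₀ : Set Y} (hY₀ : MeasurableSet Y₀) (horb : ∀ y ∈ Y₀, ∃ h : SLR d, y = h • o)
    (hstab : ∀ (g : SLR d), ∀ y ∈ Y₀, g • y ∈ Y₀) (hwY : ∀ i, w i ∈ Y₀) (hnull : ℓ Y₀ᶜ = 0)
    {E : ℕ → Set Y} (hEm : ∀ n, MeasurableSet (E n)) (hE : ⋃ n, E n = Set.univ)
    (hfin : ∀ n, ∫⁻ g in D, ∑' i, (E n).indicator (1 : Y → ℝ≥0∞) (g • w i) ∂haar d < ∞) :
    ∃ c : ℝ≥0∞, c ≠ ∞ ∧ ∀ f : Y → ℝ≥0∞, Measurable f →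
      ∫⁻ g in D, ∑' i, f (g • w i) ∂haar d = c * ∫⁻ y, f y ∂ℓ := by
  have hms : ∀ i, Measurable fun g : SLR d => g • w i := fun i => measurable_id.smul_const (w i)
  let m : Measure Y := Measure.sum fun i => ((haar d).restrict D).map fun g => g • w i
  have hm : ∀ f : Y → ℝ≥0∞, Measurable f → ∫⁻ y, f y ∂m =
      ∫⁻ g in D, ∑' i, f (g • w i) ∂haar d := fun f hf => by
    rw [lintegral_sum_measure]
    refine Eq.trans ?_ (lintegral_tsum fun i => (hf.comp (hms i)).aemeasurable).symm
    exact tsum_congr fun i => lintegral_map hf (hms i)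
  have hmE : ∀ E : Set Y, MeasurableSet E → m E =
      ∫⁻ g in D, ∑' i, E.indicator (1 : Y → ℝ≥0∞) (g • w i) ∂haar d := fun E hE => by
    rw [← hm _ (measurable_one.indicator hE), lintegral_indicator_one hE]
  have : SigmaFinite m := ⟨⟨⟨E, fun _ => trivial,
      fun n => by rw [hmE _ (hEm n)]; exact hfin n, hE⟩⟩⟩
  have : SMulInvariantMeasure (SLR d) Y m := ⟨fun h E hE => by
    have hE' : MeasurableSet ((fun y : Y => h • y) ⁻¹' E) := measurable_const_smul h hE
    rw [hmE _ hE, hmE _ hE']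
    have hΨ : Measurable fun g : SLR d => ∑' i, E.indicator (1 : Y → ℝ≥0∞) (g • w i) :=
      Measurable.tsum fun i => (measurable_one.indicator hE).comp (hms i)
    rw [← hD.setLIntegral_mul_left (haar d) hΨ ?_ h]
    · refine lintegral_congr fun g => tsum_congr fun i => ?_
      rw [mul_smul]; rfl
    · intro g γ
      obtain ⟨e, he⟩ := hw γ
      simp only [mul_smul, he]
      exact e.tsum_eq fun i => E.indicator (1 : Y → ℝ≥0∞) (g • w i)⟩
  have hom : ∀ᵐ y ∂m, ∃ h : SLR d, y = h • o := by
    have : ∀ᵐ y ∂m, y ∈ Y₀ := by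
      refine (Measure.ae_sum_iff' hY₀).2 fun i => (ae_map_iff (hms i).aemeasurable hY₀).2 ?_
      exact Filter.Eventually.of_forall fun g => hstab g _ (hwY i)
    filter_upwards [this] with y hy using horb y hy
  have hoℓ : ∀ᵐ y ∂ℓ, ∃ h : SLR d, y = h • o := by
    have : ∀ᵐ y ∂ℓ, y ∈ Y₀ := hnull
    filter_upwards [this] with y hy using horb y hy
  obtain ⟨c, hc, hmc⟩ := exists_eq_smul_of_transitive (haar_ne_zero (d := d)) hℓ o hom hoℓ
  refine ⟨c, hc, fun f hf => ?_⟩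
  rw [← hm f hf, hmc, lintegral_smul_measure, smul_eq_mul]

end Mean

/-! ### Primitive vectors in a congruence class -/

/-- Primitive integer vectors congruent to `v₀` modulo `N`. -/
def primCong {d : ℕ} (N : ℕ) (v₀ : Fin d → ℤ) : Set (Fin d → ℤ) :=
  {v | Finset.univ.gcd v = 1 ∧ ∀ j, (N : ℤ) ∣ v j - v₀ j}

/-- Pairs in `primCong` which are not equal up to sign. -/
def primCongPairs {d : ℕ} (N : ℕ) (v₀ : Fin d → ℤ) : Set ((Fin d → ℤ) × (Fin d → ℤ)) :=
  {p | p.1 ∈ primCong N v₀ ∧ p.2 ∈ primCong N v₀ ∧ p.2 ≠ p.1 ∧ p.2 ≠ -p.1}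

/-- The real vector attached to an integer vector. -/
def realVec {d : ℕ} (v : Fin d → ℤ) : Fin d → ℝ := fun j => (v j : ℝ)

section IntegralAction

variable {d : ℕ}

theorem ofInt_smul_realVec (γ : SpecialLinearGroup (Fin d) ℤ) (v : Fin d → ℤ) :
    SLR.ofInt d γ • realVec v = realVec (γ.1.mulVec v) := by
  ext i
  rw [SLR.smul_apply]
  simp [realVec, Matrix.mulVec, dotProduct, SLR.ofInt_apply]

theorem gcd_dvd_gcd_mulVec (M : Matrix (Fin d) (Fin d) ℤ) (v : Fin d → ℤ) :
    Finset.univ.gcd v ∣ Finset.univ.gcd (M.mulVec v) :=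
  Finset.dvd_gcd fun i _ => by
    rw [Matrix.mulVec, dotProduct]
    exact Finset.dvd_sum fun j _ => dvd_mul_of_dvd_right (Finset.gcd_dvd (Finset.mem_univ j)) _

theorem inv_mulVec_mulVec (γ : SpecialLinearGroup (Fin d) ℤ) (v : Fin d → ℤ) :
    (γ⁻¹).1.mulVec (γ.1.mulVec v) = v := by
  have h : (γ⁻¹).1 * γ.1 = 1 := congrArg Subtype.val (inv_mul_cancel γ)
  rw [Matrix.mulVec_mulVec, h, Matrix.one_mulVec]

theorem gcd_mulVec_eq_one (γ : SpecialLinearGroup (Fin d) ℤ) {v : Fin d → ℤ}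
    (hv : Finset.univ.gcd v = 1) : Finset.univ.gcd (γ.1.mulVec v) = 1 := by
  have h := gcd_dvd_gcd_mulVec (γ⁻¹).1 (γ.1.mulVec v)
  rw [inv_mulVec_mulVec, hv] at h
  rw [← Finset.normalize_gcd]
  exact normalize_eq_one.2 (isUnit_of_dvd_one h)

variable {N : ℕ} {v₀ : Fin d → ℤ}

theorem mulVec_mem_primCong (γ : (SLR.modN N d).ker) {v : Fin d → ℤ} (hv : v ∈ primCong N v₀) :
    γ.1.1.mulVec v ∈ primCong N v₀ := by
  refine ⟨gcd_mulVec_eq_one γ.1 hv.1, fun j => ?_⟩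
  have hj := hv.2 j
  rw [← ZMod.intCast_eq_intCast_iff_dvd_sub] at hj ⊢
  rw [hj]
  have hγ : ∀ k, ((γ.1.1 j k : ℤ) : ZMod N) = (1 : Matrix (Fin d) (Fin d) (ZMod N)) j k :=
    fun k => by
      have h : SLR.modN N d γ.1 = 1 := MonoidHom.mem_ker.1 γ.2
      exact congrFun (congrFun (congrArg Subtype.val h) j) k
  simp [Matrix.mulVec, dotProduct, hγ, Matrix.one_apply]

/-- The permutation of `primCong` induced by an element of the congruence subgroup. -/
noncomputable def primCongPerm (v₀ : Fin d → ℤ) (γ : (SLR.modN N d).ker) :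
    primCong N v₀ ≃ primCong N v₀ where
  toFun v := ⟨γ.1.1.mulVec v.1, mulVec_mem_primCong γ v.2⟩
  invFun v := ⟨(γ⁻¹).1.1.mulVec v.1, mulVec_mem_primCong γ⁻¹ v.2⟩
  left_inv v := Subtype.ext (inv_mulVec_mulVec γ.1 v.1)
  right_inv v := Subtype.ext (by
    have := inv_mulVec_mulVec (γ⁻¹).1 v.1
    simpa using this)

theorem mulVec_mem_primCongPairs (γ : (SLR.modN N d).ker) {p : (Fin d → ℤ) × (Fin d → ℤ)}
    (hp : p ∈ primCongPairs N v₀) :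
    (γ.1.1.mulVec p.1, γ.1.1.mulVec p.2) ∈ primCongPairs N v₀ := by
  refine ⟨mulVec_mem_primCong γ hp.1, mulVec_mem_primCong γ hp.2.1, fun h => hp.2.2.1 ?_,
    fun h => hp.2.2.2 ?_⟩
  · have := congrArg (γ.1⁻¹).1.mulVec h
    rwa [inv_mulVec_mulVec, inv_mulVec_mulVec] at this
  · have := congrArg (γ.1⁻¹).1.mulVec h
    simp only [Matrix.mulVec_neg] at this
    rwa [inv_mulVec_mulVec, inv_mulVec_mulVec] at this

/-- The permutation of `primCongPairs` induced by an element of the congruence subgroup. -/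
noncomputable def primCongPairsPerm (v₀ : Fin d → ℤ) (γ : (SLR.modN N d).ker) :
    primCongPairs N v₀ ≃ primCongPairs N v₀ where
  toFun p := ⟨(γ.1.1.mulVec p.1.1, γ.1.1.mulVec p.1.2), mulVec_mem_primCongPairs γ p.2⟩
  invFun p := ⟨((γ⁻¹).1.1.mulVec p.1.1, (γ⁻¹).1.1.mulVec p.1.2), mulVec_mem_primCongPairs γ⁻¹ p.2⟩
  left_inv p := Subtype.ext (Prod.ext (inv_mulVec_mulVec γ.1 _) (inv_mulVec_mulVec γ.1 _))
  right_inv p := Subtype.ext (Prod.ext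
    (by have := inv_mulVec_mulVec (γ⁻¹).1 p.1.1; simpa using this)
    (by have := inv_mulVec_mulVec (γ⁻¹).1 p.1.2; simpa using this))

end IntegralAction

section Minors

variable {d : ℕ}

/-- Pairs of vectors with a nonzero minor. -/
def minorPairs (d : ℕ) : Set ((Fin d → ℝ) × (Fin d → ℝ)) :=
  {p | ∃ i j, p.1 i * p.2 j - p.1 j * p.2 i ≠ 0}

theorem mem_minorPairs_iff {p : (Fin d → ℝ) × (Fin d → ℝ)} :
    p ∈ minorPairs d ↔ LinearIndependent ℝ ![p.1, p.2] := by
  rw [LinearIndependent.pair_iff]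
  constructor
  · rintro ⟨i, j, hij⟩ s t h
    have hi : s * p.1 i + t * p.2 i = 0 := congrFun h i
    have hj : s * p.1 j + t * p.2 j = 0 := congrFun h j
    constructor
    · refine (mul_eq_zero.1 (?_ : s * (p.1 i * p.2 j - p.1 j * p.2 i) = 0)).resolve_right hij
      linear_combination p.2 j * hi - p.2 i * hj
    · refine (mul_eq_zero.1 (?_ : t * (p.1 i * p.2 j - p.1 j * p.2 i) = 0)).resolve_right hij
      linear_combination p.1 i * hj - p.1 j * hi
  · intro h
    by_contra hp
    have hp' : ∀ i j, p.1 i * p.2 j - p.1 j * p.2 i = 0 := by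
      simpa [minorPairs] using hp
    obtain ⟨i, hi⟩ : ∃ i, p.1 i ≠ 0 := by
      by_contra! h0
      have := (h 1 0 (by ext i; simp [h0])).1
      exact one_ne_zero this
    have := (h (-p.2 i) (p.1 i) (by
      ext j
      simp only [Pi.add_apply, Pi.smul_apply, smul_eq_mul, Pi.zero_apply]
      linear_combination hp' i j)).2
    exact hi this

theorem measurableSet_minorPairs : MeasurableSet (minorPairs d) := by
  have : minorPairs d = ⋃ i, ⋃ j, {p : (Fin d → ℝ) × (Fin d → ℝ) |
      p.1 i * p.2 j - p.1 j * p.2 i ≠ 0} := by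
    ext; simp [minorPairs]
  rw [this]
  refine MeasurableSet.iUnion fun i => MeasurableSet.iUnion fun j => ?_
  have h : Measurable fun p : (Fin d → ℝ) × (Fin d → ℝ) => p.1 i * p.2 j - p.1 j * p.2 i := by
    have h1 : ∀ k, Measurable fun p : (Fin d → ℝ) × (Fin d → ℝ) => p.1 k := fun k =>
      (measurable_pi_apply k).comp measurable_fst
    have h2 : ∀ k, Measurable fun p : (Fin d → ℝ) × (Fin d → ℝ) => p.2 k := fun k =>
      (measurable_pi_apply k).comp measurable_snd
    exact ((h1 i).mul (h2 j)).sub ((h1 j).mul (h2 i))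
  exact h (measurableSet_singleton 0).compl

theorem smul_mem_minorPairs (g : SLR d) {p : (Fin d → ℝ) × (Fin d → ℝ)} (hp : p ∈ minorPairs d) :
    g • p ∈ minorPairs d := by
  rw [mem_minorPairs_iff, LinearIndependent.pair_iff] at hp ⊢
  intro s t h
  refine hp s t ?_
  have h2 : g • (s • p.1 + t • p.2) = 0 := by
    rw [← h]
    simp only [SLR.smul_def, Prod.smul_fst, Prod.smul_snd, Matrix.mulVec_add, Matrix.mulVec_smul]
  have h3 := congrArg (fun x => g⁻¹ • x) h2
  simpa using h3

theorem volume_compl_minorPairs (hd : 2 ≤ d) : volume (minorPairs d)ᶜ = 0 := by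
  rw [Measure.volume_eq_prod, Measure.measure_prod_null measurableSet_minorPairs.compl]
  have : Nonempty (Fin d) := ⟨⟨0, by omega⟩⟩
  have h0 : ∀ᵐ x : Fin d → ℝ, x ≠ 0 := by
    rw [ae_iff]; simp
  filter_upwards [h0] with x hx
  obtain ⟨i, hi⟩ := Function.ne_iff.1 hx
  have hi' : x i ≠ 0 := hi
  refine measure_mono_null (t := (Submodule.span ℝ {x} : Set (Fin d → ℝ))) ?_
    (Measure.addHaar_submodule _ _ fun h => ?_)
  · intro y hy
    have hy' : ∀ i j, x i * y j - x j * y i = 0 := by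
      simpa [minorPairs] using hy
    refine Submodule.mem_span_singleton.2 ⟨y i / x i, ?_⟩
    ext j
    simp only [Pi.smul_apply, smul_eq_mul]
    field_simp
    linear_combination -hy' i j
  · have h1 := finrank_span_singleton (K := ℝ) hx
    rw [h, finrank_top] at h1
    simp at h1
    omega

theorem realVec_mem_minorPairs {N : ℕ} {v₀ : Fin d → ℤ} {p : (Fin d → ℤ) × (Fin d → ℤ)}
    (hp : p ∈ primCongPairs N v₀) : (realVec p.1, realVec p.2) ∈ minorPairs d := by
  obtain ⟨⟨h1, -⟩, ⟨h2, -⟩, h3, h4⟩ := hp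
  by_contra h
  have hm : ∀ i j, p.1 i * p.2 j = p.1 j * p.2 i := fun i j => by
    have h5 : ∀ i j, (p.1 i : ℝ) * p.2 j - p.1 j * p.2 i = 0 := by
      simpa [minorPairs, realVec] using h
    exact_mod_cast sub_eq_zero.1 (h5 i j)
  have hab : ∀ i, normalize (p.1 i) = normalize (p.2 i) := fun i => by
    have e1 : Finset.univ.gcd (fun j => p.1 i * p.2 j) = normalize (p.1 i) := by
      rw [Finset.gcd_mul_left, h2, mul_one]
    have e2 : Finset.univ.gcd (fun j => p.2 i * p.1 j) = normalize (p.2 i) := by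
      rw [Finset.gcd_mul_left, h1, mul_one]
    rw [← e1, ← e2]
    congr 1
    ext j
    rw [hm, mul_comm]
  obtain ⟨i, hi⟩ : ∃ i, p.1 i ≠ 0 := by
    by_contra! h0
    have : Finset.univ.gcd p.1 = 0 := Finset.gcd_eq_zero_iff.2 fun i _ => h0 i
    rw [this] at h1
    exact zero_ne_one h1
  have hi2 : p.2 i = p.1 i ∨ p.2 i = -p.1 i := by
    have := normalize_eq_normalize_iff.1 (hab i)
    exact Int.natAbs_eq_natAbs_iff.1 (Int.natAbs_eq_of_dvd_dvd this.2 this.1)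
  rcases hi2 with hi2 | hi2
  · refine h3 (funext fun j => mul_left_cancel₀ hi ?_)
    rw [hm, hi2, mul_comm]
  · refine h4 (funext fun j => mul_left_cancel₀ hi ?_)
    rw [hm, hi2, Pi.neg_apply]; ring

end Minors

instance {d : ℕ} : MeasurableSMul₂ (SLR d) ((Fin d → ℝ) × (Fin d → ℝ)) :=
  ⟨continuous_smul.measurable⟩

instance {d : ℕ} : SMulInvariantMeasure (SLR d) ((Fin d → ℝ) × (Fin d → ℝ)) volume :=
  ⟨fun g _ hs => ((SLR.measurePreserving_smul g).prod
    (SLR.measurePreserving_smul g)).measure_preimage hs.nullMeasurableSet⟩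

section Mean

variable {n N : ℕ} [NeZero N] {D : Set (SLR (n + 2))} (v₀ : Fin (n + 2) → ℤ)

theorem exists_mean_one (hD : SLR.IsFD (SLR.congInc N (n + 2)) D) :
    ∃ c : ℝ≥0∞, c ≠ ∞ ∧ ∀ f : (Fin (n + 2) → ℝ) → ℝ≥0∞, Measurable f →
      ∫⁻ g in D, ∑' v : primCong N v₀, f (g • realVec v.1) ∂SLR.haar (n + 2) =
        c * ∫⁻ y, f y := by
  have hne : (volume : Measure (Fin (n + 2) → ℝ)) ≠ 0 := NeZero.ne _
  refine hD.exists_mean_eq (fun v : primCong N v₀ => realVec v.1)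
    (fun γ => ⟨primCongPerm v₀ γ, fun v => ofInt_smul_realVec γ.1 v.1⟩) volume hne
    (Pi.single 0 1) (Y₀ := {0}ᶜ) (measurableSet_singleton 0).compl (fun y hy => ?_)
    (fun g y hy => ?_) (fun v h => ?_) (by simp) (E := fun k : ℕ => {y | ‖y‖ ≤ (k : ℝ) + 1})
    (fun k => measurableSet_le measurable_norm measurable_const) ?_ fun k => ?_
  · obtain ⟨g, hg⟩ := SLR.exists_smul_single_eq (k := 1) (by omega : 1 < n + 2)
      (v := ![y]) (linearIndependent_unique_iff.2 hy)
    exact ⟨g, (hg 0).symm⟩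
  · intro h
    apply hy
    have h3 := congrArg (fun x => g⁻¹ • x) (Set.mem_singleton_iff.1 h)
    simpa using h3
  · have h0 : v.1 = 0 := by
      ext j
      have := congrFun (Set.mem_singleton_iff.1 h) j
      simpa [realVec] using this
    have := v.2.1
    rw [h0] at this
    exact zero_ne_one ((Finset.gcd_eq_zero_iff.2 fun i _ => rfl).symm.trans this)
  · refine Set.eq_univ_of_forall fun y => Set.mem_iUnion.2 ?_
    obtain ⟨k, hk⟩ := exists_nat_ge ‖y‖
    exact ⟨k, by show ‖y‖ ≤ (k : ℝ) + 1; linarith⟩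
  · refine lt_of_le_of_lt ?_ (SLR.lintegral_prim_lt_top hD (R := (k : ℝ) + 1) (by positivity))
    refine lintegral_mono fun g => ?_
    exact ENNReal.tsum_comp_le_tsum_of_injective (Set.inclusion_injective
      (show primCong N v₀ ⊆ {v | Finset.univ.gcd v = 1} from fun v hv => hv.1)) _

theorem exists_mean_two (hn : 1 ≤ n) (hD : SLR.IsFD (SLR.congInc N (n + 2)) D) :
    ∃ c : ℝ≥0∞, c ≠ ∞ ∧ ∀ f : (Fin (n + 2) → ℝ) × (Fin (n + 2) → ℝ) → ℝ≥0∞, Measurable f →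
      ∫⁻ g in D, ∑' p : primCongPairs N v₀, f (g • realVec p.1.1, g • realVec p.1.2)
        ∂SLR.haar (n + 2) = c * ∫⁻ y, f y := by
  have hne : (volume : Measure ((Fin (n + 2) → ℝ) × (Fin (n + 2) → ℝ))) ≠ 0 := NeZero.ne _
  refine hD.exists_mean_eq (fun p : primCongPairs N v₀ => (realVec p.1.1, realVec p.1.2))
    (fun γ => ⟨primCongPairsPerm v₀ γ, fun p => Prod.ext (ofInt_smul_realVec γ.1 p.1.1)
      (ofInt_smul_realVec γ.1 p.1.2)⟩) volume hne
    (Pi.single 0 1, Pi.single 1 1) measurableSet_minorPairs (fun y hy => ?_)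
    (fun g y hy => smul_mem_minorPairs g hy) (fun p => realVec_mem_minorPairs p.2)
    (volume_compl_minorPairs (by omega)) (E := fun k : ℕ => {y | ‖y‖ ≤ (k : ℝ) + 1})
    (fun k => measurableSet_le measurable_norm measurable_const) ?_ fun k => ?_
  · obtain ⟨g, hg⟩ := SLR.exists_smul_single_eq (k := 2) (by omega : 2 < n + 2)
      (mem_minorPairs_iff.1 hy)
    exact ⟨g, Prod.ext (hg 0).symm (hg 1).symm⟩
  · refine Set.eq_univ_of_forall fun y => Set.mem_iUnion.2 ?_
    obtain ⟨k, hk⟩ := exists_nat_ge ‖y‖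
    exact ⟨k, by show ‖y‖ ≤ (k : ℝ) + 1; linarith⟩
  · refine lt_of_le_of_lt ?_
      (SLR.lintegral_indepPairs_lt_top hn hD (R := (k : ℝ) + 1) (by positivity))
    refine lintegral_mono fun g => ?_
    exact ENNReal.tsum_comp_le_tsum_of_injective (Set.inclusion_injective
      (show primCongPairs N v₀ ⊆ Arr.indepPairs (n + 2) from
        fun p hp => ⟨hp.1.1, hp.2.1.1, hp.2.2.1, hp.2.2.2⟩)) _

end Mean

/-! ### Counting lattice points in dilated balls -/

section Count

open Filter Topology Pointwise

variable {d : ℕ}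

theorem realVec_add_smul (a w : Fin d → ℤ) (q : ℤ) :
    realVec (a + q • w) = realVec a + (q : ℝ) • realVec w := by
  ext; simp [realVec]

theorem norm_realVec (u : Fin d → ℤ) : ‖realVec u‖ = ‖u‖ := by
  rw [Pi.norm_def, Pi.norm_def]
  refine congrArg _ (Finset.sup_congr rfl fun b _ => ?_)
  exact Subtype.ext (Int.norm_cast_real (u b))

/-- Integer vectors whose image under `g` has norm at most `x`. -/
def latBall (g : SLR d) (x : ℝ) : Set (Fin d → ℤ) := {u | ‖g • realVec u‖ ≤ x}

theorem exists_norm_le_mul_norm_smul (g : SLR d) : ∃ M > 0, ∀ x : Fin d → ℝ, ‖x‖ ≤ M * ‖g • x‖ := by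
  let f : (Fin d → ℝ) →L[ℝ] (Fin d → ℝ) := (Matrix.toLin' (g⁻¹).1).toContinuousLinearMap
  refine ⟨‖f‖ + 1, by positivity, fun x => ?_⟩
  have h : f (g • x) = x := inv_smul_smul g x
  calc ‖x‖ = ‖f (g • x)‖ := by rw [h]
    _ ≤ ‖f‖ * ‖g • x‖ := f.le_opNorm _
    _ ≤ (‖f‖ + 1) * ‖g • x‖ := by gcongr; linarith

theorem finite_latBall (g : SLR d) (x : ℝ) : (latBall g x).Finite := by
  obtain ⟨M, hM, h⟩ := exists_norm_le_mul_norm_smul g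
  refine (Set.finite_Icc (fun _ : Fin d => -⌈M * x⌉) (fun _ => ⌈M * x⌉)).subset fun u hu => ?_
  have h1 : ‖realVec u‖ ≤ M * x := (h _).trans (mul_le_mul_of_nonneg_left hu hM.le)
  have h2 : ∀ j, |u j| ≤ ⌈M * x⌉ := fun j => by
    have h3 : |(u j : ℝ)| ≤ M * x := (norm_le_pi_norm (realVec u) j).trans h1
    have h4 : |(u j : ℝ)| ≤ (⌈M * x⌉ : ℤ) := h3.trans (Int.le_ceil _)
    exact_mod_cast h4
  exact ⟨fun j => (abs_le.1 (h2 j)).1, fun j => (abs_le.1 (h2 j)).2⟩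

theorem latBall_mono (g : SLR d) {x y : ℝ} (h : x ≤ y) : latBall g x ⊆ latBall g y :=
  fun _ hu => le_trans hu h

theorem tendsto_latBall (g : SLR d) :
    Tendsto (fun x : ℝ => ((latBall g x).ncard : ℝ) / x ^ d) atTop (𝓝 (2 ^ d)) := by
  let K : Set (Fin d → ℝ) := {x | ‖g • x‖ ≤ 1}
  obtain ⟨M, hM, h⟩ := exists_norm_le_mul_norm_smul g
  have hKpre : K = (fun x : Fin d → ℝ => g • x) ⁻¹' {x | ‖x‖ ≤ 1} := rfl
  have hbm : MeasurableSet {x : Fin d → ℝ | ‖x‖ ≤ 1} :=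
    measurableSet_le measurable_norm measurable_const
  have hKm : MeasurableSet K := (continuous_const_smul g).measurable hbm
  have hKb : Bornology.IsBounded K := (Metric.isBounded_closedBall (x := (0 : Fin d → ℝ))
    (r := M)).subset fun x hx => by
      rw [mem_closedBall_zero_iff]
      exact (h x).trans (mul_le_of_le_one_right hM.le hx)
  have hKv : volume.real K = 2 ^ d := by
    rw [measureReal_def, hKpre, (SLR.measurePreserving_smul g).measure_preimage
      hbm.nullMeasurableSet, Arr.volume_norm_le 1 one_pos, ENNReal.toReal_ofReal (by positivity),
      mul_one]
  have hKc : Convex ℝ K := by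
    have h1 : Convex ℝ {x : Fin d → ℝ | ‖x‖ ≤ 1} := by
      have := convex_closedBall (0 : Fin d → ℝ) 1
      convert! this using 1
      ext; simp
    exact h1.linear_preimage (Matrix.toLin' g.1)
  have hsmul : ∀ (c : ℝ) (x : Fin d → ℝ), g • (c • x) = c • (g • x) := fun c x => by
    simp only [SLR.smul_def, Matrix.mulVec_smul]
  have hmem : ∀ {x : ℝ}, 0 < x → ∀ y, y ∈ x • K ↔ ‖g • y‖ ≤ x := fun {x} hx y => by
    rw [Set.mem_smul_set_iff_inv_smul_mem₀ hx.ne']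
    change ‖g • (x⁻¹ • y)‖ ≤ 1 ↔ _
    rw [hsmul, norm_smul, Real.norm_of_nonneg (by positivity), inv_mul_le_iff₀ hx, mul_one]
  have key := tendsto_card_div_pow_atTop_volume' K hKb hKm (hKc.addHaar_frontier volume)
    fun x y hx hxy z hz => by
      rw [hmem (hx.trans_le hxy)]
      rw [hmem hx] at hz
      exact hz.trans hxy
  rw [hKv, Fintype.card_fin] at key
  refine key.congr' ?_
  filter_upwards [eventually_gt_atTop 0] with x hx
  congr 2
  rw [← Nat.card_coe_set_eq]
  symm
  refine Nat.card_congr (Equiv.ofBijective (fun u => ⟨x⁻¹ • realVec u.1, ?_, ?_⟩) ⟨?_, ?_⟩)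
  · have := u.2
    change ‖g • (x⁻¹ • realVec u.1)‖ ≤ 1
    rw [hsmul, norm_smul, Real.norm_of_nonneg (by positivity), inv_mul_le_iff₀ hx, mul_one]
    exact this
  · refine Set.smul_mem_smul_set ?_
    rw [SetLike.mem_coe, Module.Basis.mem_span_iff_repr_mem]
    intro i
    exact ⟨u.1 i, by simp [realVec]⟩
  · intro u u' huu
    have h1 := smul_right_injective (Fin d → ℝ) (inv_ne_zero hx.ne') (congrArg Subtype.val huu)
    refine Subtype.ext (funext fun j => ?_)
    have := congrFun h1 j
    simpa [realVec] using this
  · rintro ⟨y, hy, z, hz, rfl⟩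
    rw [SetLike.mem_coe, Module.Basis.mem_span_iff_repr_mem] at hz
    choose u hu using hz
    have huz : realVec u = z := by
      ext i
      have := hu i
      simpa [realVec] using this
    refine ⟨⟨u, ?_⟩, Subtype.ext (by simp [huz])⟩
    have hy' : ‖g • (x⁻¹ • z)‖ ≤ 1 := hy
    rw [hsmul, norm_smul, Real.norm_of_nonneg (by positivity), inv_mul_le_iff₀ hx, mul_one] at hy'
    change ‖g • realVec u‖ ≤ x
    rwa [huz]

/-- Nonzero integer vectors in a congruence class with image under `g` of norm at most `x`. -/
def congBall (g : SLR d) (N : ℕ) (a : Fin d → ℤ) (x : ℝ) : Set (Fin d → ℤ) :=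
  {u | (∀ j, (N : ℤ) ∣ u j - a j) ∧ u ≠ 0 ∧ ‖g • realVec u‖ ≤ x}

theorem congBall_subset (g : SLR d) (N : ℕ) (a : Fin d → ℤ) (x : ℝ) :
    congBall g N a x ⊆ latBall g x := fun _ hu => hu.2.2

theorem finite_congBall (g : SLR d) (N : ℕ) (a : Fin d → ℤ) (x : ℝ) : (congBall g N a x).Finite :=
  (finite_latBall g x).subset (congBall_subset g N a x)

theorem norm_smul_coset (g : SLR d) (N : ℕ) (a w : Fin d → ℤ) :
    |‖g • realVec (a + (N : ℤ) • w)‖ - N * ‖g • realVec w‖| ≤ ‖g • realVec a‖ := by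
  have h : g • realVec (a + (N : ℤ) • w) = g • realVec a + (N : ℝ) • (g • realVec w) := by
    rw [realVec_add_smul]
    simp only [SLR.smul_def, Matrix.mulVec_add, Matrix.mulVec_smul, Int.cast_natCast]
  have h2 : (N : ℝ) * ‖g • realVec w‖ = ‖(N : ℝ) • ((g • realVec w : Fin d → ℝ))‖ := by
    rw [norm_smul (N : ℝ) (g • realVec w), Real.norm_natCast]
  rw [h, h2]
  refine (abs_norm_sub_norm_le _ _).trans ?_
  rw [add_sub_cancel_right]

theorem ncard_congBall_le (g : SLR d) {N : ℕ} (hN : 0 < N) (a : Fin d → ℤ) (x : ℝ) :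
    (congBall g N a x).ncard ≤ (latBall g ((x + ‖g • realVec a‖) / N)).ncard := by
  have hN' : (0 : ℝ) < N := Nat.cast_pos.2 hN
  refine Set.ncard_le_ncard_of_injOn (fun u j => (u j - a j) / N) (fun u hu => ?_)
    (fun u hu u' hu' h => ?_) (finite_latBall _ _)
  · have hu2 : u = a + (N : ℤ) • fun j => (u j - a j) / N := by
      ext j
      simp [Int.mul_ediv_cancel' (hu.1 j)]
    change ‖g • realVec _‖ ≤ _
    rw [le_div_iff₀' hN']
    have h1 := norm_smul_coset g N a fun j => (u j - a j) / N
    rw [← hu2] at h1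
    have h2 := hu.2.2
    have := abs_le.1 h1
    linarith
  · ext j
    have h1 := congrFun h j
    simp only at h1
    have := Int.mul_ediv_cancel' (hu.1 j)
    have h3 := Int.mul_ediv_cancel' (hu'.1 j)
    rw [h1] at this
    linarith

theorem le_ncard_congBall (g : SLR d) {N : ℕ} (hN : 0 < N) (a : Fin d → ℤ) (x : ℝ) :
    (latBall g ((x - ‖g • realVec a‖) / N)).ncard ≤ (congBall g N a x).ncard + 1 := by
  have hN' : (0 : ℝ) < N := Nat.cast_pos.2 hN
  refine le_trans ?_ (Set.ncard_insert_le 0 (congBall g N a x))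
  refine Set.ncard_le_ncard_of_injOn (fun w => a + (N : ℤ) • w) (fun w hw => ?_)
    (fun w _ w' _ h => ?_) ((finite_congBall _ _ _ _).insert _)
  · by_cases h0 : a + (N : ℤ) • w = 0
    · exact Or.inl h0
    refine Or.inr ⟨fun j => ⟨w j, by simp⟩, h0, ?_⟩
    have h1 := abs_le.1 (norm_smul_coset g N a w)
    have h2 : ‖g • realVec w‖ ≤ _ := hw
    rw [le_div_iff₀' hN'] at h2
    linarith
  · have h1 := add_left_cancel h
    exact smul_right_injective _ (Nat.cast_ne_zero.2 hN.ne' : (N : ℤ) ≠ 0) h1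

theorem tendsto_latBall_affine (g : SLR d) {N : ℕ} (hN : 0 < N) (A : ℝ) :
    Tendsto (fun x : ℝ => ((latBall g ((x + A) / N)).ncard : ℝ) / x ^ d) atTop
      (𝓝 ((2 / N) ^ d)) := by
  have hN' : (0 : ℝ) < N := Nat.cast_pos.2 hN
  have h1 : Tendsto (fun x : ℝ => (x + A) / N) atTop atTop :=
    (tendsto_atTop_add_const_right _ _ tendsto_id).atTop_div_const hN'
  have h2 : Tendsto (fun x : ℝ => ((x + A) / N) / x) atTop (𝓝 (1 / N)) := by
    have h3 : Tendsto (fun x : ℝ => (1 + A / x) / N) atTop (𝓝 ((1 + 0) / N)) :=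
      (tendsto_const_nhds.add (tendsto_const_nhds.div_atTop tendsto_id)).div_const _
    rw [add_zero] at h3
    refine h3.congr' ?_
    filter_upwards [eventually_gt_atTop 0] with x hx
    field_simp
  have h4 := ((tendsto_latBall g).comp h1).mul (h2.pow d)
  rw [← mul_pow, mul_one_div] at h4
  refine h4.congr' ?_
  filter_upwards [eventually_gt_atTop 0, h1.eventually_gt_atTop 0] with x hx hx2
  simp only [Function.comp_apply]
  rw [div_pow ((x + A) / N) x, div_mul_div_comm, mul_comm, mul_div_mul_left _ _ (by positivity)]

theorem tendsto_congBall (hd : 0 < d) (g : SLR d) {N : ℕ} (hN : 0 < N) (a : Fin d → ℤ) :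
    Tendsto (fun x : ℝ => ((congBall g N a x).ncard : ℝ) / x ^ d) atTop (𝓝 ((2 / N) ^ d)) := by
  have h0 : Tendsto (fun x : ℝ => 1 / x ^ d) atTop (𝓝 0) :=
    tendsto_const_nhds.div_atTop (tendsto_pow_atTop hd.ne')
  have hlow := (tendsto_latBall_affine g hN (-‖g • realVec a‖)).sub h0
  rw [sub_zero] at hlow
  refine tendsto_of_tendsto_of_tendsto_of_le_of_le' hlow
    (tendsto_latBall_affine g hN ‖g • realVec a‖) ?_ ?_
  · filter_upwards [eventually_gt_atTop 0] with x hx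
    rw [← sub_div]
    gcongr
    have := le_ncard_congBall g hN a x
    rw [sub_le_iff_le_add]
    exact_mod_cast this
  · filter_upwards [eventually_gt_atTop 0] with x hx
    exact div_le_div_of_nonneg_right (by exact_mod_cast ncard_congBall_le g hN a x) (by positivity)

theorem exists_ncard_congBall_le (g : SLR d) : ∃ K : ℝ, 0 ≤ K ∧ ∀ (N : ℕ) (a : Fin d → ℤ) (x : ℝ),
    0 < x → ((congBall g N a x).ncard : ℝ) ≤ K * x ^ d := by
  obtain ⟨M, hM, h⟩ := exists_norm_le_mul_norm_smul g
  have hev : ∀ᶠ x : ℝ in atTop, ((latBall g x).ncard : ℝ) / x ^ d < 2 ^ d + 1 :=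
    (tendsto_latBall g).eventually_lt_const (lt_add_one _)
  obtain ⟨x₁, hx₁⟩ := eventually_atTop.1 hev
  refine ⟨(2 ^ d + 1) + (latBall g x₁).ncard * M ^ d, by positivity, fun N a x hx => ?_⟩
  have hle : ((congBall g N a x).ncard : ℝ) ≤ (latBall g x).ncard := by
    exact_mod_cast Set.ncard_le_ncard (congBall_subset g N a x) (finite_latBall _ _)
  rcases le_total x₁ x with hxx | hxx
  · have h1 := hx₁ x hxx
    rw [div_lt_iff₀ (by positivity)] at h1
    have : 0 ≤ (latBall g x₁).ncard * M ^ d * x ^ d := by positivity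
    nlinarith
  by_cases hMx : M * x < 1
  · have : congBall g N a x = ∅ := by
      refine Set.eq_empty_of_forall_notMem fun u hu => hu.2.1 ?_
      have h1 := (h (realVec u)).trans (mul_le_mul_of_nonneg_left hu.2.2 hM.le)
      rw [norm_realVec] at h1
      ext j
      have h2 := (norm_le_pi_norm u j).trans_lt (h1.trans_lt hMx)
      rw [Int.norm_eq_abs] at h2
      have h3 : |u j| < 1 := by exact_mod_cast h2
      exact Int.abs_lt_one_iff.1 h3
    rw [this, Set.ncard_empty, Nat.cast_zero]
    positivity
  · have h1 : 1 ≤ (M * x) ^ d := one_le_pow₀ (not_lt.1 hMx)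
    have h2 : ((latBall g x).ncard : ℝ) ≤ (latBall g x₁).ncard := by
      exact_mod_cast Set.ncard_le_ncard (latBall_mono g hxx) (finite_latBall _ _)
    have h3 : (0 : ℝ) ≤ (latBall g x₁).ncard := Nat.cast_nonneg _
    have h4 : (latBall g x₁).ncard * (1 : ℝ) ≤ (latBall g x₁).ncard * (M * x) ^ d :=
      mul_le_mul_of_nonneg_left h1 h3
    rw [mul_pow] at h4
    have : (0 : ℝ) ≤ (2 ^ d + 1) * x ^ d := by positivity
    nlinarith

end Count

/-! ### Counting primitive vectors in dilated balls -/

section PrimCount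

open Filter Topology ArithmeticFunction

/-- The sum of `e ^ (-d)` over the natural numbers `e` coprime to `N`. -/
noncomputable def copZeta (N d : ℕ) : ℝ := ∑' e : ℕ, if e.Coprime N then 1 / (e : ℝ) ^ d else 0

theorem copZeta_mul_tsum_moebius (N : ℕ) {d : ℕ} (hd : 2 ≤ d) :
    copZeta N d * ∑' e : ℕ, (if e.Coprime N then (moebius e : ℝ) / (e : ℝ) ^ d else 0) = 1 := by
  have hs : 1 < ((d : ℂ)).re := by
    rw [Complex.natCast_re]
    exact_mod_cast hd
  have key := DirichletCharacter.LSeries.mul_mu_eq_one (1 : DirichletCharacter ℂ N) hs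
  have h1 : ∀ n : ℕ, ((1 : DirichletCharacter ℂ N) (n : ZMod N)) = if n.Coprime N then 1 else 0 :=
    fun n => by
      split_ifs with h
      · exact MulChar.one_apply ((ZMod.isUnit_iff_coprime n N).2 h)
      · exact MulChar.map_nonunit _ (fun h' => h ((ZMod.isUnit_iff_coprime n N).1 h'))
  have hd0 : d ≠ 0 := by omega
  have h2 : LSeries (fun n : ℕ => (1 : DirichletCharacter ℂ N) (n : ZMod N)) d
      = (copZeta N d : ℂ) := by
    rw [LSeries, copZeta, Complex.ofReal_tsum]
    refine tsum_congr fun n => ?_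
    rw [LSeries.term_def, h1, Complex.cpow_natCast]
    rcases eq_or_ne n 0 with rfl | hn
    · simp [hd0]
    · rw [if_neg hn]
      split_ifs <;> simp
  have h3 : LSeries ((fun n : ℕ => (1 : DirichletCharacter ℂ N) (n : ZMod N)) *
      fun n : ℕ => ((moebius n : ℤ) : ℂ)) d
      = ((∑' e : ℕ, (if e.Coprime N then (moebius e : ℝ) / (e : ℝ) ^ d else 0) : ℝ) : ℂ) := by
    rw [LSeries, Complex.ofReal_tsum]
    refine tsum_congr fun n => ?_
    rw [LSeries.term_def, Pi.mul_apply, h1, Complex.cpow_natCast]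
    rcases eq_or_ne n 0 with rfl | hn
    · simp
    · rw [if_neg hn]
      split_ifs <;> simp
  rw [h2, h3] at key
  exact_mod_cast key

variable {d : ℕ}

theorem sum_moebius_dvd {m : ℕ} (hm : m ≠ 0) :
    HasSum (fun e : ℕ => (moebius e : ℝ) * if e ∣ m then 1 else 0) (if m = 1 then 1 else 0) := by
  have h1 : ∑ e ∈ m.divisors, ((moebius e : ℤ) * if e ∣ m then 1 else 0) =
      if m = 1 then 1 else 0 := by
    have h2 := congrArg (fun f : ArithmeticFunction ℤ => f m) coe_zeta_mul_moebius
    simp only [coe_zeta_mul_apply, ArithmeticFunction.one_apply] at h2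
    rw [← h2]
    refine Finset.sum_congr rfl fun e he => ?_
    rw [if_pos (Nat.dvd_of_mem_divisors he), mul_one]
  have h3 := hasSum_sum_of_ne_finset_zero (s := m.divisors) (L := SummationFilter.unconditional ℕ)
    (f := fun e : ℕ => (moebius e : ℝ) * if e ∣ m then 1 else 0) fun e he => by
      rw [if_neg fun h => he (Nat.mem_divisors.2 ⟨h, hm⟩), mul_zero]
  convert h3 using 1
  exact_mod_cast congrArg (Int.cast (R := ℝ)) h1.symm

/-- Primitive vectors in a congruence class with image under `g` of norm at most `x`. -/
def primBall (g : SLR d) (N : ℕ) (v₀ : Fin d → ℤ) (x : ℝ) : Set (Fin d → ℤ) :=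
  {v | v ∈ primCong N v₀ ∧ ‖g • realVec v‖ ≤ x}

/-- Elements of `congBall` all of whose coordinates are divisible by `e`. -/
def dvdBall (g : SLR d) (N : ℕ) (v₀ : Fin d → ℤ) (x : ℝ) (e : ℕ) : Set (Fin d → ℤ) :=
  {v | v ∈ congBall g N v₀ x ∧ ∀ j, (e : ℤ) ∣ v j}

theorem gcd_natAbs_eq_one_iff (v : Fin d → ℤ) :
    (Finset.univ.gcd v).natAbs = 1 ↔ Finset.univ.gcd v = 1 := by
  constructor
  · intro h
    rw [← Finset.normalize_gcd]
    exact normalize_eq_one.2 (Int.isUnit_iff_natAbs_eq.2 h)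
  · intro h
    rw [h, Int.natAbs_one]

theorem hasSum_primBall (g : SLR d) (N : ℕ) (v₀ : Fin d → ℤ) (x : ℝ) :
    HasSum (fun e : ℕ => (moebius e : ℝ) * (dvdBall g N v₀ x e).ncard)
      ((primBall g N v₀ x).ncard : ℝ) := by
  classical
  have hfin := finite_congBall g N v₀ x
  let F : Finset (Fin d → ℤ) := hfin.toFinset
  have hF : ∀ v, v ∈ F ↔ v ∈ congBall g N v₀ x := fun v => hfin.mem_toFinset
  have h0 : ∀ v ∈ F, (Finset.univ.gcd v).natAbs ≠ 0 := fun v hv h => by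
    rw [Int.natAbs_eq_zero, Finset.gcd_eq_zero_iff] at h
    exact ((hF v).1 hv).2.1 (funext fun j => h j (Finset.mem_univ j))
  have key := hasSum_sum (s := F) fun v hv => sum_moebius_dvd (h0 v hv)
  have h1 : (primBall g N v₀ x).ncard
      = (F.filter fun v => (Finset.univ.gcd v).natAbs = 1).card := by
    rw [← Set.ncard_coe_finset]
    congr 1
    ext v
    rw [Finset.mem_coe, Finset.mem_filter, hF, gcd_natAbs_eq_one_iff]
    constructor
    · rintro ⟨⟨h1, h2⟩, h3⟩
      refine ⟨⟨h2, fun h => ?_, h3⟩, h1⟩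
      rw [h] at h1
      have h4 : (Finset.univ.gcd (0 : Fin d → ℤ)) = 0 :=
        Finset.gcd_eq_zero_iff.2 fun _ _ => rfl
      rw [h4] at h1
      exact zero_ne_one h1
    · rintro ⟨⟨h2, _, h3⟩, h1⟩
      exact ⟨⟨h1, h2⟩, h3⟩
  have h2 : ∀ e : ℕ, (dvdBall g N v₀ x e).ncard
      = (F.filter fun v => e ∣ (Finset.univ.gcd v).natAbs).card := fun e => by
    rw [← Set.ncard_coe_finset]
    congr 1
    ext v
    rw [Finset.mem_coe, Finset.mem_filter, hF, ← Int.natCast_dvd, Finset.dvd_gcd_iff]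
    simp [dvdBall]
  convert key using 1
  · funext e
    rw [← Finset.mul_sum, h2, Finset.card_filter]
    push_cast
    rfl
  · rw [h1, Finset.card_filter]
    push_cast
    rfl

theorem dvdBall_eq_empty (g : SLR d) {N : ℕ} {v₀ : Fin d → ℤ} (hv₀ : Finset.univ.gcd v₀ = 1)
    (x : ℝ) {e : ℕ} (he : ¬ e.Coprime N) : dvdBall g N v₀ x e = ∅ := by
  obtain ⟨q, hq, hqe, hqN⟩ := Nat.Prime.not_coprime_iff_dvd.1 he
  refine Set.eq_empty_of_forall_notMem fun v hv => ?_
  have h1 : (q : ℤ) ∣ Finset.univ.gcd v₀ := Finset.dvd_gcd fun j _ => by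
    have h2 := (Int.natCast_dvd_natCast.2 hqN).trans (hv.1.1 j)
    have h3 := (Int.natCast_dvd_natCast.2 hqe).trans (hv.2 j)
    exact (dvd_sub_right h3).1 h2
  rw [hv₀] at h1
  have h4 : q ∣ 1 := by exact_mod_cast h1
  exact hq.one_lt.ne' (Nat.dvd_one.1 h4)

theorem exists_dvdBall_eq (g : SLR d) {N : ℕ} (v₀ : Fin d → ℤ) {e : ℕ} (he : e.Coprime N) :
    ∃ a, ∀ x, dvdBall g N v₀ x e = congBall g (N * e) a x := by
  obtain ⟨s, t, hst⟩ := Nat.isCoprime_iff_coprime.2 he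
  refine ⟨fun j => s * e * v₀ j, fun x => Set.ext fun u => ?_⟩
  have hco : IsCoprime (N : ℤ) (e : ℤ) := (Nat.isCoprime_iff_coprime.2 he).symm
  have h1 : ∀ j, ((N * e : ℕ) : ℤ) ∣ u j - s * e * v₀ j ↔
      (N : ℤ) ∣ u j - v₀ j ∧ (e : ℤ) ∣ u j := fun j => by
    have hs : u j - s * e * v₀ j = u j - v₀ j + N * (t * v₀ j) := by
      linear_combination (-v₀ j) * hst
    have hN : (N : ℤ) ∣ u j - s * e * v₀ j ↔ (N : ℤ) ∣ u j - v₀ j := by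
      rw [hs]
      exact dvd_add_left (dvd_mul_right _ _)
    have hE : (e : ℤ) ∣ u j - s * e * v₀ j ↔ (e : ℤ) ∣ u j :=
      dvd_sub_left ⟨s * v₀ j, by ring⟩
    rw [← hN, ← hE, Nat.cast_mul]
    exact ⟨fun h => ⟨(dvd_mul_right _ _).trans h, (dvd_mul_left _ _).trans h⟩,
      fun h => hco.mul_dvd h.1 h.2⟩
  constructor
  · rintro ⟨⟨h2, h3, h4⟩, h5⟩
    exact ⟨fun j => (h1 j).2 ⟨h2 j, h5 j⟩, h3, h4⟩
  · rintro ⟨h2, h3, h4⟩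
    exact ⟨⟨fun j => ((h1 j).1 (h2 j)).1, h3, h4⟩, fun j => ((h1 j).1 (h2 j)).2⟩

theorem ncard_dvdBall_le (g : SLR d) {N : ℕ} (v₀ : Fin d → ℤ) (x : ℝ) {e : ℕ} (he : 0 < e) :
    (dvdBall g N v₀ x e).ncard ≤ (congBall g 1 0 (x / e)).ncard := by
  have he' : (0 : ℝ) < e := Nat.cast_pos.2 he
  refine Set.ncard_le_ncard_of_injOn (fun u j => u j / e) (fun u hu => ?_)
    (fun u hu u' hu' h => ?_) (finite_congBall _ _ _ _)
  · have hu2 : u = 0 + (e : ℤ) • fun j => u j / e := by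
      ext j
      simp [Int.mul_ediv_cancel' (hu.2 j)]
    refine ⟨fun j => by simp, fun h0 => hu.1.2.1 ?_, ?_⟩
    · have h0' : (fun j => u j / (e : ℤ)) = 0 := h0
      rw [hu2, h0', smul_zero, add_zero]
    · rw [le_div_iff₀' he']
      have h1 := norm_smul_coset g e 0 fun j => u j / e
      rw [← hu2] at h1
      have h3 : g • realVec (0 : Fin d → ℤ) = 0 := by
        have : realVec (0 : Fin d → ℤ) = 0 := by ext; simp [realVec]
        rw [this, SLR.smul_def, Matrix.mulVec_zero]
      rw [h3, norm_zero] at h1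
      have h2 := hu.1.2.2
      have := abs_le.1 h1
      linarith
  · ext j
    have h1 := congrFun h j
    simp only at h1
    rw [← Int.mul_ediv_cancel' (hu.2 j), h1, Int.mul_ediv_cancel' (hu'.2 j)]

theorem tendsto_primBall (hd : 2 ≤ d) (g : SLR d) {N : ℕ} (hN : 0 < N) {v₀ : Fin d → ℤ}
    (hv₀ : Finset.univ.gcd v₀ = 1) :
    Tendsto (fun x : ℝ => ((primBall g N v₀ x).ncard : ℝ) / x ^ d) atTop
      (𝓝 (2 ^ d / (N ^ d * copZeta N d))) := by
  have hd0 : 0 < d := by omega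
  obtain ⟨K, hK, hKle⟩ := exists_ncard_congBall_le g
  have hmu := copZeta_mul_tsum_moebius N hd
  have hlim : (2 : ℝ) ^ d / (N ^ d * copZeta N d)
      = ∑' e : ℕ, (moebius e : ℝ) * (if e.Coprime N then (2 / ((N * e : ℕ) : ℝ)) ^ d else 0) := by
    rw [div_mul_eq_div_div, div_eq_mul_inv _ (copZeta N d), ← eq_inv_of_mul_eq_one_right hmu,
      ← tsum_mul_left]
    refine tsum_congr fun e => ?_
    split_ifs
    · rw [Nat.cast_mul, div_pow, mul_pow]
      rcases eq_or_ne e 0 with rfl | he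
      · simp
      field_simp
    · simp
  rw [hlim]
  have hsum : ∀ x : ℝ, ((primBall g N v₀ x).ncard : ℝ) / x ^ d
      = ∑' e : ℕ, (moebius e : ℝ) * ((dvdBall g N v₀ x e).ncard / x ^ d) := fun x => by
    rw [← (hasSum_primBall g N v₀ x).tsum_eq, ← tsum_div_const]
    exact tsum_congr fun e => mul_div_assoc _ _ _
  simp_rw [hsum]
  refine tendsto_tsum_of_dominated_convergence (bound := fun e : ℕ => K * (1 / (e : ℝ) ^ d))
    ((Real.summable_one_div_nat_pow.2 (by omega)).mul_left _) (fun e => ?_) ?_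
  · rcases eq_or_ne e 0 with rfl | he
    · simp
    refine Tendsto.const_mul _ ?_
    by_cases hco : e.Coprime N
    · obtain ⟨a, ha⟩ := exists_dvdBall_eq g v₀ hco
      simp_rw [ha, if_pos hco]
      exact tendsto_congBall hd0 g (Nat.mul_pos hN (Nat.pos_of_ne_zero he)) a
    · simp_rw [dvdBall_eq_empty g hv₀ _ hco, if_neg hco, Set.ncard_empty, Nat.cast_zero, zero_div]
      exact tendsto_const_nhds
  · filter_upwards [eventually_gt_atTop 0] with x hx e
    rcases eq_or_ne e 0 with rfl | he
    · simp [hd0.ne']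
    have he' : (0 : ℝ) < e := Nat.cast_pos.2 (Nat.pos_of_ne_zero he)
    have h1 : ((dvdBall g N v₀ x e).ncard : ℝ) ≤ K * (x / e) ^ d :=
      le_trans (by exact_mod_cast ncard_dvdBall_le g v₀ x (Nat.pos_of_ne_zero he))
        (hKle 1 0 _ (by positivity))
    have h2 : |(moebius e : ℝ)| ≤ 1 := by exact_mod_cast abs_moebius_le_one (n := e)
    rw [norm_mul, Real.norm_eq_abs, Real.norm_of_nonneg (by positivity)]
    refine (mul_le_of_le_one_left (by positivity) h2).trans ?_
    rw [div_le_iff₀ (by positivity)]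
    refine h1.trans_eq ?_
    rw [div_pow]
    ring

end PrimCount

/-! ### Moments of the counting function -/

section PrimMoments

variable {d : ℕ}

/-- The number of primitive vectors in a congruence class whose image under `g` lies in `A`. -/
noncomputable def primCount (N : ℕ) (v₀ : Fin d → ℤ) (A : Set (Fin d → ℝ)) (g : SLR d) : ℝ≥0∞ :=
  ∑' v : primCong N v₀, A.indicator (fun _ => (1 : ℝ≥0∞)) (g • realVec v.1)

theorem measurable_primCount (N : ℕ) (v₀ : Fin d → ℤ) {A : Set (Fin d → ℝ)}
    (hA : MeasurableSet A) : Measurable (primCount N v₀ A) :=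
  Measurable.tsum fun v => (measurable_const.indicator hA).comp
    (SLR.measurable_smul_vec (realVec v.1))

theorem primCount_mono (N : ℕ) (v₀ : Fin d → ℤ) {A B : Set (Fin d → ℝ)} (h : A ⊆ B) (g : SLR d) :
    primCount N v₀ A g ≤ primCount N v₀ B g :=
  ENNReal.tsum_le_tsum fun _ => Set.indicator_le_indicator_of_subset h (fun _ => zero_le) _

/-- Contribution of the linearly independent pairs to the product of two counting functions. -/
noncomputable def pairCountIn (N : ℕ) (v₀ : Fin d → ℤ) (A B : Set (Fin d → ℝ)) (g : SLR d) : ℝ≥0∞ :=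
  ∑' p : primCongPairs N v₀, (A ×ˢ B).indicator (fun _ => (1 : ℝ≥0∞))
    (g • realVec p.1.1, g • realVec p.1.2)

theorem primCount_eq_tsum (N : ℕ) (v₀ : Fin d → ℤ) (A : Set (Fin d → ℝ)) (g : SLR d) :
    primCount N v₀ A g = ∑' v : Fin d → ℤ, (primCong N v₀).indicator
      (fun v => A.indicator (fun _ => (1 : ℝ≥0∞)) (g • realVec v)) v :=
  tsum_subtype (primCong N v₀) fun v => A.indicator (fun _ => (1 : ℝ≥0∞)) (g • realVec v)

theorem pairCountIn_eq_tsum (N : ℕ) (v₀ : Fin d → ℤ) (A B : Set (Fin d → ℝ)) (g : SLR d) :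
    pairCountIn N v₀ A B g = ∑' v : Fin d → ℤ, ∑' w : Fin d → ℤ, (primCongPairs N v₀).indicator
      (fun p => (A ×ˢ B).indicator (fun _ => (1 : ℝ≥0∞)) (g • realVec p.1, g • realVec p.2))
        (v, w) := by
  rw [pairCountIn, tsum_subtype (primCongPairs N v₀) fun p =>
    (A ×ˢ B).indicator (fun _ => (1 : ℝ≥0∞)) (g • realVec p.1, g • realVec p.2), ENNReal.tsum_prod']

theorem primCount_mul (N : ℕ) (v₀ : Fin d → ℤ) (A B : Set (Fin d → ℝ)) (g : SLR d) :
    primCount N v₀ A g * primCount N v₀ B g = ∑' v : Fin d → ℤ, ∑' w : Fin d → ℤ,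
      (primCong N v₀).indicator (fun v => A.indicator (fun _ => (1 : ℝ≥0∞)) (g • realVec v)) v *
      (primCong N v₀).indicator (fun v => B.indicator (fun _ => (1 : ℝ≥0∞)) (g • realVec v)) w := by
  rw [primCount_eq_tsum, primCount_eq_tsum, ← ENNReal.tsum_mul_right]
  exact tsum_congr fun v => ENNReal.tsum_mul_left.symm

theorem pairCountIn_le (N : ℕ) (v₀ : Fin d → ℤ) (A B : Set (Fin d → ℝ)) (g : SLR d) :
    pairCountIn N v₀ A B g ≤ primCount N v₀ A g * primCount N v₀ B g := by
  rw [pairCountIn_eq_tsum, primCount_mul]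
  refine ENNReal.tsum_le_tsum fun v => ENNReal.tsum_le_tsum fun w => ?_
  by_cases h : (v, w) ∈ primCongPairs N v₀
  · rw [Set.indicator_of_mem h, Set.indicator_of_mem h.1, Set.indicator_of_mem h.2.1]
    by_cases hA : g • realVec v ∈ A
    · by_cases hB : g • realVec w ∈ B
      · rw [Set.indicator_of_mem (Set.mk_mem_prod hA hB), Set.indicator_of_mem hA,
          Set.indicator_of_mem hB, one_mul]
      · rw [Set.indicator_of_notMem fun h => hB h.2]
        exact zero_le
    · rw [Set.indicator_of_notMem fun h => hA h.1]
      exact zero_le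
  · rw [Set.indicator_of_notMem h]
    exact zero_le

theorem primCount_mul_le (N : ℕ) (v₀ : Fin d → ℤ) (A B : Set (Fin d → ℝ)) (g : SLR d) :
    primCount N v₀ A g * primCount N v₀ B g ≤ pairCountIn N v₀ A B g + 2 * primCount N v₀ A g := by
  classical
  let a : (Fin d → ℤ) → ℝ≥0∞ := (primCong N v₀).indicator
    (fun v => A.indicator (fun _ => (1 : ℝ≥0∞)) (g • realVec v))
  have hrhs : pairCountIn N v₀ A B g + 2 * primCount N v₀ A g
      = ∑' v : Fin d → ℤ, ∑' w : Fin d → ℤ, ((primCongPairs N v₀).indicator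
      (fun p => (A ×ˢ B).indicator (fun _ => (1 : ℝ≥0∞)) (g • realVec p.1, g • realVec p.2))
        (v, w) + ((if w = v then a v else 0) + (if w = -v then a v else 0))) := by
    rw [pairCountIn_eq_tsum, primCount_eq_tsum, ← ENNReal.tsum_mul_left, ← ENNReal.tsum_add]
    refine tsum_congr fun v => ?_
    rw [ENNReal.tsum_add, ENNReal.tsum_add, tsum_ite_eq, tsum_ite_eq, two_mul]
  rw [hrhs, primCount_mul]
  refine ENNReal.tsum_le_tsum fun v => ENNReal.tsum_le_tsum fun w => ?_
  by_cases hv : v ∈ primCong N v₀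
  swap
  · rw [Set.indicator_of_notMem hv, zero_mul]
    exact zero_le
  by_cases hw : w ∈ primCong N v₀
  swap
  · rw [Set.indicator_of_notMem hw, mul_zero]
    exact zero_le
  by_cases hA : g • realVec v ∈ A
  swap
  · rw [Set.indicator_of_mem hv, Set.indicator_of_notMem hA, zero_mul]
    exact zero_le
  by_cases hB : g • realVec w ∈ B
  swap
  · rw [Set.indicator_of_mem hw, Set.indicator_of_notMem hB, mul_zero]
    exact zero_le
  have ha : a v = 1 := by
    change (primCong N v₀).indicator _ v = 1
    rw [Set.indicator_of_mem hv, Set.indicator_of_mem hA]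
  rw [Set.indicator_of_mem hv, Set.indicator_of_mem hw, Set.indicator_of_mem hA,
    Set.indicator_of_mem hB, one_mul, ha]
  by_cases h1 : w = v
  · rw [if_pos h1]
    exact le_add_left le_self_add
  by_cases h2 : w = -v
  · rw [if_pos h2]
    exact le_add_left (le_add_left le_rfl)
  have hp : (v, w) ∈ primCongPairs N v₀ := ⟨hv, hw, h1, h2⟩
  rw [Set.indicator_of_mem hp, Set.indicator_of_mem (Set.mk_mem_prod hA hB)]
  exact le_self_add

theorem primCount_closedBall (N : ℕ) (v₀ : Fin d → ℤ) (x : ℝ) (g : SLR d) :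
    primCount N v₀ {y | ‖y‖ ≤ x} g = (primBall g N v₀ x).ncard := by
  have hfin : (primBall g N v₀ x).Finite :=
    (finite_latBall g x).subset fun _ h => h.2
  rw [primCount_eq_tsum, tsum_eq_sum (s := hfin.toFinset) fun v hv => ?_]
  · rw [Finset.sum_congr rfl fun v hv => ?_, Finset.sum_const, nsmul_one,
      Set.ncard_eq_toFinset_card _ hfin]
    have h := hfin.mem_toFinset.1 hv
    rw [Set.indicator_of_mem h.1]
    exact Set.indicator_of_mem (s := {y | ‖y‖ ≤ x}) h.2 _
  · by_cases h1 : v ∈ primCong N v₀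
    · rw [Set.indicator_of_mem h1]
      exact Set.indicator_of_notMem (s := {y | ‖y‖ ≤ x})
        (fun h2 => hv (hfin.mem_toFinset.2 ⟨h1, h2⟩)) _
    · exact Set.indicator_of_notMem h1 _

end PrimMoments

/-! ### The variance of the counting function -/

section Variance

open Filter Topology

/-- An almost everywhere convergent sequence which is bounded in `L²` converges weakly in `L²`. -/
theorem tendsto_integral_mul_of_eLpNorm_two_le {X : Type*} [MeasurableSpace X] {m : Measure X}
    [IsFiniteMeasure m] {h : ℕ → X → ℝ} {ψ : X → ℝ} {c : ℝ} {B : ℝ} (hB : 0 < B)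
    (hh : ∀ k, AEStronglyMeasurable (h k) m)
    (hb : ∀ k, eLpNorm (h k) 2 m ≤ ENNReal.ofReal B) (hψ : MemLp ψ 2 m)
    (hlim : ∀ᵐ x ∂m, Tendsto (fun k => h k x) atTop (𝓝 c)) :
    Tendsto (fun k => ∫ x, ψ x * h k x ∂m) atTop (𝓝 (c * ∫ x, ψ x ∂m)) := by
  have hψ1 : MemLp ψ 1 m := hψ.mono_exponent one_le_two
  have hhm : ∀ k, MemLp (h k) 2 m := fun k => ⟨hh k, (hb k).trans_lt ENNReal.ofReal_lt_top⟩
  have hmem : ∀ k, MemLp (ψ • h k) 1 m := fun k => (hhm k).smul hψ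
  have hui : UnifIntegrable (fun k => ψ • h k) 1 m := by
    intro ε hε
    obtain ⟨δ, hδ, hle⟩ := hψ.eLpNorm_indicator_le one_le_two ENNReal.ofNat_ne_top
      (div_pos hε hB)
    refine ⟨δ, hδ, fun k s hs hsδ => ?_⟩
    have h1 : s.indicator (ψ • h k) = s.indicator ψ • h k := by
      ext x
      by_cases hx : x ∈ s <;> simp [hx]
    rw [h1]
    calc eLpNorm (s.indicator ψ • h k) 1 m
        ≤ eLpNorm (s.indicator ψ) 2 m * eLpNorm (h k) 2 m :=
          eLpNorm_smul_le_mul_eLpNorm (hh k) (hψ.1.indicator hs)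
      _ ≤ ENNReal.ofReal (ε / B) * ENNReal.ofReal B := mul_le_mul' (hle s hs hsδ) (hb k)
      _ = ENNReal.ofReal ε := by
          rw [← ENNReal.ofReal_mul (by positivity), div_mul_cancel₀ _ hB.ne']
  have hL1 := tendsto_Lp_finite_of_tendsto_ae (f := fun k => ψ • h k) (g := fun x => c * ψ x)
    le_rfl ENNReal.one_ne_top (fun k => (hmem k).1) (hψ1.const_mul c) hui (by
      filter_upwards [hlim] with x hx
      rw [mul_comm]
      exact hx.const_mul (ψ x))
  rw [← integral_const_mul]
  refine tendsto_integral_of_L1' (fun x => c * ψ x)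
    (hψ1.const_mul c).1
    (Eventually.of_forall fun k => memLp_one_iff_integrable.1 (hmem k)) hL1

section ToReal

variable {X : Type*} [MeasurableSpace X] {m : Measure X} {F G : X → ℝ≥0∞}

theorem eLpNorm_two_toReal_le {M : ℝ} (hM : 0 ≤ M) (h : ∫⁻ x, F x * F x ∂m ≤ ENNReal.ofReal M) :
    eLpNorm (fun x => (F x).toReal) 2 m ≤ ENNReal.ofReal (M ^ (1 / 2 : ℝ)) := by
  rw [eLpNorm_eq_lintegral_rpow_enorm_toReal two_ne_zero ENNReal.ofNat_ne_top,
    ← ENNReal.ofReal_rpow_of_nonneg hM (by norm_num), ENNReal.toReal_ofNat]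
  refine ENNReal.rpow_le_rpow ((lintegral_mono fun x => ?_).trans h) (by norm_num)
  have h1 : ‖(F x).toReal‖ₑ ≤ F x := by
    rw [Real.enorm_of_nonneg ENNReal.toReal_nonneg]
    exact ENNReal.ofReal_toReal_le
  calc ‖(F x).toReal‖ₑ ^ (2 : ℝ) = ‖(F x).toReal‖ₑ * ‖(F x).toReal‖ₑ := by
        rw [ENNReal.rpow_ofNat, sq]
    _ ≤ F x * F x := mul_le_mul' h1 h1

theorem memLp_two_toReal (hF : Measurable F) {M : ℝ} (hM : 0 ≤ M)
    (h : ∫⁻ x, F x * F x ∂m ≤ ENNReal.ofReal M) : MemLp (fun x => (F x).toReal) 2 m :=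
  ⟨hF.ennreal_toReal.aestronglyMeasurable,
    (eLpNorm_two_toReal_le hM h).trans_lt ENNReal.ofReal_lt_top⟩

theorem integral_toReal_mul_toReal (hF : Measurable F) (hG : Measurable G)
    (hF' : ∀ᵐ x ∂m, F x < ∞) (hG' : ∀ᵐ x ∂m, G x < ∞) :
    ∫ x, (F x).toReal * (G x).toReal ∂m = (∫⁻ x, F x * G x ∂m).toReal := by
  simp_rw [← ENNReal.toReal_mul]
  refine integral_toReal (hF.mul hG).aemeasurable ?_
  filter_upwards [hF', hG'] with x h1 h2
  exact ENNReal.mul_lt_top h1 h2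

end ToReal

variable {n N : ℕ} [NeZero N] {v₀ : Fin (n + 2) → ℤ} {D : Set (SLR (n + 2))}

theorem exists_primCount_moments (hn : 1 ≤ n) (v₀ : Fin (n + 2) → ℤ)
    (hD : SLR.IsFD (SLR.congInc N (n + 2)) D) :
    ∃ c₁ c₂ : ℝ, 0 ≤ c₁ ∧ 0 ≤ c₂ ∧
      (∀ A a, MeasurableSet A → 0 ≤ a → volume A = ENNReal.ofReal a →
        ∫⁻ g in D, primCount N v₀ A g ∂SLR.haar (n + 2) = ENNReal.ofReal (c₁ * a)) ∧
      ∀ A B a b, MeasurableSet A → MeasurableSet B → 0 ≤ a → 0 ≤ b →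
        volume A = ENNReal.ofReal a → volume B = ENNReal.ofReal b →
        ENNReal.ofReal (c₂ * (a * b)) ≤
          ∫⁻ g in D, primCount N v₀ A g * primCount N v₀ B g ∂SLR.haar (n + 2) ∧
        ∫⁻ g in D, primCount N v₀ A g * primCount N v₀ B g ∂SLR.haar (n + 2) ≤
          ENNReal.ofReal (c₂ * (a * b) + 2 * (c₁ * a)) := by
  obtain ⟨c₁, hc₁, h₁⟩ := exists_mean_one v₀ hD
  obtain ⟨c₂, hc₂, h₂⟩ := exists_mean_two v₀ hn hD
  have hone : ∀ A a, MeasurableSet A → 0 ≤ a → volume A = ENNReal.ofReal a →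
      ∫⁻ g in D, primCount N v₀ A g ∂SLR.haar (n + 2) = ENNReal.ofReal (c₁.toReal * a) := by
    intro A a hA ha hv
    rw [ENNReal.ofReal_mul ENNReal.toReal_nonneg, ENNReal.ofReal_toReal hc₁, ← hv]
    refine (h₁ _ (measurable_const.indicator hA)).trans ?_
    rw [lintegral_indicator_const hA, one_mul]
  refine ⟨c₁.toReal, c₂.toReal, ENNReal.toReal_nonneg, ENNReal.toReal_nonneg, hone, ?_⟩
  intro A B a b hA hB ha hb hva hvb
  have hpair : ∫⁻ g in D, pairCountIn N v₀ A B g ∂SLR.haar (n + 2)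
      = ENNReal.ofReal (c₂.toReal * (a * b)) := by
    rw [ENNReal.ofReal_mul ENNReal.toReal_nonneg, ENNReal.ofReal_toReal hc₂,
      ENNReal.ofReal_mul ha, ← hva, ← hvb]
    refine (h₂ _ (measurable_const.indicator (hA.prod hB))).trans ?_
    rw [lintegral_indicator_const (hA.prod hB), one_mul, Measure.volume_eq_prod,
      Measure.prod_prod]
  constructor
  · rw [← hpair]
    exact lintegral_mono fun g => pairCountIn_le N v₀ A B g
  · refine (lintegral_mono fun g => primCount_mul_le N v₀ A B g).trans ?_
    rw [lintegral_add_right _ ((measurable_primCount N v₀ hA).const_mul 2), hpair,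
      lintegral_const_mul _ (measurable_primCount N v₀ hA), hone A a hA ha hva,
      ENNReal.ofReal_add (by positivity) (by positivity), ENNReal.ofReal_mul zero_le_two,
      ENNReal.ofReal_ofNat]

end Variance

section VarianceBound

open Filter Topology

variable {n N : ℕ} [NeZero N] {v₀ : Fin (n + 2) → ℤ} {D : Set (SLR (n + 2))}

/-- The density of the primitive vectors in a congruence class. -/
noncomputable def primDensity (N d : ℕ) : ℝ := 1 / (N ^ d * copZeta N d)

theorem tendsto_primCount_closedBall (g : SLR (n + 2)) (hv₀ : Finset.univ.gcd v₀ = 1) :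
    Tendsto (fun k : ℕ => (ENNReal.ofReal (1 / (2 * ((k : ℝ) + 1)) ^ (n + 2)) *
      primCount N v₀ {y | ‖y‖ ≤ (k : ℝ) + 1} g).toReal) atTop (𝓝 (primDensity N (n + 2))) := by
  have hN : 0 < N := Nat.pos_of_ne_zero (NeZero.ne N)
  have h1 : Tendsto (fun k : ℕ => (k : ℝ) + 1) atTop atTop :=
    tendsto_atTop_add_const_right _ _ tendsto_natCast_atTop_atTop
  have h2 := ((tendsto_primBall (by omega : 2 ≤ n + 2) g hN hv₀).comp h1).const_mul
    (1 / (2 : ℝ) ^ (n + 2))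
  have h3 : 1 / (2 : ℝ) ^ (n + 2) * (2 ^ (n + 2) / (N ^ (n + 2) * copZeta N (n + 2)))
      = primDensity N (n + 2) := by
    rw [primDensity, div_mul_div_comm, one_mul, ← div_div, div_self (by positivity)]
  rw [h3] at h2
  refine h2.congr fun k => ?_
  rw [primCount_closedBall, ENNReal.toReal_mul, ENNReal.toReal_ofReal (by positivity),
    ENNReal.toReal_natCast, Function.comp_apply, mul_pow, div_mul_div_comm, one_mul,
    div_mul_eq_mul_div, one_mul]

theorem exists_variance_le (hn : 1 ≤ n) (hv₀ : Finset.univ.gcd v₀ = 1)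
    (hD : SLR.IsFD (SLR.congInc N (n + 2)) D) :
    ∃ C : ℝ, 0 ≤ C ∧ ∀ A a, MeasurableSet A → 0 < a → volume A = ENNReal.ofReal a →
      (∀ᵐ g ∂(SLR.haar (n + 2)).restrict D, primCount N v₀ A g < ∞) ∧
      Integrable (fun g => ((primCount N v₀ A g).toReal - primDensity N (n + 2) * a) ^ 2)
        ((SLR.haar (n + 2)).restrict D) ∧
      ∫ g in D, ((primCount N v₀ A g).toReal - primDensity N (n + 2) * a) ^ 2
        ∂SLR.haar (n + 2) ≤ C * a := by
  obtain ⟨c₁, c₂, hc₁, hc₂, h₁, h₂⟩ := exists_primCount_moments hn v₀ hD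
  set κ := primDensity N (n + 2) with hκ
  have hfinm : IsFiniteMeasure ((SLR.haar (n + 2)).restrict D) :=
    ⟨by rw [Measure.restrict_apply_univ]; exact SLR.haar_fd_lt_top hD⟩
  set m := (SLR.haar (n + 2)).restrict D with hm
  have hae : ∀ A a, MeasurableSet A → 0 ≤ a → volume A = ENNReal.ofReal a →
      ∀ᵐ g ∂m, primCount N v₀ A g < ∞ := fun A a hA ha hv =>
    ae_lt_top (measurable_primCount N v₀ hA) (by rw [h₁ A a hA ha hv]; exact ENNReal.ofReal_ne_top)
  have hL2 : ∀ A a, MeasurableSet A → 0 ≤ a → volume A = ENNReal.ofReal a →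
      MemLp (fun g => (primCount N v₀ A g).toReal) 2 m := fun A a hA ha hv =>
    memLp_two_toReal (measurable_primCount N v₀ hA) (by positivity) (h₂ A A a a hA hA ha ha hv hv).2
  have hI1 : ∀ A a, MeasurableSet A → 0 ≤ a → volume A = ENNReal.ofReal a →
      ∫ g, (primCount N v₀ A g).toReal ∂m = c₁ * a := fun A a hA ha hv => by
    rw [integral_toReal (measurable_primCount N v₀ hA).aemeasurable (hae A a hA ha hv),
      h₁ A a hA ha hv, ENNReal.toReal_ofReal (by positivity)]
  have hI2 : ∀ A B a b, MeasurableSet A → MeasurableSet B → 0 ≤ a → 0 ≤ b →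
      volume A = ENNReal.ofReal a → volume B = ENNReal.ofReal b →
      c₂ * (a * b) ≤ ∫ g, (primCount N v₀ A g).toReal * (primCount N v₀ B g).toReal ∂m ∧
      ∫ g, (primCount N v₀ A g).toReal * (primCount N v₀ B g).toReal ∂m ≤
        c₂ * (a * b) + 2 * (c₁ * a) := fun A B a b hA hB ha hb hva hvb => by
    rw [integral_toReal_mul_toReal (measurable_primCount N v₀ hA) (measurable_primCount N v₀ hB)
      (hae A a hA ha hva) (hae B b hB hb hvb)]
    obtain ⟨h3, h4⟩ := h₂ A B a b hA hB ha hb hva hvb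
    exact ⟨(ENNReal.ofReal_le_iff_le_toReal (ne_top_of_le_ne_top ENNReal.ofReal_ne_top h4)).1 h3,
      ENNReal.toReal_le_of_le_ofReal (by positivity) h4⟩
  let ball : ℕ → Set (Fin (n + 2) → ℝ) := fun k => {y | ‖y‖ ≤ (k : ℝ) + 1}
  let b : ℕ → ℝ := fun k => (2 * ((k : ℝ) + 1)) ^ (n + 2)
  have hballm : ∀ k, MeasurableSet (ball k) := fun k =>
    measurableSet_le measurable_norm measurable_const
  have hballv : ∀ k, volume (ball k) = ENNReal.ofReal (b k) := fun k =>
    Arr.volume_norm_le _ (by positivity)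
  have hb1 : ∀ k, 1 ≤ b k := fun k => one_le_pow₀ (by
    have : (0 : ℝ) ≤ k := Nat.cast_nonneg k
    linarith)
  have hb0 : ∀ k, 0 < b k := fun k => one_pos.trans_le (hb1 k)
  have hbtop : Tendsto b atTop atTop :=
    (tendsto_pow_atTop (by omega : n + 2 ≠ 0)).comp (Tendsto.const_mul_atTop two_pos
      (tendsto_atTop_add_const_right _ _ tendsto_natCast_atTop_atTop))
  let H : ℕ → SLR (n + 2) → ℝ≥0∞ := fun k g =>
    ENNReal.ofReal (1 / b k) * primCount N v₀ (ball k) g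
  have hHm : ∀ k, Measurable (H k) := fun k => (measurable_primCount N v₀ (hballm k)).const_mul _
  have hH2 : ∀ k, ∫⁻ g, H k g * H k g ∂m ≤ ENNReal.ofReal (c₂ + 2 * c₁ + 1) := fun k => by
    have h3 : ∀ g, H k g * H k g = ENNReal.ofReal (1 / b k * (1 / b k)) *
        (primCount N v₀ (ball k) g * primCount N v₀ (ball k) g) := fun g => by
      rw [ENNReal.ofReal_mul (by have := hb0 k; positivity)]
      exact mul_mul_mul_comm _ _ _ _
    simp_rw [h3]
    have hmm : Measurable fun g => primCount N v₀ (ball k) g * primCount N v₀ (ball k) g :=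
      (measurable_primCount N v₀ (hballm k)).mul (measurable_primCount N v₀ (hballm k))
    rw [lintegral_const_mul _ hmm]
    have h4 := (h₂ (ball k) (ball k) (b k) (b k) (hballm k) (hballm k) (hb0 k).le (hb0 k).le
      (hballv k) (hballv k)).2
    refine (mul_le_mul_right h4 _).trans ?_
    rw [← ENNReal.ofReal_mul (by have := hb0 k; positivity)]
    refine ENNReal.ofReal_le_ofReal ?_
    have h5 := hb0 k
    have h6 : 1 / b k ≤ 1 := by
      rw [div_le_one h5]
      exact hb1 k
    have h7 : 1 / b k * (1 / b k) * (c₂ * (b k * b k) + 2 * (c₁ * b k))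
        = c₂ + 2 * c₁ * (1 / b k) := by
      field_simp
    rw [h7]
    nlinarith
  have hweak : ∀ ψ : SLR (n + 2) → ℝ, MemLp ψ 2 m →
      Tendsto (fun k => ∫ g, ψ g * (H k g).toReal ∂m) atTop (𝓝 (κ * ∫ g, ψ g ∂m)) := fun ψ hψ =>
    tendsto_integral_mul_of_eLpNorm_two_le (B := (c₂ + 2 * c₁ + 1) ^ (1 / 2 : ℝ)) (by positivity)
      (fun k => (hHm k).ennreal_toReal.aestronglyMeasurable)
      (fun k => eLpNorm_two_toReal_le (by positivity) (hH2 k)) hψ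
      (Eventually.of_forall fun g => tendsto_primCount_closedBall g hv₀)
  have hHr : ∀ k g, (H k g).toReal = 1 / b k * (primCount N v₀ (ball k) g).toReal := fun k g => by
    change (ENNReal.ofReal (1 / b k) * _).toReal = _
    rw [ENNReal.toReal_mul, ENNReal.toReal_ofReal (by have := hb0 k; positivity)]
  have hV : c₁ = κ * m.real Set.univ := by
    have h3 := hweak (fun _ => 1) (memLp_const 1)
    rw [integral_const, smul_eq_mul, mul_one] at h3
    refine tendsto_nhds_unique (tendsto_const_nhds.congr fun k => ?_) h3
    simp_rw [hHr, one_mul]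
    rw [integral_const_mul, hI1 _ _ (hballm k) (hb0 k).le (hballv k)]
    have := hb0 k
    field_simp
  have hK : ∀ (A : Set (Fin (n + 2) → ℝ)) a, MeasurableSet A → 0 < a →
      volume A = ENNReal.ofReal a → c₂ * a = κ * (c₁ * a) := by
    intro A a hA ha hv
    have h3 := hweak _ (hL2 A a hA ha.le hv)
    rw [hI1 A a hA ha.le hv] at h3
    refine tendsto_nhds_unique ?_ h3
    have h4 : Tendsto (fun k => c₂ * a + 2 * (c₁ * a) / b k) atTop (𝓝 (c₂ * a + 0)) :=
      tendsto_const_nhds.add (tendsto_const_nhds.div_atTop hbtop)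
    rw [add_zero] at h4
    have h5 : ∀ k, ∫ g, (primCount N v₀ A g).toReal * (H k g).toReal ∂m = 1 / b k *
        ∫ g, (primCount N v₀ A g).toReal * (primCount N v₀ (ball k) g).toReal ∂m := fun k => by
      rw [← integral_const_mul]
      refine integral_congr_ae (Eventually.of_forall fun g => ?_)
      simp only [hHr]
      ring
    refine tendsto_of_tendsto_of_tendsto_of_le_of_le tendsto_const_nhds h4 (fun k => ?_)
      fun k => ?_
    · simp only [h5]
      have h6 := hb0 k
      rw [one_div, ← div_eq_inv_mul, le_div_iff₀ h6]
      exact le_trans (by rw [mul_assoc])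
          (hI2 A (ball k) a (b k) hA (hballm k) ha.le h6.le hv (hballv k)).1
    · simp only [h5]
      have h6 := hb0 k
      rw [one_div, ← div_eq_inv_mul, div_le_iff₀ h6]
      refine (hI2 A (ball k) a (b k) hA (hballm k) ha.le h6.le hv (hballv k)).2.trans_eq ?_
      field_simp
  refine ⟨2 * c₁, by positivity, fun A a hA ha hv => ⟨hae A a hA ha.le hv, ?_, ?_⟩⟩
  · exact ((hL2 A a hA ha.le hv).sub (memLp_const (κ * a))).integrable_sq
  · have hφ2 := (hL2 A a hA ha.le hv).integrable_sq
    have hφ1 : Integrable (fun g => (primCount N v₀ A g).toReal) m :=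
      (hL2 A a hA ha.le hv).integrable one_le_two
    have hexp : ∀ g, ((primCount N v₀ A g).toReal - κ * a) ^ 2 = (primCount N v₀ A g).toReal ^ 2 -
        2 * (κ * a) * (primCount N v₀ A g).toReal + (κ * a) ^ 2 := fun g => by ring
    simp_rw [hexp]
    have hs : Integrable (fun g => (primCount N v₀ A g).toReal ^ 2 -
        2 * (κ * a) * (primCount N v₀ A g).toReal) m := hφ2.sub (hφ1.const_mul _)
    rw [integral_add hs (integrable_const _),
      integral_sub hφ2 (hφ1.const_mul _), integral_const_mul, integral_const, smul_eq_mul,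
      hI1 A a hA ha.le hv]
    have h8 := (hI2 A A a a hA hA ha.le ha.le hv hv).2
    simp_rw [← sq] at h8
    have h9 := hK A a hA ha hv
    have h10 : c₂ * a ^ 2 = κ * c₁ * a ^ 2 := by linear_combination a * h9
    have h11 : m.real Set.univ * (κ * a) ^ 2 = κ * c₁ * a ^ 2 := by
      rw [hV]
      ring
    rw [h11]
    linarith

end VarianceBound

/-! ### From variance bounds to almost sure asymptotics -/

section Interpolation

open Filter Topology

theorem rpow_sub_rpow_le {a x : ℝ} (ha : 1 ≤ a) (hx : 1 ≤ x) :
    x ^ a - (x - 1) ^ a ≤ a * (x ^ a / x) := by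
  have hx0 : 0 < x := by linarith
  have h1 := one_add_mul_self_le_rpow_one_add (s := -1 / x)
    (by rw [le_div_iff₀ hx0]; linarith) ha
  have h2 : x - 1 = x * (1 + -1 / x) := by field_simp; ring
  rw [h2, Real.mul_rpow hx0.le (by
    have : 1 / x ≤ 1 := (div_le_one hx0).2 hx
    rw [neg_div]
    linarith)]
  have h3 := mul_le_mul_of_nonneg_left h1 (Real.rpow_nonneg hx0.le a)
  have h4 : x ^ a * (1 + a * (-1 / x)) = x ^ a - a * (x ^ a / x) := by field_simp; ring
  linarith

/-- Sandwiching between consecutive terms of the sequence `(k + 1) ^ (1 / (1 - δ))`. -/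
theorem exists_rpow_sandwich {δ T : ℝ} (hδ₀ : 0 < δ) (hδ₂ : δ < 1) (hT : 1 ≤ T) :
    ∃ k : ℕ, ((k : ℝ) + 1) ^ (1 / (1 - δ)) ≤ T ∧ T ≤ (((k + 1 : ℕ) : ℝ) + 1) ^ (1 / (1 - δ)) ∧
      (((k + 1 : ℕ) : ℝ) + 1) ^ (1 / (1 - δ)) ≤ 2 ^ (1 / (1 - δ)) * T ∧
      (((k + 1 : ℕ) : ℝ) + 1) ^ (1 / (1 - δ)) - ((k : ℝ) + 1) ^ (1 / (1 - δ)) ≤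
        1 / (1 - δ) * ((((k + 1 : ℕ) : ℝ) + 1) ^ (1 / (1 - δ))) ^ δ := by
  have h1δ : 0 < 1 - δ := by linarith
  have hT0 : 0 < T := by linarith
  set a := 1 / (1 - δ) with ha
  have ha0 : 0 < a := by positivity
  have ha1 : 1 ≤ a := by
    rw [ha, le_div_iff₀ h1δ]
    linarith
  have haδ : a * δ = a - 1 := by
    rw [ha]
    field_simp
    ring
  set y := T ^ (1 - δ) with hy
  have hya : y ^ a = T := by
    rw [hy, ← Real.rpow_mul hT0.le, ha, mul_one_div_cancel h1δ.ne', Real.rpow_one]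
  have hy1 : 1 ≤ y := Real.one_le_rpow hT h1δ.le
  have hfl : 1 ≤ ⌊y⌋₊ := (Nat.one_le_floor_iff y).2 hy1
  obtain ⟨k, hk⟩ := Nat.exists_eq_add_of_le' hfl
  have hle : (k : ℝ) + 1 ≤ y := by
    have := Nat.floor_le (by linarith : 0 ≤ y)
    rw [hk] at this
    exact_mod_cast this
  have hlt : y < ((k + 1 : ℕ) : ℝ) + 1 := by
    have := Nat.lt_floor_add_one y
    rw [hk] at this
    exact_mod_cast this
  have hk0 : (0 : ℝ) ≤ k := Nat.cast_nonneg k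
  have hkT : ((k : ℝ) + 1) ^ a ≤ T := by
    rw [← hya]
    exact Real.rpow_le_rpow (by positivity) hle ha0.le
  refine ⟨k, hkT, ?_, ?_, ?_⟩
  · rw [← hya]
    exact Real.rpow_le_rpow (by linarith) hlt.le ha0.le
  · refine le_trans ?_ (mul_le_mul_of_nonneg_left hkT (by positivity))
    rw [← Real.mul_rpow (by norm_num) (by positivity)]
    refine Real.rpow_le_rpow (by positivity) ?_ ha0.le
    push_cast
    linarith
  · have h5 := rpow_sub_rpow_le (a := a) (x := ((k + 1 : ℕ) : ℝ) + 1) ha1 (by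
      push_cast
      linarith)
    rw [← Real.rpow_mul (by positivity), haδ, Real.rpow_sub (by positivity), Real.rpow_one]
    push_cast at h5 ⊢
    rwa [add_sub_cancel_right] at h5

variable {X : Type*} [MeasurableSpace X] {m : Measure X} {Φ : ℝ → X → ℝ≥0∞} {κ δ : ℝ}

theorem ae_exists_abs_sub_le {C : ℝ} (hΦm : ∀ T > 0, Measurable (Φ T)) {t : ℕ → ℝ}
    (ht : ∀ k, 0 < t k) (hsum : Summable fun k => t k ^ (1 - 2 * δ))
    (hΦi : ∀ T > 0, Integrable (fun x => ((Φ T x).toReal - κ * T) ^ 2) m)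
    (hvar : ∀ T > 0, ∫ x, ((Φ T x).toReal - κ * T) ^ 2 ∂m ≤ C * T) :
    ∀ᵐ x ∂m, ∃ B : ℝ, 0 ≤ B ∧ ∀ k, |(Φ (t k) x).toReal - κ * t k| ≤ B * t k ^ δ := by
  let f : ℕ → X → ℝ≥0∞ := fun k x =>
    ENNReal.ofReal ((((Φ (t k) x).toReal - κ * t k) / t k ^ δ) ^ 2)
  have hf : ∀ k, Measurable (f k) := fun k =>
    ((((hΦm _ (ht k)).ennreal_toReal.sub_const _).div_const _).pow_const 2).ennreal_ofReal
  have hfint : ∀ k, ∫⁻ x, f k x ∂m ≤ ENNReal.ofReal (C * t k ^ (1 - 2 * δ)) := fun k => by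
    have h1 : ∀ x, (((Φ (t k) x).toReal - κ * t k) / t k ^ δ) ^ 2
        = ((Φ (t k) x).toReal - κ * t k) ^ 2 / (t k ^ δ) ^ 2 := fun x => div_pow _ _ _
    change ∫⁻ x, ENNReal.ofReal _ ∂m ≤ _
    rw [← ofReal_integral_eq_lintegral_ofReal
      (by simp_rw [h1]; exact (hΦi _ (ht k)).div_const _)
      (Eventually.of_forall fun x => sq_nonneg _)]
    refine ENNReal.ofReal_le_ofReal ?_
    simp_rw [h1]
    rw [integral_div, div_le_iff₀ (by have := ht k; positivity)]
    refine (hvar _ (ht k)).trans_eq ?_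
    rw [mul_assoc, ← Real.rpow_natCast, ← Real.rpow_mul (ht k).le, ← Real.rpow_add (ht k)]
    have h2 : 1 - 2 * δ + δ * ((2 : ℕ) : ℝ) = 1 := by
      push_cast
      ring
    rw [h2, Real.rpow_one]
  have htot : ∫⁻ x, ∑' k, f k x ∂m ≠ ∞ := by
    rw [lintegral_tsum fun k => (hf k).aemeasurable]
    refine ne_top_of_le_ne_top ?_ (ENNReal.tsum_le_tsum hfint)
    exact (hsum.mul_left C).tsum_ofReal_ne_top
  filter_upwards [ae_lt_top (Measurable.tsum hf) htot] with x hx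
  refine ⟨Real.sqrt (∑' k, f k x).toReal, Real.sqrt_nonneg _, fun k => ?_⟩
  have hpos : 0 < t k ^ δ := Real.rpow_pos_of_pos (ht k) δ
  rw [← div_le_iff₀ hpos]
  have h1 : (((Φ (t k) x).toReal - κ * t k) / t k ^ δ) ^ 2 ≤ (∑' k, f k x).toReal :=
    (ENNReal.ofReal_le_iff_le_toReal hx.ne).1 (ENNReal.le_tsum k)
  have h2 := Real.abs_le_sqrt h1
  rwa [abs_div, abs_of_pos hpos] at h2

theorem ae_exists_asymptotic {C : ℝ} (hδ₁ : 2 / 3 < δ) (hδ₂ : δ < 1) (hκ : 0 ≤ κ)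
    (hΦm : ∀ T > 0, Measurable (Φ T)) (hmono : ∀ T₁ T₂ x, 0 < T₁ → T₁ ≤ T₂ → Φ T₁ x ≤ Φ T₂ x)
    (hfin : ∀ T > 0, ∀ᵐ x ∂m, Φ T x < ∞)
    (hΦi : ∀ T > 0, Integrable (fun x => ((Φ T x).toReal - κ * T) ^ 2) m)
    (hvar : ∀ T > 0, ∫ x, ((Φ T x).toReal - κ * T) ^ 2 ∂m ≤ C * T) :
    ∀ᵐ x ∂m, ∃ C > (0 : ℝ), ∃ T₀ > (0 : ℝ), ∀ T : ℝ, T₀ ≤ T →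
      Φ T x ≤ ENNReal.ofReal (κ * T + C * T ^ δ) ∧
        ENNReal.ofReal (κ * T - C * T ^ δ) ≤ Φ T x := by
  have h1δ : 0 < 1 - δ := by linarith
  have hδ₀ : 0 < δ := by linarith
  set a := 1 / (1 - δ) with ha
  have ha0 : 0 < a := by positivity
  let t : ℕ → ℝ := fun k => ((k : ℝ) + 1) ^ a
  have ht : ∀ k, 0 < t k := fun k => Real.rpow_pos_of_pos (by positivity) a
  have hsum : Summable fun k => t k ^ (1 - 2 * δ) := by
    have h2 : a * (1 - 2 * δ) < -1 := by
      rw [ha, one_div_mul_eq_div, div_lt_iff₀ h1δ]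
      linarith
    refine ((summable_nat_add_iff 1).2 (Real.summable_nat_rpow.2 h2)).congr fun k => ?_
    push_cast
    exact Real.rpow_mul (by positivity) _ _
  have hfin' : ∀ᵐ x ∂m, ∀ k, Φ (t k) x < ∞ := ae_all_iff.2 fun k => hfin _ (ht k)
  filter_upwards [hfin', ae_exists_abs_sub_le hΦm ht hsum hΦi hvar] with x hx ⟨B, hB, hle⟩
  have hc : 1 ≤ ((2 : ℝ) ^ a) ^ δ :=
    Real.one_le_rpow (Real.one_le_rpow one_le_two ha0.le) hδ₀.le
  refine ⟨(κ * a + B) * ((2 : ℝ) ^ a) ^ δ + B + 1, by positivity, 1, one_pos, fun T hT => ?_⟩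
  have hT0 : 0 < T := by linarith
  obtain ⟨k, hk1, hk2, hk3, hk4⟩ := exists_rpow_sandwich hδ₀ hδ₂ hT
  rw [← ha] at hk1 hk2 hk3 hk4
  change t k ≤ T at hk1
  change T ≤ t (k + 1) at hk2
  change t (k + 1) ≤ _ at hk3
  change t (k + 1) - t k ≤ a * t (k + 1) ^ δ at hk4
  have hTδ : 0 < T ^ δ := Real.rpow_pos_of_pos hT0 δ
  have hXδ : t (k + 1) ^ δ ≤ ((2 : ℝ) ^ a) ^ δ * T ^ δ := by
    rw [← Real.mul_rpow (by positivity) hT0.le]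
    exact Real.rpow_le_rpow (ht _).le hk3 hδ₀.le
  have hYδ : t k ^ δ ≤ T ^ δ := Real.rpow_le_rpow (ht k).le hk1 hδ₀.le
  have hu := (abs_le.1 (hle (k + 1))).2
  have hl := (abs_le.1 (hle k)).1
  have e1 : κ * (t (k + 1) - t k) ≤ κ * (a * t (k + 1) ^ δ) := mul_le_mul_of_nonneg_left hk4 hκ
  have e2 : (κ * a + B) * t (k + 1) ^ δ ≤ (κ * a + B) * (((2 : ℝ) ^ a) ^ δ * T ^ δ) :=
    mul_le_mul_of_nonneg_left hXδ (by positivity)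
  have e3 : B * t k ^ δ ≤ B * T ^ δ := mul_le_mul_of_nonneg_left hYδ hB
  have e4 : κ * t k ≤ κ * T := mul_le_mul_of_nonneg_left hk1 hκ
  have e5 : κ * T ≤ κ * t (k + 1) := mul_le_mul_of_nonneg_left hk2 hκ
  have e6 : 0 ≤ B * t (k + 1) ^ δ := mul_nonneg hB (Real.rpow_nonneg (ht _).le δ)
  have e7 : 0 ≤ B * T ^ δ := by positivity
  constructor
  · refine (hmono _ _ x hT0 hk2).trans ?_
    rw [← ENNReal.ofReal_toReal (hx (k + 1)).ne]
    refine ENNReal.ofReal_le_ofReal ?_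
    linarith
  · refine le_trans ?_ (hmono _ _ x (ht k) hk1)
    rw [← ENNReal.ofReal_toReal (hx k).ne]
    refine ENNReal.ofReal_le_ofReal ?_
    linarith

end Interpolation

/-! ### Almost sure asymptotics of the counting function -/

section AlmostSure

variable {d N : ℕ}

theorem primCount_mul_congInc (v₀ : Fin d → ℤ) (A : Set (Fin d → ℝ)) (g : SLR d)
    (γ : (SLR.modN N d).ker) :
    primCount N v₀ A (g * SLR.congInc N d γ) = primCount N v₀ A g := by
  rw [primCount, primCount]
  refine Eq.trans (tsum_congr fun v => ?_) ((primCongPerm v₀ γ).tsum_eq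
    fun v : primCong N v₀ => A.indicator (fun _ => (1 : ℝ≥0∞)) (g • realVec v.1))
  rw [mul_smul]
  exact congrArg (fun y => A.indicator (fun _ => (1 : ℝ≥0∞)) (g • y)) (ofInt_smul_realVec γ.1 v.1)

theorem SLR.IsFD.ae_of_ae_restrict {L : Type*} [Group L] [Countable L] {ι : L →* SLR d}
    {D : Set (SLR d)} (hD : SLR.IsFD ι D) {θ : Measure (SLR d)} [θ.IsMulRightInvariant]
    {p : SLR d → Prop} (hp : ∀ g γ, p (g * ι γ) ↔ p g) (h : ∀ᵐ g ∂θ.restrict D, p g) :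
    ∀ᵐ g ∂θ, p g := by
  rw [ae_restrict_iff' hD.1] at h
  have h1 : ∀ᵐ g ∂θ, ∀ γ, g * ι γ ∈ D → p (g * ι γ) := ae_all_iff.2 fun γ =>
    (measurePreserving_mul_right θ (ι γ)).quasiMeasurePreserving.ae h
  filter_upwards [h1] with g hg
  obtain ⟨γ, hγ, _⟩ := hD.2 g
  exact (hp g γ).1 (hg γ hγ)

theorem copZeta_nonneg (N d : ℕ) : 0 ≤ copZeta N d := tsum_nonneg fun e => by
  split_ifs
  · positivity
  · exact le_rfl

theorem ae_primCount_asymptotic {n : ℕ} (hn : 1 ≤ n) (hN : N ≠ 0) {v₀ : Fin (n + 2) → ℤ}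
    (hv₀ : Finset.univ.gcd v₀ = 1) {δ : ℝ} (hδ₁ : 2 / 3 < δ) (hδ₂ : δ < 1)
    {A : ℝ → Set (Fin (n + 2) → ℝ)} (hmeas : ∀ T > (0 : ℝ), MeasurableSet (A T))
    (hvol : ∀ T > (0 : ℝ), volume (A T) = ENNReal.ofReal T)
    (hmono : ∀ T₁ T₂ : ℝ, 0 < T₁ → T₁ ≤ T₂ → A T₁ ⊆ A T₂)
    (ν : Measure (SLR (n + 2))) [ν.IsMulLeftInvariant] [SigmaFinite ν] :
    ∀ᵐ g ∂ν, ∃ C > (0 : ℝ), ∃ T₀ > (0 : ℝ), ∀ T : ℝ, T₀ ≤ T →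
      primCount N v₀ (A T) g ≤ ENNReal.ofReal (primDensity N (n + 2) * T + C * T ^ δ) ∧
        ENNReal.ofReal (primDensity N (n + 2) * T - C * T ^ δ) ≤ primCount N v₀ (A T) g := by
  have : NeZero N := ⟨hN⟩
  obtain ⟨D, hD⟩ := SLR.exists_isFD_congInc N (n + 2)
  obtain ⟨C, -, hC⟩ := exists_variance_le hn hv₀ hD
  refine null_of_null_right (SLR.haar_ne_zero (d := n + 2)) (hD.ae_of_ae_restrict
    (fun g γ => by simp only [primCount_mul_congInc]) ?_)
  refine ae_exists_asymptotic (Φ := fun T g => primCount N v₀ (A T) g) (C := C) hδ₁ hδ₂ ?_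
    (fun T hT => measurable_primCount N v₀ (hmeas T hT))
    (fun T₁ T₂ g h0 h => primCount_mono N v₀ (hmono T₁ T₂ h0 h) g)
    (fun T hT => (hC (A T) T (hmeas T hT) hT (hvol T hT)).1)
    (fun T hT => (hC (A T) T (hmeas T hT) hT (hvol T hT)).2.1)
    (fun T hT => (hC (A T) T (hmeas T hT) hT (hvol T hT)).2.2)
  have := copZeta_nonneg N (n + 2)
  rw [primDensity]
  positivity

theorem PrimeTup.zetaS_eq_copZeta (S : PrimeTup) {k : Fin S.s → ℕ} (hk : ∀ i, 0 < k i)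
    (hd : d ≠ 0) : S.zetaS d = copZeta (∏ i, S.p i ^ k i) d := by
  rw [PrimeTup.zetaS, copZeta, tsum_subtype S.NS fun m : ℕ => (1 : ℝ) / (m : ℝ) ^ d]
  refine tsum_congr fun e => ?_
  rcases eq_or_ne e 0 with rfl | he
  · rw [Set.indicator_of_notMem fun h => h.1.ne rfl]
    simp [hd]
  have hiff : e ∈ S.NS ↔ e.Coprime (∏ i, S.p i ^ k i) := by
    rw [Nat.coprime_prod_right_iff]
    refine (and_iff_right (Nat.pos_of_ne_zero he)).trans ⟨fun h i _ => ?_, fun h i => ?_⟩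
    · exact (Nat.coprime_pow_right_iff (hk i) _ _).2
        ((S.hp i).coprime_iff_not_dvd.2 (h i)).symm
    · exact (S.hp i).coprime_iff_not_dvd.1
        ((Nat.coprime_pow_right_iff (hk i) _ _).1 (h i (Finset.mem_univ i))).symm
  by_cases h : e ∈ S.NS
  · rw [Set.indicator_of_mem h, if_pos (hiff.1 h)]
  · rw [Set.indicator_of_notMem h, if_neg fun h' => h (hiff.2 h')]

end AlmostSure

open PrimeTup in
/-- **Counting primitive integer vectors in congruence classes** (Theorem 1.3).
Let `d ≥ 3`, `{A_T}` an increasing family of Borel sets in `ℝ^d` with `vol(A_T) = T`,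
`N = p₁^{k₁}⋯p_s^{k_s}` and `v₀` a primitive integer vector.  For any `δ ∈ (2/3, 1)` and
Haar-almost every `g ∈ SL_d(ℝ)`,
`#(g·P_{v₀,N}(ℤ^d) ∩ A_T) = T/(N^d ζ_S(d)) + O_g(T^δ)`. -/
theorem schmidt_counting_congruence_real
    (S : PrimeTup) (d : ℕ) (hd : 3 ≤ d) (δ : ℝ) (hδ₁ : 2/3 < δ) (hδ₂ : δ < 1)
    (A : ℝ → Set (Fin d → ℝ))
    (hmeas : ∀ T > (0:ℝ), MeasurableSet (A T))
    (hvol : ∀ T > (0:ℝ), volume (A T) = ENNReal.ofReal T)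
    (hmono : ∀ T₁ T₂ : ℝ, 0 < T₁ → T₁ ≤ T₂ → A T₁ ⊆ A T₂)
    (k : Fin S.s → ℕ) (hk : ∀ i, 0 < k i)
    (N : ℕ) (hN : N = ∏ i, S.p i ^ k i)
    (v₀ : Fin d → ℤ) (hv₀ : Finset.univ.gcd v₀ = 1)
    (P : Set (Fin d → ℤ))
    (hP : P = {v | Finset.univ.gcd v = 1 ∧ ∀ j, (N : ℤ) ∣ v j - v₀ j})
    (ν : Measure (SpecialLinearGroup (Fin d) ℝ))
    (hinv : ν.IsMulLeftInvariant) (hreg : ν.Regular)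
    (hfin : IsFiniteMeasureOnCompacts ν) (hne : ν ≠ 0) :
    ∀ᵐ g : SpecialLinearGroup (Fin d) ℝ ∂ν, ∃ C > (0:ℝ), ∃ T₀ > (0:ℝ), ∀ T : ℝ, T₀ ≤ T →
      (∑' v : P, (A T).indicator (fun _ => (1:ℝ≥0∞))
            ((g : Matrix (Fin d) (Fin d) ℝ).mulVec fun j => ((v : Fin d → ℤ) j : ℝ))) ≤
          ENNReal.ofReal (T / ((N : ℝ) ^ d * S.zetaS d) + C * T ^ δ) ∧
        ENNReal.ofReal (T / ((N : ℝ) ^ d * S.zetaS d) - C * T ^ δ) ≤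
          ∑' v : P, (A T).indicator (fun _ => (1:ℝ≥0∞))
            ((g : Matrix (Fin d) (Fin d) ℝ).mulVec fun j => ((v : Fin d → ℤ) j : ℝ)) := by
  obtain ⟨n, rfl⟩ : ∃ n, d = n + 2 := ⟨d - 2, by omega⟩
  have hN0 : N ≠ 0 := by
    rw [hN]
    exact Finset.prod_ne_zero_iff.2 fun i _ => pow_ne_zero _ (S.hp i).ne_zero
  have hsig : SigmaFinite ν := inferInstance
  have hz : ∀ T : ℝ, T / ((N : ℝ) ^ (n + 2) * S.zetaS (n + 2)) = primDensity N (n + 2) * T := by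
    intro T
    rw [S.zetaS_eq_copZeta hk (by omega), ← hN, primDensity, one_div_mul_eq_div]
  simp only [hz]
  subst hP
  exact ae_primCount_asymptotic (by omega) hN0 hv₀ hδ₁ hδ₂ hmeas hvol hmono ν
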